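/- Let A be a basic indecomposable artin algebra, C a connected component of the Auslander–Reiten quiver Γ_A, and Σ an infinite family of cycle-finite modules in C. Then one of the following holds: (i) the stable part _sC of C contains a stable tube D having infinitely many modules from Σ; (ii) the left stable part _lC of C contains a component D with an oriented cycle and an injective module such that the cyclic part _cD of D contains infinitely many modules from Σ; (iii) the right stable part _rC of C contains a component D with an oriented cycle and a projective module such that the cyclic part _cD of D contains infinitely many modules from Σ. -/

import Mathlib

/-!
Common framework: finite length modules over a ring, the radical of the module
category, cycles of indecomposable modules, Auslander-Reiten quivers,
translation quivers notions, and classes of artin algebras.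
Right `A`-modules are formalized as left `Aᵐᵒᵖ`-modules.
-/

universe u

/-- A bundled object of `mod R`: a finite length `R`-module. -/
structure ModA (R : Type u) [Ring R] : Type (u + 1) where
  M : Type u
  [acg : AddCommGroup M]
  [mod : Module R M]
  finLen : IsFiniteLength R M

attribute [instance] ModA.acg ModA.mod

/-- A bundled (not necessarily finite length) `R`-module. -/
structure RawMod (R : Type u) [Ring R] : Type (u + 1) where
  M : Type u
  [acg : AddCommGroup M]
  [mod : Module R M]

attribute [instance] RawMod.acg RawMod.mod

/-- A module is indecomposable iff it is nonzero and its endomorphism ring has no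
nontrivial idempotents. -/
def IsIndecMod (R : Type u) [Ring R] (M : Type u) [AddCommGroup M] [Module R M] : Prop :=
  Nontrivial M ∧ ∀ f : Module.End R M, f * f = f → f = 0 ∨ f = 1

namespace ModA

variable {R : Type u} [Ring R]

/-- Indecomposability of an object of `mod R`. -/
def IsIndec (X : ModA R) : Prop := IsIndecMod R X.M

/-- Isomorphism of objects of `mod R`. -/
def Iso (X Y : ModA R) : Prop := Nonempty (X.M ≃ₗ[R] Y.M)

end ModA

/-- Membership in the radical `rad(X, Y)` of the category `mod R`: a map `f : X → Y`
belongs to the radical iff for every indecomposable `Z` and all `g : Z → X`, `h : Y → Z`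
the composite `h ∘ f ∘ g` is not an isomorphism. -/
def InRad {R : Type u} [Ring R] {X Y : ModA R} (f : X.M →ₗ[R] Y.M) : Prop :=
  ∀ Z : ModA R, Z.IsIndec → ∀ (g : Z.M →ₗ[R] X.M) (h : Y.M →ₗ[R] Z.M),
    ¬Function.Bijective (h.comp (f.comp g))

/-- The powers `rad^n` of the radical of `mod R`. -/
def radPow (R : Type u) [Ring R] : ℕ → ∀ X Y : ModA R, AddSubgroup (X.M →ₗ[R] Y.M)
  | 0, _, _ => ⊤
  | n + 1, X, Y => AddSubgroup.closure
      {f | ∃ (Z : ModA R) (g : X.M →ₗ[R] Z.M) (h : Z.M →ₗ[R] Y.M),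
        InRad g ∧ h ∈ radPow R n Z Y ∧ f = h.comp g}

/-- Membership in the infinite radical `rad^∞ = ⋂ₙ radⁿ` of `mod R`. -/
def InRadInf {R : Type u} [Ring R] {X Y : ModA R} (f : X.M →ₗ[R] Y.M) : Prop :=
  ∀ n : ℕ, f ∈ radPow R n X Y

/-- A cycle in `ind R`: a sequence of nonzero nonisomorphisms
`M₀ → M₁ → ⋯ → M_{r-1} → M_r = M₀` between indecomposable modules. -/
structure ModCycle (R : Type u) [Ring R] : Type (u + 1) where
  len : ℕ
  len_pos : 0 < len
  obj : Fin (len + 1) → ModA R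
  obj_indec : ∀ i, (obj i).IsIndec
  closed : obj (Fin.last len) = obj 0
  hom : ∀ i : Fin len, (obj i.castSucc).M →ₗ[R] (obj i.succ).M
  hom_ne_zero : ∀ i, hom i ≠ 0
  hom_not_iso : ∀ i, ¬Function.Bijective (hom i)

/-- A cycle is finite if none of its homomorphisms lies in the infinite radical. -/
def ModCycle.IsFiniteCycle {R : Type u} [Ring R] (c : ModCycle R) : Prop :=
  ∀ i, ¬InRadInf (c.hom i)

/-- The cycle passes through the module `M`. -/
def ModCycle.Passes {R : Type u} [Ring R] (c : ModCycle R) (M : ModA R) : Prop :=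
  ∃ i, (c.obj i).Iso M

/-- A module is cycle-finite if it lies on a cycle and every cycle through it is finite. -/
def IsCycleFiniteModule {R : Type u} [Ring R] (M : ModA R) : Prop :=
  (∃ c : ModCycle R, c.Passes M) ∧ ∀ c : ModCycle R, c.Passes M → c.IsFiniteCycle

/-- A module is directing if it lies on no cycle. -/
def IsDirectingModule {R : Type u} [Ring R] (M : ModA R) : Prop :=
  ¬∃ c : ModCycle R, c.Passes M

section Irreducible

variable {R : Type u} [Ring R]

/-- `f` is a split monomorphism (a section). -/
def SplitMonoMap {X Y : ModA R} (f : X.M →ₗ[R] Y.M) : Prop :=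
  ∃ r : Y.M →ₗ[R] X.M, r.comp f = LinearMap.id

/-- `f` is a split epimorphism (a retraction). -/
def SplitEpiMap {X Y : ModA R} (f : X.M →ₗ[R] Y.M) : Prop :=
  ∃ s : Y.M →ₗ[R] X.M, f.comp s = LinearMap.id

/-- `f` is an irreducible homomorphism. -/
def IsIrred {X Y : ModA R} (f : X.M →ₗ[R] Y.M) : Prop :=
  ¬SplitMonoMap f ∧ ¬SplitEpiMap f ∧
    ∀ (Z : ModA R) (g : X.M →ₗ[R] Z.M) (h : Z.M →ₗ[R] Y.M), h.comp g = f →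
      SplitMonoMap g ∨ SplitEpiMap h

end Irreducible

/-- An almost split (Auslander-Reiten) sequence `0 → l → m → r → 0` in `mod R`. -/
structure AlmostSplitSeq (R : Type u) [Ring R] : Type (u + 1) where
  l : ModA R
  m : ModA R
  r : ModA R
  f : l.M →ₗ[R] m.M
  g : m.M →ₗ[R] r.M
  inj : Function.Injective f
  surj : Function.Surjective g
  exact : LinearMap.range f = LinearMap.ker g
  not_split : ¬SplitEpiMap g
  l_indec : l.IsIndec
  r_indec : r.IsIndec
  right_almost : ∀ (Z : ModA R) (h : Z.M →ₗ[R] r.M), ¬SplitEpiMap h →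
      ∃ h' : Z.M →ₗ[R] m.M, g.comp h' = h
  left_almost : ∀ (Z : ModA R) (h : l.M →ₗ[R] Z.M), ¬SplitMonoMap h →
      ∃ h' : m.M →ₗ[R] Z.M, h'.comp f = h

/-- `N ≅ τ M` for the Auslander-Reiten translation `τ = DTr`. -/
def IsTauOf {R : Type u} [Ring R] (N M : ModA R) : Prop :=
  ∃ s : AlmostSplitSeq R, s.l.Iso N ∧ s.r.Iso M

/-- The indecomposable objects of `mod R`. -/
def IndecModA (R : Type u) [Ring R] := {X : ModA R // X.IsIndec}

/-- Isomorphism is an equivalence relation on indecomposable modules. -/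
def isoSetoid (R : Type u) [Ring R] : Setoid (IndecModA R) where
  r X Y := X.1.Iso Y.1
  iseqv :=
    { refl := fun X => ⟨LinearEquiv.refl R X.1.M⟩
      symm := fun h => h.elim fun e => ⟨e.symm⟩
      trans := fun h h' => h.elim fun e => h'.elim fun e' => ⟨e.trans e'⟩ }

/-- The vertices of the Auslander-Reiten quiver `Γ_R`: isomorphism classes of
indecomposable modules in `mod R`. -/
def ARVertex (R : Type u) [Ring R] := Quotient (isoSetoid R)

/-- The vertex of `Γ_R` given by an indecomposable module. -/
def ARVertex.mk {R : Type u} [Ring R] (X : IndecModA R) : ARVertex R :=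
  Quotient.mk (isoSetoid R) X

section ARQuiver

variable {R : Type u} [Ring R]

/-- The arrows of the Auslander-Reiten quiver: `x → y` iff there is an irreducible
homomorphism between representatives. -/
def ARArrow (x y : ARVertex R) : Prop :=
  ∃ (X Y : IndecModA R) (f : X.1.M →ₗ[R] Y.1.M),
    IsIrred f ∧ ARVertex.mk X = x ∧ ARVertex.mk Y = y

/-- `TauRel x y` iff `x = τ y` in the Auslander-Reiten quiver. -/
def TauRel (x y : ARVertex R) : Prop :=
  ∃ X Y : IndecModA R, ARVertex.mk X = x ∧ ARVertex.mk Y = y ∧ IsTauOf X.1 Y.1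

/-- A vertex given by an (indecomposable) projective module. -/
def IsProjVertex (x : ARVertex R) : Prop :=
  ∃ X : IndecModA R, ARVertex.mk X = x ∧ Module.Projective R X.1.M

/-- A vertex given by an (indecomposable) injective module. -/
def IsInjVertex (x : ARVertex R) : Prop :=
  ∃ X : IndecModA R, ARVertex.mk X = x ∧ Module.Injective R X.1.M

/-- The vertex lies on an oriented cycle of `Γ_R`. -/
def OnARCycle (x : ARVertex R) : Prop := Relation.TransGen ARArrow x x

/-- An edge (arrow in either direction) of the underlying graph of `Γ_R`. -/
def ARStep (x y : ARVertex R) : Prop := ARArrow x y ∨ ARArrow y x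

/-- `D` is a connected component of the full subquiver of `Γ_R` on the vertex set `S`. -/
def IsComponentOf (S D : Set (ARVertex R)) : Prop :=
  D ⊆ S ∧ D.Nonempty ∧
    (∀ x ∈ D, ∀ y ∈ S, ARStep x y → y ∈ D) ∧
    ∀ x ∈ D, ∀ y ∈ D, Relation.ReflTransGen (fun a b => a ∈ S ∧ b ∈ S ∧ ARStep a b) x y

/-- `C` is a connected component of `Γ_R`. -/
def IsARComponent (C : Set (ARVertex R)) : Prop := IsComponentOf Set.univ C

/-- The vertex lies on an oriented cycle all of whose vertices belong to `S`. -/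
def OnCycleIn (S : Set (ARVertex R)) (x : ARVertex R) : Prop :=
  Relation.TransGen (fun a b => a ∈ S ∧ b ∈ S ∧ ARArrow a b) x x

/-- `Γ` is a connected component of the cyclic quiver `_cΓ_R` (a cyclic component). -/
def IsCyclicComponent (Γ : Set (ARVertex R)) : Prop :=
  IsComponentOf {x | OnARCycle x} Γ

/-- A vertex represented by a cycle-finite module. -/
def IsCycleFiniteVertex (x : ARVertex R) : Prop :=
  ∃ X : IndecModA R, ARVertex.mk X = x ∧ IsCycleFiniteModule X.1

/-- A vertex represented by a directing module. -/
def IsDirectingVertex (x : ARVertex R) : Prop :=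
  ∃ X : IndecModA R, ARVertex.mk X = x ∧ IsDirectingModule X.1

/-- A cycle-finite cyclic component: a cyclic component containing a cycle-finite module. -/
def IsCycleFiniteCyclicComponent (Γ : Set (ARVertex R)) : Prop :=
  IsCyclicComponent Γ ∧ ∃ x ∈ Γ, IsCycleFiniteVertex x

/-- A full translation subquiver is cyclic if each of its vertices lies on an oriented
cycle inside it. -/
def IsCyclicSub (S : Set (ARVertex R)) : Prop := ∀ x ∈ S, OnCycleIn S x

/-- A full translation subquiver is coherent: every projective vertex is the start of an
infinite sectional path inside it, and every injective vertex is the end of an infinite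
sectional path inside it. -/
def IsCoherentSub (S : Set (ARVertex R)) : Prop :=
  (∀ x ∈ S, IsProjVertex x → ∃ c : ℕ → ARVertex R, c 0 = x ∧ (∀ n, c n ∈ S) ∧
      (∀ n, ARArrow (c n) (c (n + 1))) ∧ ∀ n, ¬TauRel (c n) (c (n + 2))) ∧
  (∀ x ∈ S, IsInjVertex x → ∃ c : ℕ → ARVertex R, c 0 = x ∧ (∀ n, c n ∈ S) ∧
      (∀ n, ARArrow (c (n + 1)) (c n)) ∧ ∀ n, ¬TauRel (c (n + 2)) (c n))

/-- `S` is a convex subquiver of (the full subquiver on) `C`: every path in `C` with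
source and target in `S` has all its vertices in `S`. -/
def ConvexIn (C S : Set (ARVertex R)) : Prop :=
  ∀ (n : ℕ) (c : ℕ → ARVertex R), (∀ k ≤ n, c k ∈ C) →
    (∀ k < n, ARArrow (c k) (c (k + 1))) → c 0 ∈ S → c n ∈ S → ∀ k ≤ n, c k ∈ S

/-- `S` is the core of the almost acyclic component `C`: the finite convex subquiver of
`C` containing all vertices lying on oriented cycles in `C`. -/
def IsCoreOf (C S : Set (ARVertex R)) : Prop :=
  S ⊆ C ∧ S.Finite ∧ ConvexIn C S ∧ ∀ x ∈ C, OnCycleIn C x → x ∈ S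

/-- A component is almost acyclic if all but finitely many of its vertices do not lie on
oriented cycles. -/
def IsAlmostAcyclicComp (C : Set (ARVertex R)) : Prop := {x ∈ C | OnCycleIn C x}.Finite

/-- A component is almost cyclic if its cyclic part is cofinite. -/
def IsAlmostCyclicComp (C : Set (ARVertex R)) : Prop := {x ∈ C | ¬OnCycleIn C x}.Finite

/-- Two vertices lie in the same `τ`-orbit. -/
def TauConn (x y : ARVertex R) : Prop :=
  Relation.ReflTransGen (fun a b => TauRel a b ∨ TauRel b a) x y

/-- The left stable part of `C`: remove the `τ`-orbits of projective vertices. -/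
def leftStable (C : Set (ARVertex R)) : Set (ARVertex R) :=
  {x | x ∈ C ∧ ¬∃ y, TauConn x y ∧ IsProjVertex y}

/-- The right stable part of `C`: remove the `τ`-orbits of injective vertices. -/
def rightStable (C : Set (ARVertex R)) : Set (ARVertex R) :=
  {x | x ∈ C ∧ ¬∃ y, TauConn x y ∧ IsInjVertex y}

/-- The stable part of `C`. -/
def stablePart (C : Set (ARVertex R)) : Set (ARVertex R) := leftStable C ∩ rightStable C

end ARQuiver

/-- The arrows of the translation quiver `ℤA∞/(τ^r)`, with vertices indexed by the
`τ`-orbit coordinate in `ZMod r` and the quasi-length (minus one) in `ℕ`. -/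
def TubeArrow {r : ℕ} : ZMod r × ℕ → ZMod r × ℕ → Prop := fun u v =>
  (v.1 = u.1 ∧ v.2 = u.2 + 1) ∨ (v.1 = u.1 + 1 ∧ u.2 = v.2 + 1)

section Tube

variable {R : Type u} [Ring R]

/-- `T` is a stable tube of rank `r`, parametrized by `φ : ℤA∞/(τ^r) → Γ_R`. -/
def IsStableTubeVia (T : Set (ARVertex R)) (r : ℕ) (φ : ZMod r × ℕ → ARVertex R) : Prop :=
  0 < r ∧ Function.Injective φ ∧ Set.range φ = T ∧
    (∀ u v, TubeArrow u v → ARArrow (φ u) (φ v)) ∧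
    (∀ u v, ARArrow (φ u) (φ v) → TubeArrow u v) ∧
    ∀ (i : ZMod r) (n : ℕ), TauRel (φ (i - 1, n)) (φ (i, n))

/-- `T` is a stable tube. -/
def IsStableTube (T : Set (ARVertex R)) : Prop := ∃ r φ, IsStableTubeVia T r φ

end Tube

section Separating

variable {R : Type u} [Ring R]

/-- A family of vertices is generalized standard if `rad^∞` vanishes between its modules. -/
def GeneralizedStandardSet (U : Set (ARVertex R)) : Prop :=
  ∀ X Y : IndecModA R, ARVertex.mk X ∈ U → ARVertex.mk Y ∈ U →
    ∀ f : X.1.M →ₗ[R] Y.1.M, InRadInf f → f = 0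

/-- `S` is (isomorphic to) a composition factor (a subquotient) of `M`. -/
def IsCompFactorMod (R : Type u) [Ring R] (S : Type u) [AddCommGroup S] [Module R S]
    (M : Type u) [AddCommGroup M] [Module R M] : Prop :=
  ∃ N' N : Submodule R M, N' ≤ N ∧
    Nonempty ((↥N ⧸ N'.comap N.subtype) ≃ₗ[R] S)

/-- A family of vertices is sincere if every simple module is a composition factor of one
of its modules. -/
def SincereSet (U : Set (ARVertex R)) : Prop :=
  ∀ (S : Type u) [AddCommGroup S] [Module R S], IsSimpleModule R S →
    ∃ x ∈ U, ∃ X : IndecModA R, ARVertex.mk X = x ∧ IsCompFactorMod R S X.1.M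

/-- All homomorphisms from modules with vertex in `U` to modules with vertex in `V` vanish. -/
def HomVanish (U V : Set (ARVertex R)) : Prop :=
  ∀ X Y : IndecModA R, ARVertex.mk X ∈ U → ARVertex.mk Y ∈ V →
    ∀ f : X.1.M →ₗ[R] Y.1.M, f = 0

/-- Every homomorphism from a module in `U` to a module in `V` factors through the
additive closure of the modules in `W`. -/
def FactorsThrough (U W V : Set (ARVertex R)) : Prop :=
  ∀ X Y : IndecModA R, ARVertex.mk X ∈ U → ARVertex.mk Y ∈ V →
    ∀ f : X.1.M →ₗ[R] Y.1.M, ∃ (k : ℕ) (Z : Fin k → IndecModA R)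
      (g : ∀ i, X.1.M →ₗ[R] (Z i).1.M) (h : ∀ i, (Z i).1.M →ₗ[R] Y.1.M),
      (∀ i, ARVertex.mk (Z i) ∈ W) ∧ f = ∑ i, (h i).comp (g i)

/-- `cs` is a separating family of components of `Γ_R`. -/
def IsSeparatingFamily (cs : Set (Set (ARVertex R))) : Prop :=
  ∃ ps qs : Set (Set (ARVertex R)),
    (∀ C ∈ ps, IsARComponent C) ∧ (∀ C ∈ cs, IsARComponent C) ∧ (∀ C ∈ qs, IsARComponent C) ∧
    (∀ C, IsARComponent C → C ∈ ps ∨ C ∈ cs ∨ C ∈ qs) ∧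
    (∀ C ∈ ps, C ∉ cs ∧ C ∉ qs) ∧ (∀ C ∈ cs, C ∉ qs) ∧
    SincereSet (⋃₀ cs) ∧ GeneralizedStandardSet (⋃₀ cs) ∧
    HomVanish (⋃₀ qs) (⋃₀ ps) ∧ HomVanish (⋃₀ qs) (⋃₀ cs) ∧ HomVanish (⋃₀ cs) (⋃₀ ps) ∧
    FactorsThrough (⋃₀ ps) (⋃₀ cs) (⋃₀ qs)

end Separating

/-! ### Classes of algebras via their Auslander-Reiten quivers.
For a ring `B`, the category `mod B` of finitely generated right `B`-modules is
realized as the category of finite length left `Bᵐᵒᵖ`-modules. -/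

/-- An algebra is of finite representation type if it has only finitely many isomorphism
classes of indecomposable finitely generated (right) modules. -/
def IsFiniteRepTypeAlg (B : Type u) [Ring B] : Prop :=
  (Set.univ : Set (ARVertex Bᵐᵒᵖ)).Finite

/-- An algebra is cycle-finite if all cycles in `ind B` are finite. -/
def IsCycleFiniteAlg (B : Type u) [Ring B] : Prop :=
  ∀ c : ModCycle Bᵐᵒᵖ, c.IsFiniteCycle

/-- A generalized multicoil algebra: an algebra whose Auslander-Reiten quiver admits a
separating family of almost cyclic coherent components. -/
def IsGeneralizedMulticoilAlgebra (B : Type u) [Ring B] : Prop :=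
  ∃ cs : Set (Set (ARVertex Bᵐᵒᵖ)),
    (∀ C ∈ cs, IsARComponent C ∧ IsAlmostCyclicComp C ∧ IsCoherentSub C) ∧
    IsSeparatingFamily cs

/-- A generalized double tilted algebra: an algebra whose Auslander-Reiten quiver admits
a separating almost acyclic component (a connecting component). -/
def IsGeneralizedDoubleTiltedAlgebra (B : Type u) [Ring B] : Prop :=
  ∃ C : Set (ARVertex Bᵐᵒᵖ),
    IsARComponent C ∧ IsAlmostAcyclicComp C ∧ IsSeparatingFamily {C}

/-- A concealed canonical algebra: an algebra whose Auslander-Reiten quiver admits a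
separating family of stable tubes. -/
def IsConcealedCanonicalAlgebra (B : Type u) [Ring B] : Prop :=
  ∃ ts : Set (Set (ARVertex Bᵐᵒᵖ)), (∀ T ∈ ts, IsStableTube T) ∧ IsSeparatingFamily ts

/-- A generic module: an indecomposable module of infinite length with finite endolength. -/
def IsGenericModule (R : Type u) [Ring R] (N : RawMod R) : Prop :=
  IsIndecMod R N.M ∧ ¬IsFiniteLength R N.M ∧ IsFiniteLength (Module.End R N.M) N.M

/-- The endolength of a module: its length over its endomorphism ring. -/
noncomputable def endolength (R : Type u) [Ring R] (N : RawMod R) : WithBot ℕ∞ :=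
  Order.krullDim (Submodule (Module.End R N.M) N.M)

/-- Generic tameness in the sense of Crawley-Boevey: for each `d` there are only finitely
many isomorphism classes of generic (right) modules of endolength `d`. -/
def IsGenericallyTameAlg (B : Type u) [Ring B] : Prop :=
  ∀ d : ℕ, ∃ (k : ℕ) (T : Fin k → RawMod Bᵐᵒᵖ),
    ∀ N : RawMod Bᵐᵒᵖ, IsGenericModule Bᵐᵒᵖ N → endolength Bᵐᵒᵖ N = (d : ℕ∞) →
      ∃ i, Nonempty (N.M ≃ₗ[Bᵐᵒᵖ] (T i).M)

/-- A tame generalized multicoil algebra. -/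
def IsTameGeneralizedMulticoilAlgebra (B : Type u) [Ring B] : Prop :=
  IsGeneralizedMulticoilAlgebra B ∧ IsGenericallyTameAlg B

/-- A tame generalized double tilted algebra. -/
def IsTameGeneralizedDoubleTiltedAlgebra (B : Type u) [Ring B] : Prop :=
  IsGeneralizedDoubleTiltedAlgebra B ∧ IsGenericallyTameAlg B

/-! ### The quiver of an algebra, convex idempotents, basic and connected algebras -/

section AlgebraSide

variable (A : Type u) [Ring A]

/-- The Jacobson radical of `A` (as a left ideal; it is in fact two-sided). -/
def jacobsonRad : Ideal A := (⊥ : Ideal A).jacobson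

/-- The square of the Jacobson radical of `A`. -/
def jacobsonRadSq : Ideal A :=
  Ideal.span {x | ∃ a ∈ jacobsonRad A, ∃ b ∈ jacobsonRad A, x = a * b}

/-- A primitive idempotent of `A`. -/
def IsPrimitiveIdempotent (e : A) : Prop :=
  IsIdempotentElem e ∧ e ≠ 0 ∧
    ∀ f g : A, IsIdempotentElem f → IsIdempotentElem g → f * g = 0 → g * f = 0 →
      e = f + g → f = 0 ∨ g = 0

/-- A complete family of pairwise orthogonal primitive idempotents of `A`; its indices
are the vertices of the quiver `Q_A` of `A`. -/
structure CompleteIdemFamily (A : Type u) [Ring A] where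
  n : ℕ
  e : Fin n → A
  prim : ∀ i, IsPrimitiveIdempotent A (e i)
  orth : ∀ i j, i ≠ j → e i * e j = 0
  total : ∑ i, e i = 1

/-- There is an arrow `i → j` in the quiver `Q_A` iff `e_i (rad A) e_j ⊄ (rad A)²`. -/
def QAarrow (E : CompleteIdemFamily A) (i j : Fin E.n) : Prop :=
  ∃ y ∈ jacobsonRad A, E.e i * y * E.e j ∉ jacobsonRadSq A

/-- A set of vertices of `Q_A` is convex if every path of `Q_A` with source and target in
it has all its vertices in it. -/
def ConvexVertexSet (E : CompleteIdemFamily A) (S : Set (Fin E.n)) : Prop :=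
  ∀ (n : ℕ) (c : ℕ → Fin E.n), (∀ k < n, QAarrow A E (c k) (c (k + 1))) →
    c 0 ∈ S → c n ∈ S → ∀ k ≤ n, c k ∈ S

/-- A convex idempotent of `A`: a sum of pairwise orthogonal primitive idempotents
corresponding to the vertices of a convex subquiver of `Q_A`. -/
def IsConvexIdempotent (e : A) : Prop :=
  ∃ (E : CompleteIdemFamily A) (S : Finset (Fin E.n)),
    ConvexVertexSet A E ↑S ∧ e = ∑ i ∈ S, E.e i

/-- The corner `eAe` of `A` at an idempotent `e`, as a nonunital subring (it is a unital
ring with unit `e`). -/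
def cornerRing (e : A) : NonUnitalSubring A where
  carrier := {x | e * x = x ∧ x * e = x}
  zero_mem' := by simp
  add_mem' := by
    rintro a b ⟨ha1, ha2⟩ ⟨hb1, hb2⟩
    constructor
    · rw [mul_add, ha1, hb1]
    · rw [add_mul, ha2, hb2]
  neg_mem' := by
    rintro a ⟨ha1, ha2⟩
    constructor
    · rw [mul_neg, ha1]
    · rw [neg_mul, ha2]
  mul_mem' := by
    rintro a b ⟨ha1, ha2⟩ ⟨hb1, hb2⟩
    constructor
    · rw [← mul_assoc, ha1]
    · rw [mul_assoc, hb2]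

/-- An (indecomposable =) connected algebra: no nontrivial central idempotents. -/
def IsConnectedAlgebra : Prop :=
  Nontrivial A ∧ ∀ e : A, IsIdempotentElem e → e ∈ Set.center A → e = 0 ∨ e = 1

/-- A basic algebra: distinct orthogonal primitive idempotents have nonisomorphic
associated indecomposable projective right modules. -/
def IsBasicAlgebra : Prop :=
  ¬∃ e f : A, IsPrimitiveIdempotent A e ∧ IsPrimitiveIdempotent A f ∧
    e * f = 0 ∧ f * e = 0 ∧
    Nonempty ((Submodule.span Aᵐᵒᵖ {e} : Submodule Aᵐᵒᵖ A) ≃ₗ[Aᵐᵒᵖ]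
      (Submodule.span Aᵐᵒᵖ {f} : Submodule Aᵐᵒᵖ A))

end AlgebraSide

/-! ### Support algebras and faithful algebras of families of vertices -/

section Support

variable (A : Type u) [Ring A]

/-- The radical of a module: the intersection of its maximal submodules. -/
def modRadical (R : Type u) [Ring R] (M : Type u) [AddCommGroup M] [Module R M] :
    Submodule R M :=
  sInf {N | IsCoatom N}

/-- The intersection `ann_A(Γ)` of the annihilators of all right `A`-modules whose
vertices belong to `Γ`, as a two-sided ideal of `A`. -/
def annTwoSidedIdeal (Γ : Set (ARVertex Aᵐᵒᵖ)) : TwoSidedIdeal A :=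
  TwoSidedIdeal.mk'
    {a | ∀ x ∈ Γ, ∀ X : IndecModA Aᵐᵒᵖ, ARVertex.mk X = x →
      ∀ m : X.1.M, MulOpposite.op a • m = 0}
    (by intro x _ X _ m; simp)
    (by
      intro a b ha hb x hx X hX m
      have : MulOpposite.op (a + b) • m = MulOpposite.op a • m + MulOpposite.op b • m := by
        rw [← add_smul]; rfl
      rw [this, ha x hx X hX m, hb x hx X hX m, add_zero])
    (by
      intro a ha x hx X hX m
      have : MulOpposite.op (-a) • m = -(MulOpposite.op a • m) := by
        rw [← neg_smul]; rfl
      rw [this, ha x hx X hX m, neg_zero])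
    (by
      intro a b hb x hx X hX m
      have : MulOpposite.op (a * b) • m = MulOpposite.op b • (MulOpposite.op a • m) := by
        rw [← mul_smul]; rfl
      rw [this, hb x hx X hX _])
    (by
      intro a b ha x hx X hX m
      have : MulOpposite.op (a * b) • m = MulOpposite.op b • (MulOpposite.op a • m) := by
        rw [← mul_smul]; rfl
      rw [this, ha x hx X hX m, smul_zero])

/-- The faithful algebra `B(Γ) = A / ann_A(Γ)` of a family `Γ` of vertices of `Γ_A`. -/
abbrev faithfulAlg (Γ : Set (ARVertex Aᵐᵒᵖ)) : Type u :=
  (annTwoSidedIdeal A Γ).ringCon.Quotient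

/-- The canonical projection `A → B(Γ)`. -/
def faithfulProj (Γ : Set (ARVertex Aᵐᵒᵖ)) : A →+* faithfulAlg A Γ :=
  RingCon.mk' (annTwoSidedIdeal A Γ).ringCon

/-- The trace ideal `t_A(Γ)`: the two-sided ideal of `A` generated by the images of all
homomorphisms of right `A`-modules from `Q` to `A`. -/
def traceIdeal (Q : Submodule Aᵐᵒᵖ A) : TwoSidedIdeal A :=
  TwoSidedIdeal.span (⋃ f : ↥Q →ₗ[Aᵐᵒᵖ] A, Set.range f)

/-- A decomposition `A = P_Γ ⊕ Q_Γ` of `A` in `mod A` such that the simple summands of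
`P_Γ / rad P_Γ` are exactly the simple composition factors of the modules in `Γ`. -/
structure GammaDecomp (A : Type u) [Ring A] (Γ : Set (ARVertex Aᵐᵒᵖ)) where
  P : Submodule Aᵐᵒᵖ A
  Q : Submodule Aᵐᵒᵖ A
  compl : IsCompl P Q
  top_factors : ∀ (S : Type u) [AddCommGroup S] [Module Aᵐᵒᵖ S], IsSimpleModule Aᵐᵒᵖ S →
    (IsCompFactorMod Aᵐᵒᵖ S (↥P ⧸ modRadical Aᵐᵒᵖ ↥P) ↔
      ∃ x ∈ Γ, ∃ X : IndecModA Aᵐᵒᵖ, ARVertex.mk X = x ∧ IsCompFactorMod Aᵐᵒᵖ S X.1.M)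

end Support

/-- Restriction of scalars along a surjective ring homomorphism `π : A → B` identifies a
vertex `y` of `Γ_B` with a vertex `x` of `Γ_A`: representatives have the same underlying
group, with the `A`-action obtained from the `B`-action through `π`. -/
def VertexRestrictsTo {A B : Type u} [Ring A] [Ring B] (π : A →+* B)
    (y : ARVertex Bᵐᵒᵖ) (x : ARVertex Aᵐᵒᵖ) : Prop :=
  ∃ (N : IndecModA Bᵐᵒᵖ) (X : IndecModA Aᵐᵒᵖ), ARVertex.mk N = y ∧ ARVertex.mk X = x ∧
    ∃ e : X.1.M ≃+ N.1.M, ∀ (a : A) (m : X.1.M),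
      e (MulOpposite.op a • m) = MulOpposite.op (π a) • e m

/-! ### `K`-module structures on Hom-groups, lengths, and Ext -/

section KLength

variable (K B : Type u) [CommRing K] [Ring B] [Algebra K B]
variable (X N : Type u) [AddCommGroup X] [Module B X] [AddCommGroup N] [Module B N]

/-- The action of `K` on `B`-linear maps, through `algebraMap K B`. -/
def homKSMul (k : K) (f : X →ₗ[B] N) : X →ₗ[B] N where
  toFun x := algebraMap K B k • f x
  map_add' x y := by show algebraMap K B k • f (x + y) = _; rw [map_add, smul_add]
  map_smul' b x := by
    simp only [map_smul, RingHom.id_apply, smul_smul]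
    rw [Algebra.commutes]

/-- The `K`-module structure on the group of `B`-linear maps. -/
def homKModule : Module K (X →ₗ[B] N) where
  smul := homKSMul K B X N
  one_smul f := LinearMap.ext fun x => by
    show algebraMap K B 1 • f x = f x
    rw [map_one, one_smul]
  mul_smul k l f := LinearMap.ext fun x => by
    show algebraMap K B (k * l) • f x = algebraMap K B k • algebraMap K B l • f x
    rw [map_mul, mul_smul]
  smul_zero k := LinearMap.ext fun x => by
    show algebraMap K B k • (0 : X →ₗ[B] N) x = 0
    simp
  smul_add k f g := LinearMap.ext fun x => by
    show algebraMap K B k • (f + g) x = algebraMap K B k • f x + algebraMap K B k • g x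
    simp [smul_add]
  add_smul k l f := LinearMap.ext fun x => by
    show algebraMap K B (k + l) • f x = algebraMap K B k • f x + algebraMap K B l • f x
    rw [map_add, add_smul]
  zero_smul f := LinearMap.ext fun x => by
    show algebraMap K B 0 • f x = 0
    rw [map_zero, zero_smul]

/-- The length `|Hom_B(X, N)|` of the group of `B`-linear maps `X → N` as a `K`-module. -/
noncomputable def homKLength : WithBot ℕ∞ :=
  letI : Module K (X →ₗ[B] N) := homKModule K B X N
  Order.krullDim (Submodule K (X →ₗ[B] N))

/-- The canonical surjection from the free module on (the underlying set of) `X` to `X`. -/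
noncomputable def freeCover : (X →₀ B) →ₗ[B] X :=
  Finsupp.linearCombination B id

/-- The length `|Ext¹_B(X, N)|` of `Ext¹` as a `K`-module, computed as the cokernel of
`Hom_B(F, N) → Hom_B(Ω X, N)` for the canonical free cover `F → X` with kernel `Ω X`. -/
noncomputable def ext1KLength : WithBot ℕ∞ :=
  letI : Module K (↥(LinearMap.ker (freeCover B X)) →ₗ[B] N) :=
    homKModule K B (↥(LinearMap.ker (freeCover B X))) N
  let D : Submodule K (↥(LinearMap.ker (freeCover B X)) →ₗ[B] N) :=
    { carrier := {f | ∃ g : (X →₀ B) →ₗ[B] N,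
        f = g.comp (LinearMap.ker (freeCover B X)).subtype}
      add_mem' := by
        rintro f₁ f₂ ⟨g₁, rfl⟩ ⟨g₂, rfl⟩
        exact ⟨g₁ + g₂, rfl⟩
      zero_mem' := ⟨0, rfl⟩
      smul_mem' := by
        rintro k f ⟨g, rfl⟩
        exact ⟨homKSMul K B _ N k g, rfl⟩ }
  Order.krullDim (Submodule K ((↥(LinearMap.ker (freeCover B X)) →ₗ[B] N) ⧸ D))

end KLength

/-- Vanishing of `Ext¹_B(X, N)`: every short exact sequence `0 → N → E → X → 0` splits. -/
def Ext1IsZero (B : Type u) [Ring B] (X : Type u) [AddCommGroup X] [Module B X]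
    (N : Type u) [AddCommGroup N] [Module B N] : Prop :=
  ∀ (E : Type u) [AddCommGroup E] [Module B E], ∀ (f : N →ₗ[B] E) (g : E →ₗ[B] X),
    Function.Injective f → Function.Surjective g → LinearMap.range f = LinearMap.ker g →
    ∃ s : X →ₗ[B] E, g.comp s = LinearMap.id

/-- The syzygy `Ω X`: the kernel of the canonical free cover of `X`. -/
noncomputable def syzygyRaw (B : Type u) [Ring B] (X : RawMod B) : RawMod B :=
  ⟨↥(LinearMap.ker (freeCover B X.M))⟩

/-- Iterated syzygies. -/
noncomputable def syzygyIter (B : Type u) [Ring B] : ℕ → RawMod B → RawMod B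
  | 0, X => X
  | n + 1, X => syzygyRaw B (syzygyIter B n X)

/-- Vanishing of `Ext^r_B(X, N)` for `r ≥ 1`, via `Ext^r(X, N) ≅ Ext¹(Ω^{r-1} X, N)`. -/
noncomputable def ExtIsZero (B : Type u) [Ring B] (X N : RawMod B) (r : ℕ) : Prop :=
  Ext1IsZero B (syzygyIter B (r - 1) X).M N.M

/-- `[X] = [M]` in the Grothendieck group `K₀`: the modules `X` and `M` have the same
composition factors including multiplicities. -/
def SameCompFactors {B : Type u} [Ring B] (X M : ModA B) : Prop :=
  ∃ (n : ℕ) (s : Fin (n + 1) → Submodule B X.M) (t : Fin (n + 1) → Submodule B M.M)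
    (σ : Equiv.Perm (Fin n)),
    s 0 = ⊥ ∧ s (Fin.last n) = ⊤ ∧ t 0 = ⊥ ∧ t (Fin.last n) = ⊤ ∧
    (∀ i : Fin n, s i.castSucc ≤ s i.succ) ∧ (∀ i : Fin n, t i.castSucc ≤ t i.succ) ∧
    ∀ i : Fin n,
      IsSimpleModule B (↥(s i.succ) ⧸ (s i.castSucc).comap (s i.succ).subtype) ∧
      Nonempty ((↥(s i.succ) ⧸ (s i.castSucc).comap (s i.succ).subtype) ≃ₗ[B]
        (↥(t (σ i).succ) ⧸ (t (σ i).castSucc).comap (t (σ i).succ).subtype))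

/-- A torsion class in `mod B`: a class of modules closed under factor modules and
extensions. -/
def IsTorsionClass (B : Type u) [Ring B] (T : Set (ModA B)) : Prop :=
  (∀ M ∈ T, ∀ (N : ModA B) (g : M.M →ₗ[B] N.M), Function.Surjective g → N ∈ T) ∧
  ∀ (X E M : ModA B) (f : X.M →ₗ[B] E.M) (g : E.M →ₗ[B] M.M),
    Function.Injective f → Function.Surjective g → LinearMap.range f = LinearMap.ker g →
    X ∈ T → M ∈ T → E ∈ T

/-- A torsion class is functorially finite iff it is of the form `Fac(M)`. -/
def IsFunctoriallyFinite (B : Type u) [Ring B] (T : Set (ModA B)) : Prop :=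
  ∃ M : ModA B,
    T = {N | ∃ (k : ℕ) (g : (Fin k → M.M) →ₗ[B] N.M), Function.Surjective g}

/-- A module `M` is `τ`-rigid if `Hom(M, τM) = 0`. -/
def IsTauRigid {B : Type u} [Ring B] (M : ModA B) : Prop :=
  ∀ N : ModA B, IsTauOf N M → ∀ f : M.M →ₗ[B] N.M, f = 0

/-- A module `M` is rigid if `Ext¹(M, M) = 0`. -/
def IsRigid {B : Type u} [Ring B] (M : ModA B) : Prop := Ext1IsZero B M.M M.M

/-- `α(M) ≤ 2`: the middle term of any almost split sequence ending at `M` has at most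
two indecomposable direct summands. -/
def AlphaLe2 {B : Type u} [Ring B] (M : ModA B) : Prop :=
  ∀ s : AlmostSplitSeq B, s.r.Iso M →
    ∀ (k : ℕ) (N : Fin k → Submodule B s.m.M),
      (∀ i, IsIndecMod B ↥(N i)) → iSupIndep N → (⨆ i, N i) = ⊤ → k ≤ 2

namespace CF

open Relation

/-- abstract translation quivers with length function -/
structure TQ (V : Type*) where
  arr : V → V → Prop
  tau : V → V → Prop
  len : V → ℕ
  tau_fun : ∀ {x x' y}, tau x y → tau x' y → x = x'
  tau_inj : ∀ {x y y'}, tau x y → tau x y' → y = y'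
  arr_tau : ∀ {x y}, tau x y → ∀ z, arr x z ↔ arr z y
  pred_ne : ∀ {x y}, tau x y → ∃ z, arr z y
  proj_fin : {p | ¬∃ x, tau x p}.Finite
  inj_fin : {p | ¬∃ x, tau p x}.Finite
  pred_fin : ∀ y, {x | arr x y}.Finite
  succ_fin : ∀ y, {x | arr y x}.Finite
  len_pos : ∀ x, 0 < len x
  mesh : ∀ {x y}, tau x y → ∀ S : Finset V, (∀ z ∈ S, arr z y) →
    ∑ z ∈ S, len z ≤ len x + len y
  hs : ∀ b : ℕ, ∃ N : ℕ, ∀ c : ℕ → V, (∀ i < N, arr (c i) (c (i + 1))) →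
    (∀ i, i + 1 < N → ¬tau (c i) (c (i + 2))) → ∃ i ≤ N, b < len (c i)

namespace TQ

variable {V : Type*} (T : TQ V)

/-- opposite -/
def op : TQ V where
  arr x y := T.arr y x
  tau x y := T.tau y x
  len := T.len
  tau_fun h h' := T.tau_inj h h'
  tau_inj h h' := T.tau_fun h h'
  arr_tau h z := (T.arr_tau h z).symm
  pred_ne h := by
    obtain ⟨z, hz⟩ := T.pred_ne h
    exact ⟨z, (T.arr_tau h z).2 hz⟩
  proj_fin := T.inj_fin
  inj_fin := T.proj_fin
  pred_fin := T.succ_fin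
  succ_fin := T.pred_fin
  len_pos := T.len_pos
  mesh h S hS := by
    rw [add_comm]
    exact T.mesh h S fun z hz => (T.arr_tau h z).1 (hS z hz)
  hs b := by
    obtain ⟨N, hN⟩ := T.hs b
    refine ⟨N, fun c h1 h2 => ?_⟩
    obtain ⟨i, hi, hb⟩ := hN (fun i => c (N - i)) (fun i hi => by
        have := h1 (N - (i + 1)) (by omega)
        rwa [show N - (i + 1) + 1 = N - i by omega] at this)
      (fun i hi => by
        have := h2 (N - (i + 2)) (by omega)
        rwa [show N - (i + 2) + 2 = N - i by omega] at this)
    exact ⟨N - i, by omega, hb⟩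

@[simp] theorem op_arr (x y : V) : T.op.arr x y ↔ T.arr y x := Iff.rfl
@[simp] theorem op_tau (x y : V) : T.op.tau x y ↔ T.tau y x := Iff.rfl

/-- arrow either way -/
def step (a b : V) : Prop := T.arr a b ∨ T.arr b a

/-- component -/
def IsComp (S D : Set V) : Prop :=
  D ⊆ S ∧ D.Nonempty ∧ (∀ x ∈ D, ∀ y ∈ S, T.step x y → y ∈ D) ∧
    ∀ x ∈ D, ∀ y ∈ D, ReflTransGen (fun a b => a ∈ S ∧ b ∈ S ∧ T.step a b) x y

/-- arrows inside -/
def arrIn (D : Set V) (a b : V) : Prop := a ∈ D ∧ b ∈ D ∧ T.arr a b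

/-- on cycle -/
def OnCyc (D : Set V) (x : V) : Prop := TransGen (T.arrIn D) x x

/-- orbit relation -/
def conn (x y : V) : Prop := ReflTransGen (fun a b => T.tau a b ∨ T.tau b a) x y

/-- left stable vertices -/
def LS : Set V := {x | ¬∃ y, T.conn x y ∧ ¬∃ z, T.tau z y}

variable {T}

theorem rtg_symm {r : V → V → Prop} (hr : ∀ a b, r a b → r b a) {x y : V}
    (h : ReflTransGen r x y) : ReflTransGen r y x := by
  induction h with
  | refl => exact ReflTransGen.refl
  | tail _ h ih => exact ReflTransGen.head (hr _ _ h) ih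

theorem rtg_mono {r r' : V → V → Prop} (hr : ∀ a b, r a b → r' a b) {x y : V}
    (h : ReflTransGen r x y) : ReflTransGen r' x y := by
  induction h with
  | refl => exact ReflTransGen.refl
  | tail _ h ih => exact ih.tail (hr _ _ h)

theorem tg_mono {r r' : V → V → Prop} (hr : ∀ a b, r a b → r' a b) {x y : V}
    (h : TransGen r x y) : TransGen r' x y := by
  induction h with
  | single h => exact TransGen.single (hr _ _ h)
  | tail _ h ih => exact ih.tail (hr _ _ h)

theorem conn.symm {x y : V} (h : T.conn x y) : T.conn y x := by
  exact rtg_symm (fun a b h => Or.symm h) h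

theorem conn_tau {x y : V} (h : T.tau x y) : T.conn x y := ReflTransGen.single (Or.inl h)

theorem conn.trans' {x y z : V} (h : T.conn x y) (h' : T.conn y z) : T.conn x z :=
  ReflTransGen.trans h h'

theorem conn_op {x y : V} : T.op.conn x y ↔ T.conn x y := by
  constructor <;> intro h
  · exact rtg_mono (fun a b h => Or.symm h) h
  · exact rtg_mono (fun a b h => Or.symm h) h

theorem LS_conn {x y : V} (hx : x ∈ T.LS) (h : T.conn x y) : y ∈ T.LS := by
  rintro ⟨z, hz, hp⟩
  exact hx ⟨z, h.trans' hz, hp⟩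

variable (T)

open Classical in
/-- translation as a total function -/
noncomputable def t (x : V) : V := if h : ∃ z, T.tau z x then h.choose else x

variable {T}

theorem t_eq {x y : V} (h : T.tau x y) : T.t y = x := by
  have h' : ∃ z, T.tau z y := ⟨x, h⟩
  rw [t, dif_pos h']
  exact T.tau_fun h'.choose_spec h

theorem t_spec {x : V} (hx : x ∈ T.LS) : T.tau (T.t x) x := by
  have h : ∃ z, T.tau z x := by
    by_contra h
    exact hx ⟨x, ReflTransGen.refl, h⟩
  obtain ⟨z, hz⟩ := h
  rwa [t_eq hz]

theorem t_mem {x : V} (hx : x ∈ T.LS) : T.t x ∈ T.LS :=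
  LS_conn hx (conn_tau (t_spec hx)).symm

theorem tk_mem {x : V} (hx : x ∈ T.LS) (k : ℕ) : T.t^[k] x ∈ T.LS := by
  induction k with
  | zero => exact hx
  | succ k ih => rw [Function.iterate_succ_apply']; exact t_mem ih

theorem tk_conn {x : V} (hx : x ∈ T.LS) (k : ℕ) : T.conn x (T.t^[k] x) := by
  induction k with
  | zero => exact ReflTransGen.refl
  | succ k ih =>
    rw [Function.iterate_succ_apply']
    exact ih.trans' (conn_tau (t_spec (tk_mem hx k))).symm

theorem t_inj {x y : V} (hx : x ∈ T.LS) (hy : y ∈ T.LS) (h : T.t x = T.t y) : x = y := by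
  have := t_spec hx
  rw [h] at this
  exact T.tau_inj this (t_spec hy)

theorem tk_inj {x y : V} (hx : x ∈ T.LS) (hy : y ∈ T.LS) (k : ℕ)
    (h : T.t^[k] x = T.t^[k] y) : x = y := by
  induction k with
  | zero => exact h
  | succ k ih =>
    rw [Function.iterate_succ_apply', Function.iterate_succ_apply'] at h
    exact ih (t_inj (tk_mem hx k) (tk_mem hy k) h)

/-- arrows out of the translate -/
theorem arr_t_left {y : V} (hy : y ∈ T.LS) (z : V) : T.arr (T.t y) z ↔ T.arr z y :=
  T.arr_tau (t_spec hy) z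

theorem arr_t {x y : V} (hx : x ∈ T.LS) (hy : y ∈ T.LS) :
    T.arr (T.t x) (T.t y) ↔ T.arr x y := by
  rw [arr_t_left hx, arr_t_left hy]

theorem arr_tk {x y : V} (hx : x ∈ T.LS) (hy : y ∈ T.LS) (k : ℕ) :
    T.arr (T.t^[k] x) (T.t^[k] y) ↔ T.arr x y := by
  induction k with
  | zero => rfl
  | succ k ih =>
    rw [Function.iterate_succ_apply', Function.iterate_succ_apply',
      arr_t (tk_mem hx k) (tk_mem hy k), ih]

/-- iterated translation as a relation -/
def tn (T : TQ V) : ℕ → V → V → Prop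
  | 0, a, b => a = b
  | k + 1, a, b => ∃ c, T.tau a c ∧ tn T k c b

theorem tn_succ' {k : ℕ} {a b : V} : T.tn (k + 1) a b ↔ ∃ c, T.tn k a c ∧ T.tau c b := by
  induction k generalizing a b with
  | zero =>
    constructor
    · rintro ⟨c, h, rfl⟩; exact ⟨a, rfl, h⟩
    · rintro ⟨c, rfl, h⟩; exact ⟨b, h, rfl⟩
  | succ k ih =>
    constructor
    · rintro ⟨c, h, h'⟩
      obtain ⟨d, h1, h2⟩ := ih.1 h'
      exact ⟨d, ⟨c, h, h1⟩, h2⟩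
    · rintro ⟨c, ⟨d, h, h'⟩, h2⟩
      exact ⟨d, h, ih.2 ⟨c, h', h2⟩⟩

theorem tn_op {k : ℕ} {a b : V} : T.op.tn k a b ↔ T.tn k b a := by
  induction k generalizing a b with
  | zero => exact eq_comm
  | succ k ih =>
    rw [tn_succ']
    constructor
    · rintro ⟨c, h, h'⟩; exact ⟨c, h', ih.1 h⟩
    · rintro ⟨c, h', h⟩; exact ⟨c, ih.2 h, h'⟩

theorem conn_tn {k : ℕ} {a b : V} (h : T.tn k a b) : T.conn a b := by
  induction k generalizing a with
  | zero => cases h; exact ReflTransGen.refl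
  | succ k ih =>
    obtain ⟨c, h, h'⟩ := h
    exact (conn_tau h).trans' (ih h')

theorem tn_of_conn {a b : V} (h : T.conn a b) : ∃ k, T.tn k a b ∨ T.tn k b a := by
  induction h with
  | refl => exact ⟨0, Or.inl rfl⟩
  | tail _ h ih =>
    obtain ⟨k, ih | ih⟩ := ih
    · rcases h with h | h
      · exact ⟨k + 1, Or.inl (tn_succ'.2 ⟨_, ih, h⟩)⟩
      · cases k with
        | zero => cases ih; exact ⟨1, Or.inr ⟨_, h, rfl⟩⟩
        | succ k =>
          obtain ⟨c, h1, h2⟩ := tn_succ'.1 ih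
          have := T.tau_fun h h2
          subst this
          exact ⟨k, Or.inl h1⟩
    · rcases h with h | h
      · cases k with
        | zero => cases ih; exact ⟨1, Or.inl ⟨_, h, rfl⟩⟩
        | succ k =>
          obtain ⟨c, h1, h2⟩ := ih
          have := T.tau_inj h h1
          subst this
          exact ⟨k, Or.inr h2⟩
      · exact ⟨k + 1, Or.inr ⟨_, h, ih⟩⟩

theorem tn_fun {k : ℕ} {a a' b : V} (h : T.tn k a b) (h' : T.tn k a' b) : a = a' := by
  induction k generalizing a a' with
  | zero => exact h.trans h'.symm
  | succ k ih =>
    obtain ⟨c, h1, h2⟩ := h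
    obtain ⟨c', h1', h2'⟩ := h'
    have := ih h2 h2'
    subst this
    exact T.tau_fun h1 h1'

theorem tn_t {k : ℕ} {a b : V} (h : T.tn k a b) : a = T.t^[k] b := by
  induction k generalizing a with
  | zero => exact h
  | succ k ih =>
    obtain ⟨c, h1, h2⟩ := h
    rw [Function.iterate_succ_apply', ← ih h2, t_eq h1]

theorem t_tn {k : ℕ} {b : V} (hb : b ∈ T.LS) : T.tn k (T.t^[k] b) b := by
  induction k with
  | zero => rfl
  | succ k ih =>
    rw [Function.iterate_succ_apply']
    exact ⟨_, t_spec (tk_mem hb k), ih⟩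

/-- A non left stable vertex has a projective forward translate. -/
theorem not_LS {w : V} (hw : w ∉ T.LS) : ∃ P m, (¬∃ z, T.tau z P) ∧ T.tn m P w := by
  simp only [LS, Set.mem_ofPred_eq, not_not] at hw
  obtain ⟨P, hc, hP⟩ := hw
  obtain ⟨m, h | h⟩ := tn_of_conn hc
  · cases m with
    | zero => cases h; exact ⟨_, 0, hP, rfl⟩
    | succ m =>
      obtain ⟨c, h1, h2⟩ := tn_succ'.1 h
      exact absurd ⟨_, h2⟩ hP
  · exact ⟨P, m, hP, h⟩

theorem LS_of_tn {x : V} (h : ∀ k, ∃ y, T.tn k y x) : x ∈ T.LS := by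
  by_contra hx
  obtain ⟨P, m, hP, hm⟩ := not_LS hx
  obtain ⟨y, c, h1, h2⟩ := h (m + 1)
  rw [tn_fun h2 hm] at h1
  exact hP ⟨_, h1⟩

/-- shifting arrows -/
theorem arr_tn {m : ℕ} {P w y : V} (h : T.tn m P w) (hy : y ∈ T.LS) :
    T.arr P (T.t^[m] y) ↔ T.arr w y := by
  induction m generalizing P with
  | zero => cases h; rfl
  | succ m ih =>
    obtain ⟨c, h1, h2⟩ := h
    rw [Function.iterate_succ_apply', T.arr_tau h1, arr_t_left (tk_mem hy m), ih h2]

theorem arr_tn' {m : ℕ} {P w y : V} (h : T.tn m P w) (hy : y ∈ T.LS) :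
    T.arr (T.t^[m] y) P ↔ T.arr y w := by
  induction m generalizing P with
  | zero => cases h; rfl
  | succ m ih =>
    obtain ⟨c, h1, h2⟩ := h
    rw [Function.iterate_succ_apply', arr_t_left (tk_mem hy m), T.arr_tau h1, ih h2]

/-- no infinite bounded sectional path -/
theorem no_bdd {c : ℕ → V} (h1 : ∀ i, T.arr (c i) (c (i + 1)))
    (h2 : ∀ i, ¬T.tau (c i) (c (i + 2))) (b : ℕ) (hb : ∀ i, T.len (c i) ≤ b) : False := by
  obtain ⟨N, hN⟩ := T.hs b
  obtain ⟨i, -, hi⟩ := hN c (fun i _ => h1 i) (fun i _ => h2 i)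
  exact absurd (hb i) (not_le.2 hi)

/-- Nonisolated -/
def NI (T : TQ V) (x : V) : Prop := x ∈ T.LS ∧ ∃ w ∈ T.LS, T.arr w x

/-- steps in LS -/
def lstep (T : TQ V) (a b : V) : Prop := a ∈ T.LS ∧ b ∈ T.LS ∧ T.step a b

/-- component of LS -/
def comp (T : TQ V) (x : V) : Set V := {y | ReflTransGen T.lstep x y}

theorem lstep_symm {a b : V} (h : T.lstep a b) : T.lstep b a := ⟨h.2.1, h.1, h.2.2.symm⟩

/-- The kind of sets we work in: t-closed components of the left stable part. -/
structure Good (T : TQ V) (D : Set V) : Prop where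
  ls : ∀ x ∈ D, x ∈ T.LS
  closed : ∀ x ∈ D, ∀ y ∈ T.LS, T.step x y → y ∈ D
  conn : ∀ x ∈ D, ∀ y ∈ D, ReflTransGen T.lstep x y
  pred : ∀ x ∈ D, ∃ w ∈ D, T.arr w x

theorem good_comp {x : V} (hx : T.NI x) : T.Good (T.comp x) := by
  have hls : ∀ y ∈ T.comp x, y ∈ T.LS := by
    intro y hy
    rcases ReflTransGen.cases_tail hy with h | ⟨b, -, h⟩
    · rw [h]; exact hx.1
    · exact h.2.1
  have hcl : ∀ y ∈ T.comp x, ∀ z ∈ T.LS, T.step y z → z ∈ T.comp x :=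
    fun y hy z hz h => ReflTransGen.tail hy ⟨hls y hy, hz, h⟩
  refine ⟨hls, hcl, ?_, ?_⟩
  · intro y hy z hz
    exact (rtg_symm (fun _ _ h => lstep_symm h) hy).trans hz
  · intro y hy
    have : ∃ w ∈ T.LS, T.arr w y := by
      rcases ReflTransGen.cases_tail hy with h | ⟨b, -, h⟩
      · rw [h]; exact hx.2
      · rcases h with ⟨h1, h2, h | h⟩
        · exact ⟨b, h1, h⟩
        · exact ⟨T.t b, t_mem h1, (arr_t_left h1 y).2 h⟩
    obtain ⟨w, hw, h⟩ := this
    exact ⟨w, hcl y hy w hw (Or.inr h), h⟩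

theorem mem_comp (x : V) : x ∈ T.comp x := ReflTransGen.refl

namespace Good

variable {D : Set V}

theorem t_mem (hD : T.Good D) {x : V} (hx : x ∈ D) : T.t x ∈ D := by
  obtain ⟨w, hw, h⟩ := hD.pred x hx
  exact hD.closed w hw _ (TQ.t_mem (hD.ls x hx)) (Or.inr ((arr_t_left (hD.ls x hx) w).2 h))

theorem tk_mem (hD : T.Good D) {x : V} (hx : x ∈ D) (k : ℕ) : T.t^[k] x ∈ D := by
  induction k with
  | zero => exact hx
  | succ k ih => rw [Function.iterate_succ_apply']; exact hD.t_mem ih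

theorem desc1 (hD : T.Good D) {x : V} (hx : x ∈ D) : TransGen (T.arrIn D) (T.t x) x := by
  obtain ⟨w, hw, h⟩ := hD.pred x hx
  exact TransGen.tail (TransGen.single ⟨hD.t_mem hx, hw, (arr_t_left (hD.ls x hx) w).2 h⟩)
    ⟨hw, hx, h⟩

theorem desc (hD : T.Good D) {x : V} (hx : x ∈ D) (k : ℕ) : ReflTransGen (T.arrIn D) (T.t^[k] x) x := by
  induction k with
  | zero => exact ReflTransGen.refl
  | succ k ih =>
    rw [Function.iterate_succ_apply']
    exact (hD.desc1 (hD.tk_mem hx k)).to_reflTransGen.trans ih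

theorem desc' (hD : T.Good D) {x : V} (hx : x ∈ D) {k : ℕ} (hk : 0 < k) :
    TransGen (T.arrIn D) (T.t^[k] x) x := by
  obtain ⟨k, rfl⟩ : ∃ j, k = j + 1 := ⟨k - 1, by omega⟩
  rw [Function.iterate_succ_apply']
  exact TransGen.trans_left (hD.desc1 (hD.tk_mem hx k)) (hD.desc hx k)

/-- connect far translates -/
theorem far (hD : T.Good D) {x z : V} (hx : x ∈ D) (hz : z ∈ D) :
    ∃ b M, b ≤ M ∧ ∀ m, M ≤ m → ReflTransGen (T.arrIn D) (T.t^[m] x) (T.t^[m - b] z) := by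
  have h := hD.conn x hx z hz
  clear hz
  suffices H : z ∈ D ∧ ∃ b M, b ≤ M ∧ ∀ m, M ≤ m →
      ReflTransGen (T.arrIn D) (T.t^[m] x) (T.t^[m - b] z) from H.2
  induction h with
  | refl => exact ⟨hx, 0, 0, le_rfl, fun m _ => ReflTransGen.refl⟩
  | @tail u v _ h ih =>
    obtain ⟨hu, b, M, hbM, ih⟩ := ih
    have hv : v ∈ D := hD.closed u hu v h.2.1 h.2.2
    refine ⟨hv, ?_⟩
    rcases h with ⟨h1, h2, h | h⟩
    · refine ⟨b, M, hbM, fun m hm => (ih m hm).tail ⟨hD.tk_mem hu _, hD.tk_mem hv _, ?_⟩⟩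
      exact (arr_tk h1 h2 _).2 h
    · refine ⟨b + 1, M + 1, by omega, fun m hm => (ih m (by omega)).tail
        ⟨hD.tk_mem hu _, hD.tk_mem hv _, ?_⟩⟩
      rw [show m - b = (m - (b + 1)) + 1 by omega, Function.iterate_succ_apply',
        arr_t_left (TQ.tk_mem h1 _)]
      exact (arr_tk h2 h1 _).2 h

theorem far0 (hD : T.Good D) {x z : V} (hx : x ∈ D) (hz : z ∈ D) :
    ∃ b, ReflTransGen (T.arrIn D) (T.t^[b] x) z := by
  obtain ⟨b, M, -, h⟩ := hD.far hx hz
  exact ⟨M, (h M le_rfl).trans (hD.desc hz _)⟩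

end Good

/-- periodic -/
def Per (T : TQ V) (x : V) : Prop := ∃ k, 0 < k ∧ T.t^[k] x = x

theorem per_of_eq {x : V} (hx : x ∈ T.LS) {k l : ℕ} (hkl : k < l)
    (h : T.t^[k] x = T.t^[l] x) : T.Per x := by
  refine ⟨l - k, by omega, ?_⟩
  rw [show l = k + (l - k) by omega, Function.iterate_add_apply] at h
  exact (tk_inj hx (tk_mem hx _) k h).symm

theorem inj_of_not_per {x : V} (hx : x ∈ T.LS) (h : ¬T.Per x) :
    Function.Injective fun k => T.t^[k] x := by
  intro k l hkl
  by_contra hne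
  rcases Nat.lt_or_gt_of_ne hne with h' | h'
  · exact h (per_of_eq hx h' hkl)
  · exact h (per_of_eq hx h' hkl.symm)

theorem per_step {u v : V} (h : T.lstep u v) (hu : T.Per u) : T.Per v := by
  obtain ⟨p, hp, hpu⟩ := hu
  obtain ⟨h1, h2, h⟩ := h
  have hfix : ∀ n, T.t^[p * n] u = u := by
    intro n
    rw [Function.iterate_mul]
    exact Function.iterate_fixed hpu n
  have hfin : {x | T.step u x}.Finite := (T.succ_fin u).union (T.pred_fin u)
  have hm : ∀ n, T.t^[p * n] v ∈ {x | T.step u x} := by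
    intro n
    have h3 := arr_tk h1 h2 (p * n)
    have h4 := arr_tk h2 h1 (p * n)
    rw [hfix] at h3 h4
    rcases h with h | h
    · exact Or.inl (h3.2 h)
    · exact Or.inr (h4.2 h)
  obtain ⟨a, -, b, -, hne, hab⟩ := Set.infinite_univ.exists_ne_map_eq_of_mapsTo
    (f := fun n => T.t^[p * n] v) (fun n _ => hm n) hfin
  rcases Nat.lt_or_gt_of_ne hne with h' | h'
  · exact per_of_eq h2 (Nat.mul_lt_mul_of_pos_left h' hp) hab
  · exact per_of_eq h2 (Nat.mul_lt_mul_of_pos_left h' hp) hab.symm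

theorem Good.per {D : Set V} (hD : T.Good D) {x y : V} (hx : x ∈ D) (hy : y ∈ D)
    (h : T.Per x) : T.Per y := by
  have hc := hD.conn x hx y hy
  clear hy
  induction hc with
  | refl => exact h
  | tail _ h' ih => exact per_step h' ih

end TQ
end CF

namespace CF
open Relation
namespace TQ

variable {V : Type*} {T : TQ V}

/-- A sectional path invariant under a glide translation. -/
structure Glide (T : TQ V) (D : Set V) (x : ℕ → V) (m r : ℕ) : Prop where
  hm : 0 < m
  hr : 0 < r
  mem : ∀ i, x i ∈ D
  arr : ∀ i, T.arr (x i) (x (i + 1))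
  per : ∀ i, x (i + m) = T.t^[r] (x i)
  sec : ∀ i, x i ≠ T.t (x (i + 2))

/-- path of given length -/
def PathIn (T : TQ V) (D : Set V) (n : ℕ) (c : ℕ → V) : Prop :=
  (∀ i, i ≤ n → c i ∈ D) ∧ ∀ i, i < n → T.arr (c i) (c (i + 1))

theorem path_of_rtg {D : Set V} {x y : V} (h : ReflTransGen (T.arrIn D) x y) (hx : x ∈ D) :
    ∃ n c, T.PathIn D n c ∧ c 0 = x ∧ c n = y := by
  induction h with
  | refl => exact ⟨0, fun _ => x, ⟨fun i _ => hx, fun i hi => absurd hi (by omega)⟩, rfl, rfl⟩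
  | @tail b z _ h ih =>
    obtain ⟨n, c, ⟨h1, h2⟩, h3, h4⟩ := ih
    refine ⟨n + 1, fun i => if i ≤ n then c i else z, ⟨?_, ?_⟩, ?_, ?_⟩
    · intro i hi
      by_cases hin : i ≤ n
      · simp only [hin, if_true]; exact h1 i hin
      · simp only [hin, if_false]; exact h.2.1
    · intro i hi
      by_cases hin : i + 1 ≤ n
      · simp only [hin, if_true, show i ≤ n by omega]; exact h2 i hin
      · have : i = n := by omega
        subst this
        simp only [hin, if_false, le_refl, if_true, h4]; exact h.2.2
    · simp [h3]
    · simp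

theorem path_of_tg {D : Set V} {x y : V} (h : TransGen (T.arrIn D) x y) :
    ∃ n c, 0 < n ∧ T.PathIn D n c ∧ c 0 = x ∧ c n = y := by
  obtain ⟨b, h1, h2⟩ := TransGen.tail'_iff.1 h
  obtain ⟨b', h1', h2'⟩ := TransGen.head'_iff.1 h
  obtain ⟨n, c, ⟨h3, h3'⟩, h4, h5⟩ := path_of_rtg h1 h1'.1
  refine ⟨n + 1, fun i => if i ≤ n then c i else y, by omega, ⟨?_, ?_⟩, ?_, ?_⟩
  · intro i hi
    by_cases hin : i ≤ n
    · simp only [hin, if_true]; exact h3 i hin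
    · simp only [hin, if_false]; exact h2.2.1
  · intro i hi
    by_cases hin : i + 1 ≤ n
    · simp only [hin, if_true, show i ≤ n by omega]; exact h3' i hin
    · have : i = n := by omega
      subst this
      simp only [hin, if_false, le_refl, if_true, h5]; exact h2.2.2
  · simp [h4]
  · simp

theorem rtg_of_path {D : Set V} {n : ℕ} {c : ℕ → V} (h : T.PathIn D n c) {i j : ℕ} (hij : i ≤ j)
    (hj : j ≤ n) : ReflTransGen (T.arrIn D) (c i) (c j) := by
  induction j with
  | zero => obtain rfl : i = 0 := by omega
            exact ReflTransGen.refl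
  | succ j ih =>
    rcases Nat.lt_or_ge j i with h' | h'
    · obtain rfl : i = j + 1 := by omega
      exact ReflTransGen.refl
    · exact (ih h' (by omega)).tail ⟨h.1 j (by omega), h.1 _ hj, h.2 j (by omega)⟩

/-- Existence of glide paths. -/
theorem exists_glide {D : Set V} (hD : T.Good D) (hnp : ∀ x ∈ D, ¬T.Per x)
    (hcyc : ∃ x, T.OnCyc D x) : ∃ x m r, T.Glide D x m r := by
  classical
  have hex : ∃ m, 0 < m ∧ ∃ r c, T.PathIn D m c ∧ c m = T.t^[r] (c 0) := by
    obtain ⟨x, hx⟩ := hcyc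
    obtain ⟨n, c, hn, h1, h2, h3⟩ := path_of_tg hx
    exact ⟨n, hn, 0, c, h1, by simp [h2, h3]⟩
  obtain ⟨hm, r, c, ⟨hcD, hca⟩, hcm⟩ := Nat.find_spec hex
  have hmin := fun k => Nat.find_min hex (m := k)
  set m := Nat.find hex with hmdef
  clear_value m
  let x : ℕ → V := fun i => T.t^[r * (i / m)] (c (i % m))
  have hmod : ∀ i, i % m < m := fun i => Nat.mod_lt i hm
  have hxD : ∀ i, x i ∈ D := fun i => hD.tk_mem (hcD _ (hmod i).le) _
  have hper : ∀ i, x (i + m) = T.t^[r] (x i) := by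
    intro i
    simp only [x]
    rw [Nat.add_div_right i hm, Nat.add_mod_right, Nat.mul_succ, Nat.add_comm,
      Function.iterate_add_apply]
  have harr : ∀ i, T.arr (x i) (x (i + 1)) := by
    intro i
    have h1 : T.arr (x i) (T.t^[r * (i / m)] (c (i % m + 1))) :=
      (arr_tk (hD.ls _ (hcD _ (hmod i).le)) (hD.ls _ (hcD _ (hmod i))) _).2 (hca _ (hmod i))
    suffices T.t^[r * (i / m)] (c (i % m + 1)) = x (i + 1) by rwa [this] at h1
    simp only [x]
    rcases Nat.lt_or_ge (i % m + 1) m with h | h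
    · have e : i + 1 = (i % m + 1) + m * (i / m) := by
        have := Nat.mod_add_div i m; omega
      rw [e, Nat.add_mul_div_left _ _ hm, Nat.add_mul_mod_self_left, Nat.mod_eq_of_lt h,
        Nat.div_eq_of_lt h, Nat.zero_add]
    · have h' : i % m + 1 = m := le_antisymm (hmod i) h
      have e : i + 1 = 0 + m * (i / m + 1) := by
        have := Nat.mod_add_div i m
        rw [Nat.mul_succ]; omega
      rw [e, Nat.add_mul_div_left _ _ hm, Nat.add_mul_mod_self_left, Nat.zero_mod,
        Nat.zero_div, Nat.zero_add, h', hcm, Nat.mul_succ, Function.iterate_add_apply]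
  have hsec : ∀ i, x i ≠ T.t (x (i + 2)) := by
    intro i hi
    rcases Nat.lt_or_ge 2 m with h2 | h2
    · refine hmin (m - 2) (by omega) ⟨by omega, r + 1, fun j => x (i + 2 + j),
        ⟨fun j _ => hxD _, fun j _ => harr _⟩, ?_⟩
      show x (i + 2 + (m - 2)) = T.t^[r + 1] (x (i + 2 + 0))
      rw [show i + 2 + (m - 2) = i + m by omega, hper, hi, Function.iterate_succ_apply]
    · have hm' : m = 1 ∨ m = 2 := by omega
      rcases hm' with rfl | rfl
      · refine hnp (x i) (hxD i) ⟨2 * r + 1, by omega, ?_⟩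
        conv_rhs => rw [hi, hper (i + 1), hper i]
        rw [Function.iterate_succ_apply', two_mul, Function.iterate_add_apply]
      · refine hnp (x (i + 2)) (hxD _) ⟨r + 1, by omega, ?_⟩
        conv_rhs => rw [hper i, hi]
        rw [Function.iterate_succ_apply]
  refine ⟨x, m, r, hm, ?_, hxD, harr, hper, hsec⟩
  by_contra hr
  obtain rfl : r = 0 := by omega
  refine no_bdd harr (fun i h => hsec i (t_eq h).symm)
    (∑ i ∈ Finset.range m, T.len (c i)) fun i => ?_
  simp only [x, Nat.zero_mul, Function.iterate_zero, id]
  exact Finset.single_le_sum (f := fun i => T.len (c i)) (fun _ _ => Nat.zero_le _)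
    (Finset.mem_range.2 (hmod i))

namespace Glide

variable {D : Set V} {x : ℕ → V} {m r : ℕ}

/-- glide translation -/
theorem shift (h : T.Glide D x m r) (i k : ℕ) : T.t^[k] (x (i + m)) = T.t^[k + r] (x i) := by
  rw [h.per, ← Function.iterate_add_apply]

theorem shift_n (h : T.Glide D x m r) (n i k : ℕ) :
    T.t^[k] (x (i + n * m)) = T.t^[k + n * r] (x i) := by
  induction n generalizing k with
  | zero => simp
  | succ n ih =>
    rw [show i + (n + 1) * m = i + n * m + m by ring, h.shift, ih,
      show k + r + n * r = k + (n + 1) * r by ring]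

theorem mesh' (h : T.Glide D x m r) (hD : T.Good D) (i k : ℕ) (S : Finset V)
    (hS : ∀ z ∈ S, T.arr z (T.t^[k] (x (i + 1))) ∧ z ≠ T.t^[k] (x i) ∧
      z ≠ T.t^[k + 1] (x (i + 2))) :
    T.len (T.t^[k] (x i)) + T.len (T.t^[k + 1] (x (i + 2))) + ∑ z ∈ S, T.len z ≤
      T.len (T.t^[k] (x (i + 1))) + T.len (T.t^[k + 1] (x (i + 1))) := by
  classical
  have hls := fun i => hD.ls _ (h.mem i)
  have htau : T.tau (T.t^[k + 1] (x (i + 1))) (T.t^[k] (x (i + 1))) := by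
    rw [Function.iterate_succ_apply']
    exact t_spec (tk_mem (hls _) k)
  have hne : T.t^[k] (x i) ≠ T.t^[k + 1] (x (i + 2)) := by
    intro he
    rw [Function.iterate_succ_apply] at he
    exact h.sec i (tk_inj (hls _) (t_mem (hls _)) k he)
  have := T.mesh htau (insert (T.t^[k] (x i)) (insert (T.t^[k + 1] (x (i + 2))) S)) ?_
  · rw [Finset.sum_insert, Finset.sum_insert] at this
    · omega
    · intro hmem; exact (hS _ hmem).2.2 rfl
    · simp only [Finset.mem_insert, not_or]
      exact ⟨hne, fun hmem => (hS _ hmem).2.1 rfl⟩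
  · intro z hz
    simp only [Finset.mem_insert] at hz
    rcases hz with rfl | rfl | hz
    · exact (arr_tk (hls _) (hls _) k).2 (h.arr i)
    · rw [Function.iterate_succ_apply', arr_t_left (tk_mem (hls _) _)]
      exact (arr_tk (hls _) (hls _) k).2 (h.arr (i + 1))
    · exact (hS z hz).1

/-- diagonal lengths -/
noncomputable def b (T : TQ V) (x : ℕ → V) (k : ℕ) : ℤ := T.len (T.t^[k] (x k))

/-- the total slope of the window -/
noncomputable def W (T : TQ V) (x : ℕ → V) (m r k : ℕ) : ℤ :=
  T.len (T.t^[k] (x (k + (m + r)))) - T.len (T.t^[k] (x k))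

theorem W_eq (h : T.Glide D x m r) (k : ℕ) : W T x m r k = b T x (k + r) - b T x k := by
  rw [W, b, b, show k + (m + r) = k + r + m by ring, h.shift]

theorem W_sub (x : ℕ → V) (m r k : ℕ) : W T x m r k - W T x m r (k + 1) =
    ∑ s ∈ Finset.range (m + r), (((T.len (T.t^[k] (x (k + s + 1))) : ℤ) -
      T.len (T.t^[k] (x (k + s)))) - ((T.len (T.t^[k + 1] (x (k + s + 2))) : ℤ) -
      T.len (T.t^[k + 1] (x (k + s + 1))))) := by
  rw [Finset.sum_sub_distrib]
  congr 1
  · exact (Finset.sum_range_sub (fun s => (T.len (T.t^[k] (x (k + s))) : ℤ)) (m + r)).symm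
  · rw [W, show k + 1 + (m + r) = k + (m + r) + 1 by ring]
    exact (Finset.sum_range_sub (fun s => (T.len (T.t^[k + 1] (x (k + s + 1))) : ℤ))
      (m + r)).symm

theorem term_nonneg (h : T.Glide D x m r) (hD : T.Good D) (i k : ℕ) :
    0 ≤ ((T.len (T.t^[k] (x (i + 1))) : ℤ) -
      T.len (T.t^[k] (x i))) - ((T.len (T.t^[k + 1] (x (i + 2))) : ℤ) -
      T.len (T.t^[k + 1] (x (i + 1)))) := by
  have := h.mesh' hD i k ∅ (by simp)
  rw [Finset.sum_empty] at this
  omega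

theorem W_anti (h : T.Glide D x m r) (hD : T.Good D) : Antitone (W T x m r) := by
  refine antitone_nat_of_succ_le fun k => ?_
  have := W_sub (T := T) x m r k
  have h2 : 0 ≤ W T x m r k - W T x m r (k + 1) := by
    rw [this]
    exact Finset.sum_nonneg fun s _ => h.term_nonneg hD (k + s) k
  omega

theorem W_nonneg (h : T.Glide D x m r) (hD : T.Good D) (k : ℕ) : 0 ≤ W T x m r k := by
  by_contra hneg
  have key : ∀ j : ℕ, b T x (k + j * r) ≤ b T x k - j := by
    intro j
    induction j with
    | zero => simp
    | succ j ih =>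
      have h1 := h.W_eq (k + j * r)
      have h2 := h.W_anti hD (show k ≤ k + j * r by omega)
      rw [show k + (j + 1) * r = k + j * r + r by ring]
      push_cast
      omega
  have h1 := key (b T x k).toNat
  have h2 : 0 < b T x (k + (b T x k).toNat * r) := by
    simp only [b]; exact_mod_cast T.len_pos _
  have h3 : 0 ≤ b T x k := by simp only [b]; positivity
  omega

theorem W_stab (h : T.Glide D x m r) (hD : T.Good D) :
    ∃ k0, ∀ k, k0 ≤ k → W T x m r (k + 1) = W T x m r k := by
  classical
  have hex : ∃ n : ℕ, ∃ k, (W T x m r k).toNat = n := ⟨_, 0, rfl⟩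
  obtain ⟨k0, hk0⟩ := Nat.find_spec hex
  have hmin : ∀ k, (W T x m r k0).toNat ≤ (W T x m r k).toNat := by
    intro k; rw [hk0]; exact Nat.find_min' hex ⟨k, rfl⟩
  refine ⟨k0, fun k hk => ?_⟩
  have h1 := hmin k
  have h2 := hmin (k + 1)
  have h3 := h.W_anti hD hk
  have h4 := h.W_anti hD (show k0 ≤ k + 1 by omega)
  have h5 := h.W_nonneg hD k
  have h6 := h.W_nonneg hD (k + 1)
  have h7 := h.W_nonneg hD k0
  omega

/-- far window vertices have exactly two predecessors -/
theorem window (h : T.Glide D x m r) (hD : T.Good D) : ∃ k0, ∀ k, k0 ≤ k → ∀ s < m + r, ∀ z,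
    T.arr z (T.t^[k] (x (k + s + 1))) →
      z = T.t^[k] (x (k + s)) ∨ z = T.t^[k + 1] (x (k + s + 2)) := by
  obtain ⟨k0, hk0⟩ := h.W_stab hD
  refine ⟨k0, fun k hk s hs z hz => ?_⟩
  by_contra hne
  rw [not_or] at hne
  have h1 := W_sub (T := T) x m r k
  rw [hk0 k hk, sub_self] at h1
  have h2 := (Finset.sum_eq_zero_iff_of_nonneg
    (fun s _ => h.term_nonneg hD (k + s) k)).1 h1.symm s (Finset.mem_range.2 hs)
  have h3 := h.mesh' hD (k + s) k {z} (by simpa using ⟨hz, hne.1, hne.2⟩)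
  rw [Finset.sum_singleton] at h3
  have h4 := T.len_pos z
  omega

/-- the far part of the window -/
def F (T : TQ V) (x : ℕ → V) (m r K : ℕ) : Set V :=
  {y | ∃ k s, K ≤ k ∧ s < m + r ∧ y = T.t^[k] (x (k + s + 1))}

theorem memF0 (h : T.Glide D x m r) (K j : ℕ) (hj : (K + r) * (m + r) ≤ j) :
    T.t^[j] (x 0) ∈ F T x m r K := by
  have hmr : 0 < m + r := by have := h.hm; omega
  set n := j / (m + r) with hn
  set s := j % (m + r) with hs
  have hjs : s + (m + r) * n = j := Nat.mod_add_div j (m + r)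
  have hsl : s < m + r := Nat.mod_lt _ hmr
  have hnK : K + r ≤ n := (Nat.le_div_iff_mul_le hmr).2 hj
  have hnm : n ≤ n * m := Nat.le_mul_of_pos_right n h.hm
  refine ⟨n * m + s - r, m + r - s - 1, by omega, by omega, ?_⟩
  have e1 : n * m + s - r + (m + r - s - 1) + 1 = 0 + (n + 1) * m := by
    rw [Nat.add_mul, Nat.one_mul]; omega
  have e2 : n * m + s - r + (n + 1) * r = j := by
    rw [Nat.add_mul, Nat.one_mul]
    rw [← hjs, Nat.add_mul, Nat.mul_comm m n, Nat.mul_comm r n]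
    omega
  rw [e1, h.shift_n, e2]

theorem F_mono {K K' : ℕ} (hK : K ≤ K') : F T x m r K' ⊆ F T x m r K := by
  rintro y ⟨k, s, h1, h2, h3⟩
  exact ⟨k, s, hK.trans h1, h2, h3⟩

theorem F_sub (h : T.Glide D x m r) (hD : T.Good D) (K : ℕ) : F T x m r K ⊆ D := by
  rintro y ⟨k, s, -, -, rfl⟩
  exact hD.tk_mem (h.mem _) _

/-- neighbours of far elements are far -/
theorem F_nbr (h : T.Glide D x m r) (hD : T.Good D) : ∃ k0, ∀ K, k0 ≤ K →
    ∀ y ∈ F T x m r (K + r + 1), ∀ z, T.step y z → z ∈ F T x m r K := by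
  obtain ⟨k0, hk0⟩ := h.window hD
  have hm := h.hm
  have hr := h.hr
  have hpred : ∀ K, k0 ≤ K → ∀ y ∈ F T x m r (K + r), ∀ z, T.arr z y → z ∈ F T x m r K := by
    rintro K hK y ⟨k, s, hk, hs, rfl⟩ z hz
    rcases hk0 k (by omega) s hs z hz with rfl | rfl
    · rcases Nat.eq_zero_or_pos s with rfl | hs0
      · refine ⟨k - r, m + r - 1, by omega, by omega, ?_⟩
        rw [show k - r + (m + r - 1) + 1 = k + m by omega, h.shift]
        congr 2
        omega
      · exact ⟨k, s - 1, by omega, by omega, by congr 2; omega⟩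
    · refine ⟨k + 1, s, by omega, hs, ?_⟩
      rw [show k + s + 2 = k + 1 + s + 1 by ring]
  refine ⟨k0, fun K hK y hy z hz => ?_⟩
  rcases hz with hz | hz
  · -- successors are predecessors of the inverse translate
    obtain ⟨k, s, hk, hs, rfl⟩ := hy
    have hk' : k = (k - 1) + 1 := by omega
    rw [hk', Function.iterate_succ_apply', arr_t_left (tk_mem (hD.ls _ (h.mem _)) _)] at hz
    have e : k - 1 + 1 + s + 1 = (k - 1) + (s + 1) + 1 := by omega
    rw [e] at hz
    rcases Nat.lt_or_ge (s + 1) (m + r) with h1 | h1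
    · exact hpred K hK _ ⟨k - 1, s + 1, by omega, h1, rfl⟩ z hz
    · -- s + 1 = m + r
      have e2 : k - 1 + (s + 1) + 1 = (k - 1 + r) + 0 + 1 + m := by omega
      rw [e2, h.shift] at hz
      exact hpred K hK _ ⟨k - 1 + r, 0, by omega, by omega, rfl⟩ z hz
  · exact hpred K hK y (F_mono (by omega) hy) z hz

theorem F_cyc (h : T.Glide D x m r) (hD : T.Good D) {K : ℕ} {y : V} (hy : y ∈ F T x m r K) :
    T.OnCyc D y := by
  obtain ⟨k, s, -, -, rfl⟩ := hy
  generalize k + s + 1 = i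
  have hp : T.PathIn D m (fun j => T.t^[k] (x (i + j))) := by
    refine ⟨fun j _ => hD.tk_mem (h.mem _) _, fun j _ => ?_⟩
    exact (arr_tk (hD.ls _ (h.mem _)) (hD.ls _ (h.mem _)) k).2 (h.arr (i + j))
  have h1 := rtg_of_path hp (Nat.zero_le m) le_rfl
  simp only [Nat.add_zero] at h1
  rw [h.shift, Nat.add_comm k r, Function.iterate_add_apply] at h1
  exact TransGen.trans_right h1 (hD.desc' (hD.tk_mem (h.mem i) k) h.hr)

theorem F_fin_diff (T : TQ V) (x : ℕ → V) (m r K K' : ℕ) :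
    (F T x m r K \ F T x m r K').Finite := by
  have : F T x m r K \ F T x m r K' ⊆
      (fun p : ℕ × ℕ => T.t^[p.1] (x (p.1 + p.2 + 1))) '' ((Set.Iio K') ×ˢ (Set.Iio (m + r))) := by
    rintro y ⟨⟨k, s, h1, h2, rfl⟩, hy⟩
    refine ⟨(k, s), ⟨?_, h2⟩, rfl⟩
    by_contra hk
    exact hy ⟨k, s, not_lt.1 hk, h2, rfl⟩
  exact (((Set.finite_Iio K').prod (Set.finite_Iio (m + r))).image _).subset this

/-- inverse translates of a glide path, in the absence of injectives -/
theorem back (h : T.Glide D x m r) (hD : T.Good D) (hni : ∀ y ∈ D, ∃ z, T.tau y z) :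
    ∃ w, T.Glide D w m r ∧ ∀ i, T.t (w i) = x i := by
  choose w hw using fun i => hni (x i) (h.mem i)
  have hwls : ∀ i, w i ∈ T.LS := fun i => LS_conn (hD.ls _ (h.mem i)) (conn_tau (hw i))
  have ht : ∀ i, T.t (w i) = x i := fun i => t_eq (hw i)
  have harr : ∀ i, T.arr (w i) (w (i + 1)) := by
    intro i
    rw [← arr_t (hwls _) (hwls _), ht, ht]
    exact h.arr i
  refine ⟨w, ⟨h.hm, h.hr, ?_, harr, ?_, ?_⟩, ht⟩
  · intro i
    have : T.arr (x (i + 1)) (w i) := by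
      rw [← ht, arr_t_left (hwls _)]; exact harr i
    exact hD.closed _ (h.mem (i + 1)) _ (hwls i) (Or.inl this)
  · intro i
    refine t_inj (hwls _) (tk_mem (hwls _) _) ?_
    rw [ht, h.per, ← Function.iterate_succ_apply' T.t, Function.iterate_succ_apply, ht]
  · intro i hi
    apply h.sec i
    rw [← ht, ← ht, ← hi]

theorem back_n (h : T.Glide D x m r) (hD : T.Good D) (hni : ∀ y ∈ D, ∃ z, T.tau y z) (n : ℕ) :
    ∃ w, T.Glide D w m r ∧ ∀ i, T.t^[n] (w i) = x i := by
  induction n with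
  | zero => exact ⟨x, h, fun i => rfl⟩
  | succ n ih =>
    obtain ⟨w, hw, h1⟩ := ih
    obtain ⟨w', hw', h2⟩ := hw.back hD hni
    exact ⟨w', hw', fun i => by rw [Function.iterate_succ_apply, h2, h1]⟩

theorem len_eq (h : T.Glide D x m r) (hD : T.Good D) (hni : ∀ y ∈ D, ∃ z, T.tau y z) :
    T.len (x (m + r)) = T.len (x 0) := by
  have h0 := h.W_nonneg hD 0
  have hW : W T x m r 0 = T.len (x (m + r)) - T.len (x 0) := by
    simp [W]
  by_contra hne
  have hpos : 1 ≤ W T x m r 0 := by omega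
  set L := T.len (x 0) with hL
  -- take n = r * (L + 1)
  obtain ⟨z, hz, hzx⟩ := h.back_n hD hni ((m + r) * (r * (L + 1)))
  set n := r * (L + 1) with hn
  have hzi : ∀ i, T.t^[m * n] (z (i + n * m)) = x i := by
    intro i
    rw [hz.shift_n, ← hzx i]
    congr 1; rw [show m * n + n * r = (m + r) * n by ring]
  have hWz : W T z m r (m * n) = W T x m r 0 := by
    rw [W, hW, hL, ← hzi 0, ← hzi (m + r)]
    rw [show m * n + (m + r) = m + r + n * m by ring, show 0 + n * m = m * n by ring]
  have hbz : b T z (m * n) = L := by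
    rw [b, hL, ← hzi 0, show 0 + n * m = m * n by ring]
  have key : ∀ j : ℕ, j * r ≤ m * n → (j : ℤ) ≤ b T z (j * r) := by
    intro j
    induction j with
    | zero => intro _; simp [b]
    | succ j ih =>
      intro hj
      have e : (j + 1) * r = j * r + r := by ring
      have h1 := hz.W_eq (j * r)
      have h2 := hz.W_anti hD (show j * r ≤ m * n by omega)
      have h3 := ih (by omega)
      rw [e]
      push_cast
      omega
  have e : m * (L + 1) * r = m * n := by rw [hn]; ring
  have := key (m * (L + 1)) (by rw [e])
  rw [e, hbz] at this
  have hm := h.hm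
  have : m * (L + 1) ≤ L := by exact_mod_cast this
  nlinarith

theorem exists_inj (h : T.Glide D x m r) (hD : T.Good D) : ∃ y ∈ D, ¬∃ z, T.tau y z := by
  by_contra hno
  have hni : ∀ y ∈ D, ∃ z, T.tau y z := by
    intro y hy
    by_contra hz
    exact hno ⟨y, hy, hz⟩
  have hsh : ∀ p, T.Glide D (fun i => x (p + i)) m r := fun p =>
    ⟨h.hm, h.hr, fun i => h.mem _, fun i => h.arr _, fun i => by simpa [add_assoc] using h.per (p + i),
      fun i => h.sec (p + i)⟩
  have hper : ∀ p, T.len (x (p + (m + r))) = T.len (x p) := fun p => (hsh p).len_eq hD hni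
  have hmr : 0 < m + r := by have := h.hm; omega
  refine no_bdd h.arr (fun i hi => h.sec i (t_eq hi).symm)
    (∑ i ∈ Finset.range (m + r), T.len (x i)) fun i => ?_
  have : T.len (x i) = T.len (x (i % (m + r))) := by
    have hfp : Function.Periodic (fun p => T.len (x p)) (m + r) := hper
    exact (hfp.map_mod_nat i).symm
  rw [this]
  exact Finset.single_le_sum (f := fun i => T.len (x i)) (fun _ _ => Nat.zero_le _)
    (Finset.mem_range.2 (Nat.mod_lt _ hmr))

end Glide

/-- Structure theorem for nonperiodic components with cycles. -/
theorem structure_thm {D : Set V} (hD : T.Good D) (hnp : ∀ x ∈ D, ¬T.Per x)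
    (hcyc : ∃ x, T.OnCyc D x) :
    ∃ (F : Set V) (G : Set V), F ⊆ D ∧ G.Finite ∧
      (∀ y ∈ F, T.OnCyc D y) ∧
      (∀ y ∈ D, ∃ K, ∀ k, K ≤ k → T.t^[k] y ∈ F) ∧
      {z | z ∉ F ∧ ∃ y ∈ F, T.step y z}.Finite ∧
      (∀ y ∈ D, ∃ g ∈ G, T.conn y g) ∧
      (∃ y ∈ D, ¬∃ z, T.tau y z) := by
  obtain ⟨x, m, r, h⟩ := exists_glide hD hnp hcyc
  obtain ⟨k0, hk0⟩ := h.F_nbr hD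
  have hev : ∀ y ∈ D, ∀ K, k0 ≤ K → ∃ N, ∀ j, N ≤ j → T.t^[j] y ∈ Glide.F T x m r K := by
    intro y hy
    have hc := hD.conn (x 0) (h.mem 0) y hy
    clear hy
    induction hc with
    | refl => exact fun K _ => ⟨_, fun j hj => h.memF0 K j hj⟩
    | @tail u v _ hs ih =>
      intro K hK
      obtain ⟨N, hN⟩ := ih (K + r + 1) (by omega)
      refine ⟨N, fun j hj => hk0 K hK _ (hN j hj) _ ?_⟩
      rcases hs with ⟨h1, h2, hs | hs⟩
      · exact Or.inl ((arr_tk h1 h2 j).2 hs)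
      · exact Or.inr ((arr_tk h2 h1 j).2 hs)
  refine ⟨Glide.F T x m r k0, x '' Set.Iio m, h.F_sub hD _, (Set.finite_Iio m).image _,
    fun y hy => h.F_cyc hD hy, fun y hy => hev y hy k0 le_rfl, ?_, ?_, h.exists_inj hD⟩
  · have hfin : (⋃ y ∈ (Glide.F T x m r k0 \ Glide.F T x m r (k0 + r + 1)),
        {z | T.step y z}).Finite :=
      (Glide.F_fin_diff T x m r _ _).biUnion fun y _ => (T.succ_fin y).union (T.pred_fin y)
    refine hfin.subset ?_
    rintro z ⟨hz, y, hy, hs⟩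
    simp only [Set.mem_iUnion]
    exact ⟨y, ⟨hy, fun hy' => hz (hk0 k0 le_rfl y hy' z hs)⟩, hs⟩
  · intro y hy
    obtain ⟨N, hN⟩ := hev y hy k0 le_rfl
    obtain ⟨k, s, -, -, he⟩ := hN N le_rfl
    set i := k + s + 1
    refine ⟨x (i % m), ⟨i % m, Nat.mod_lt _ h.hm, rfl⟩, ?_⟩
    have e : i = i % m + (i / m) * m := by
      rw [Nat.mul_comm]; exact (Nat.mod_add_div i m).symm
    rw [e, h.shift_n] at he
    have h1 := tk_conn (hD.ls y hy) N
    rw [he] at h1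
    exact h1.trans' (tk_conn (hD.ls _ (h.mem _)) _).symm

end TQ
end CF

namespace CF
open Relation
namespace TQ

variable {V : Type*} {T : TQ V}

theorem last_entry {D : Set V} {u v : V} (h : ReflTransGen T.arr u v) (hv : v ∈ D) :
    (u ∈ D ∧ ReflTransGen (T.arrIn D) u v) ∨ ∃ w y, w ∉ D ∧ y ∈ D ∧ T.arr w y ∧
      ReflTransGen T.arr u w ∧ ReflTransGen (T.arrIn D) y v := by
  induction h using ReflTransGen.head_induction_on with
  | refl => exact Or.inl ⟨hv, ReflTransGen.refl⟩
  | @head a c hac hcv ih =>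
    rcases ih with ⟨hc, ih⟩ | ⟨w, y, hw, hy, h1, h2, h3⟩
    · by_cases ha : a ∈ D
      · exact Or.inl ⟨ha, ReflTransGen.head ⟨ha, hc, hac⟩ ih⟩
      · exact Or.inr ⟨a, c, ha, hc, hac, ReflTransGen.refl, ih⟩
    · exact Or.inr ⟨w, y, hw, hy, h1, ReflTransGen.head hac h2, h3⟩

theorem first_exit {D : Set V} {u v : V} (h : ReflTransGen T.arr u v) (hu : u ∈ D) :
    (v ∈ D ∧ ReflTransGen (T.arrIn D) u v) ∨ ∃ y w, y ∈ D ∧ w ∉ D ∧ T.arr y w ∧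
      ReflTransGen (T.arrIn D) u y ∧ ReflTransGen T.arr w v := by
  induction h with
  | refl => exact Or.inl ⟨hu, ReflTransGen.refl⟩
  | @tail c a _ hca ih =>
    rcases ih with ⟨hc, ih⟩ | ⟨y, w, hy, hw, h1, h2, h3⟩
    · by_cases ha : a ∈ D
      · exact Or.inl ⟨ha, ih.tail ⟨hc, ha, hca⟩⟩
      · exact Or.inr ⟨c, a, hc, ha, hca, ih, ReflTransGen.refl⟩
    · exact Or.inr ⟨y, w, hy, hw, h1, h2, h3.tail hca⟩

/-- Strongly connected convex sets -/
structure SConv (T : TQ V) (Γ : Set V) : Prop where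
  conn : ∀ a ∈ Γ, ∀ b ∈ Γ, ReflTransGen T.arr a b
  convex : ∀ a ∈ Γ, ∀ b ∈ Γ, ∀ y, ReflTransGen T.arr a y → ReflTransGen T.arr y b → y ∈ Γ

theorem rtg_op {u v : V} : ReflTransGen T.op.arr u v ↔ ReflTransGen T.arr v u := by
  rw [← reflTransGen_swap]; rfl

theorem SConv.op {Γ : Set V} (h : T.SConv Γ) : T.op.SConv Γ :=
  ⟨fun a ha b hb => rtg_op.2 (h.conn b hb a ha),
   fun a ha b hb y h1 h2 => h.convex b hb a ha y (rtg_op.1 h2) (rtg_op.1 h1)⟩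

theorem desc_arr {x : V} (hx : x ∈ T.LS) (k : ℕ) : ReflTransGen T.arr (T.t^[k] x) x := by
  induction k with
  | zero => exact ReflTransGen.refl
  | succ k ih =>
    have h := t_spec (tk_mem hx k)
    rw [Function.iterate_succ_apply']
    obtain ⟨z, hz⟩ := T.pred_ne h
    exact ReflTransGen.head ((T.arr_tau h z).2 hz) (ReflTransGen.head hz ih)

theorem arrIn_arr {D : Set V} {u v : V} (h : ReflTransGen (T.arrIn D) u v) :
    ReflTransGen T.arr u v := rtg_mono (fun _ _ h => h.2.2) h

/-- neighbours of projectives -/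
def N (T : TQ V) : Set V := {z | ∃ P, (¬∃ y, T.tau y P) ∧ T.step P z}

theorem N_fin : T.N.Finite := by
  have : (⋃ P ∈ {p | ¬∃ x, T.tau x p}, {z | T.step P z}).Finite :=
    T.proj_fin.biUnion fun y _ => (T.succ_fin y).union (T.pred_fin y)
  refine this.subset ?_
  rintro z ⟨P, hP, hz⟩
  simp only [Set.mem_iUnion]
  exact ⟨P, hP, hz⟩

theorem N_of_arr {w y : V} (hw : w ∉ T.LS) (hy : y ∈ T.LS) (h : T.step w y) :
    ∃ m, T.t^[m] y ∈ T.N := by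
  obtain ⟨P, m, hP, hm⟩ := not_LS hw
  refine ⟨m, P, hP, ?_⟩
  rcases h with h | h
  · exact Or.inl ((arr_tn hm hy).2 h)
  · exact Or.inr ((arr_tn' hm hy).2 h)

theorem stepA {Γ : Set V} (hΓ : T.SConv Γ) {x : V} (hx : x ∈ T.LS) (hnp : ¬T.Per x)
    (hinf : {k | T.t^[k] x ∈ Γ}.Infinite) :
    ∃ D k1, T.Good D ∧ (∀ k, k1 ≤ k → T.t^[k] x ∈ D) ∧ (∀ y ∈ D, ¬T.Per y) ∧
      ∃ y, T.OnCyc D y := by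
  have hinj := inj_of_not_per hx hnp
  -- all far translates are in Γ
  obtain ⟨k0, hk0⟩ := hinf.nonempty
  have hmem : ∀ k, k0 ≤ k → T.t^[k] x ∈ Γ := by
    intro k hk
    obtain ⟨l, hl, hkl⟩ := hinf.exists_gt k
    refine hΓ.convex _ hl _ hk0 _ ?_ ?_
    · rw [show l = (l - k) + k by omega, Function.iterate_add_apply]
      exact desc_arr (tk_mem hx k) _
    · rw [show k = (k - k0) + k0 by omega, Function.iterate_add_apply]
      exact desc_arr (tk_mem hx k0) _
  -- far translates have only left stable predecessors
  have hfinN : {k | T.t^[k] x ∈ T.N}.Finite := N_fin.preimage hinj.injOn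
  obtain ⟨B, hB⟩ := hfinN.bddAbove
  have hpred : ∀ k, B < k → ∀ w, T.arr w (T.t^[k] x) → w ∈ T.LS := by
    intro k hk w hw
    by_contra hls
    obtain ⟨m, hm⟩ := N_of_arr hls (tk_mem hx k) (Or.inl hw)
    rw [← Function.iterate_add_apply] at hm
    have := hB hm
    omega
  set k1 := max k0 (B + 1) with hk1
  have hk1B : B < k1 := by omega
  have hNI : T.NI (T.t^[k1] x) := by
    obtain ⟨w, hw⟩ := T.pred_ne (t_spec (tk_mem hx k1))
    exact ⟨tk_mem hx k1, w, hpred k1 hk1B w hw, hw⟩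
  set y0 := T.t^[k1] x with hy0
  have hD := good_comp hNI
  set D := T.comp y0 with hDdef
  have hy0D : y0 ∈ D := mem_comp y0
  have hkD : ∀ k, k1 ≤ k → T.t^[k] x ∈ D := by
    intro k hk
    rw [show k = (k - k1) + k1 by omega, Function.iterate_add_apply]
    exact hD.tk_mem hy0D _
  refine ⟨D, k1, hD, hkD, ?_, ?_⟩
  · intro y hy hp
    obtain ⟨p, hp0, hp1⟩ := hD.per hy hy0D hp
    rw [hy0, ← Function.iterate_add_apply] at hp1
    have := hinj hp1
    omega
  · -- cycle
    have hfar : ∃ J, k1 < J ∧ ∀ z ∈ T.N ∩ D, ∃ b, b < J ∧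
        ReflTransGen (T.arrIn D) (T.t^[J] x) (T.t^[J - k1 - b] z) ∧ b + k1 < J := by
      have hc : ∀ z, ∃ J0, z ∈ D → ∃ b, ∀ J, J0 ≤ J → b + k1 < J ∧
          ReflTransGen (T.arrIn D) (T.t^[J] x) (T.t^[J - k1 - b] z) := by
        intro z
        by_cases hz : z ∈ D
        · obtain ⟨b, M, hbM, h⟩ := hD.far hy0D hz
          refine ⟨M + k1 + 1, fun _ => ⟨b, fun J hJ => ⟨by omega, ?_⟩⟩⟩
          have := h (J - k1) (by omega)
          rwa [hy0, ← Function.iterate_add_apply, show J - k1 + k1 = J by omega] at this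
        · exact ⟨0, fun h => absurd h hz⟩
      choose J0 hJ0 using hc
      have hfin : (T.N ∩ D).Finite := N_fin.subset Set.inter_subset_left
      obtain ⟨M, hM⟩ := (hfin.image J0).bddAbove
      refine ⟨max M (k1 + 1), by omega, fun z hz => ?_⟩
      obtain ⟨b, hb⟩ := hJ0 z hz.2
      have hle : J0 z ≤ M := hM ⟨z, hz, rfl⟩
      have := hb (max M (k1 + 1)) (by omega)
      exact ⟨b, by omega, this.2, this.1⟩
    obtain ⟨J, hJ, hJz⟩ := hfar
    have hpath := hΓ.conn _ (hmem k1 (by omega)) _ (hmem J (by omega))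
    rcases last_entry hpath (hkD J hJ.le) with ⟨-, h⟩ | ⟨w, y, hw, hy, hwy, -, h⟩
    · refine ⟨y0, TransGen.trans_right h ?_⟩
      rw [show J = (J - k1) + k1 by omega, Function.iterate_add_apply]
      exact hD.desc' hy0D (by omega)
    · have hwls : w ∉ T.LS := fun hls => hw (hD.closed y hy w hls (Or.inr hwy))
      obtain ⟨m, hm⟩ := N_of_arr hwls (hD.ls y hy) (Or.inl hwy)
      have hzD := hD.tk_mem hy m
      obtain ⟨b, hb, h1, h2⟩ := hJz _ ⟨hm, hzD⟩
      refine ⟨T.t^[J] x, TransGen.trans_right h1 (TransGen.trans_left (hD.desc' hzD (by omega)) ?_)⟩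
      exact (hD.desc hy m).trans h

/-- Consequences of stepA and structure theorem, self-contained. -/
theorem stepA_full {Γ : Set V} (hΓ : T.SConv Γ) {x : V} (hx : x ∈ T.LS) (hnp : ¬T.Per x)
    (hinf : {k | T.t^[k] x ∈ Γ}.Infinite) :
    ∃ D F G : Set V, T.Good D ∧ F ⊆ D ∧ G.Finite ∧ (∀ y ∈ F, T.OnCyc D y) ∧
      (∃ K, ∀ k, K ≤ k → T.t^[k] x ∈ F) ∧
      {z | z ∉ F ∧ ∃ y ∈ F, T.step y z}.Finite ∧
      (∀ y ∈ D, ∃ g ∈ G, T.conn y g) ∧ (∃ y ∈ D, ¬∃ z, T.tau y z) := by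
  obtain ⟨D, k1, hD, hk, hp, hc⟩ := stepA hΓ hx hnp hinf
  obtain ⟨F, G, h1, h2, h3, h4, h5, h6, h7⟩ := structure_thm hD hp hc
  refine ⟨D, F, G, hD, h1, h2, h3, ?_, h5, h6, h7⟩
  obtain ⟨K, hK⟩ := h4 _ (hk k1 le_rfl)
  refine ⟨K + k1, fun k hk' => ?_⟩
  have := hK (k - k1) (by omega)
  rwa [← Function.iterate_add_apply, show k - k1 + k1 = k by omega] at this

end TQ
end CF

namespace CF

open Relation

namespace TQ

variable {V : Type*} {T : TQ V}

/-- Koenig -/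
theorem koenig {r : V → V → Prop} (hr : ∀ y, {z | r y z}.Finite) {y : V}
    (hy : {z | ReflTransGen r y z}.Infinite) :
    ∃ c : ℕ → V, c 0 = y ∧ ∀ i, r (c i) (c (i + 1)) := by
  have step : ∀ y, {z | ReflTransGen r y z}.Infinite →
      ∃ y', r y y' ∧ {z | ReflTransGen r y' z}.Infinite := by
    intro y hy
    by_contra! h
    apply hy
    refine ((Set.finite_singleton y).union
      ((hr y).biUnion (t := fun y' => {z | ReflTransGen r y' z}) ?_)).subset ?_
    · intro y' hy'
      exact h y' hy'
    · intro z hz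
      rcases ReflTransGen.cases_head hz with h | ⟨w, h1, h2⟩
      · exact Or.inl h.symm
      · exact Or.inr (Set.mem_biUnion (show w ∈ {z | r y z} from h1) h2)
  choose! g hg1 hg2 using step
  let c : ℕ → V := fun n => g^[n] y
  have hc : ∀ n, {z | ReflTransGen r (c n) z}.Infinite := by
    intro n
    induction n with
    | zero => exact hy
    | succ n ih =>
      have := hg2 _ ih
      simpa only [c, Function.iterate_succ_apply'] using this
  refine ⟨c, rfl, fun i => ?_⟩
  have := hg1 _ (hc i)
  simpa only [c, Function.iterate_succ_apply'] using this

/-- sum over translates -/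
noncomputable def W (T : TQ V) (N : ℕ) (x : V) : ℕ := ∑ k ∈ Finset.range N, T.len (T.t^[k] x)

/-- average length -/
noncomputable def av (T : TQ V) (x : V) : ℚ :=
  (T.W (Function.minimalPeriod T.t x) x : ℚ) / Function.minimalPeriod T.t x

theorem W_mul {p : ℕ} {x : V} (h : T.t^[p] x = x) (q : ℕ) : T.W (p * q) x = q * T.W p x := by
  induction q with
  | zero => simp [W]
  | succ q ih =>
    have : T.t^[p * q] x = x := by
      rw [Function.iterate_mul]
      exact Function.iterate_fixed h q
    rw [Nat.mul_succ, W, Finset.sum_range_add, ← W, ih, Nat.succ_mul]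
    congr 1
    apply Finset.sum_congr rfl
    intro k _
    rw [add_comm, Function.iterate_add_apply, this]

theorem W_av {N : ℕ} {x : V} (h : T.t^[N] x = x) : (T.W N x : ℚ) = N * T.av x := by
  obtain ⟨q, hq⟩ := Function.IsPeriodicPt.minimalPeriod_dvd (f := T.t) (x := x) (n := N) h
  have h0 : T.t^[Function.minimalPeriod T.t x] x = x := Function.iterate_minimalPeriod
  rw [hq, W_mul h0, av]
  rcases Nat.eq_zero_or_pos (Function.minimalPeriod T.t x) with h1 | h1
  · simp [h1, W]
  · have : (Function.minimalPeriod T.t x : ℚ) ≠ 0 := by positivity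
    push_cast
    field_simp

theorem W_t {N : ℕ} {x : V} (h : T.t^[N] x = x) : T.W N (T.t x) = T.W N x := by
  have h1 : T.W N (T.t x) + T.len x = T.W N x + T.len (T.t^[N] x) := by
    have a1 := Finset.sum_range_succ (fun k => T.len (T.t^[k] x)) N
    have a2 := Finset.sum_range_succ' (fun k => T.len (T.t^[k] x)) N
    have a3 : T.W N (T.t x) = ∑ k ∈ Finset.range N, T.len (T.t^[k+1] x) :=
      Finset.sum_congr rfl fun k _ => by rw [Function.iterate_succ_apply]
    simp only [Function.iterate_zero, id] at a2
    rw [a3, W]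
    omega
  rw [h] at h1
  omega

theorem Per.minpos {x : V} (h : T.Per x) : 0 < Function.minimalPeriod T.t x := by
  obtain ⟨k, hk, h⟩ := h
  exact Function.minimalPeriod_pos_of_mem_periodicPts ⟨k, hk, h⟩

theorem av_t {x : V} (h : T.Per x) : T.av (T.t x) = T.av x := by
  obtain ⟨k, hk, h⟩ := h
  have h' : T.t^[k] (T.t x) = T.t x := by
    rw [← Function.iterate_succ_apply, Function.iterate_succ_apply', h]
  have h1 := W_av h
  have h2 := W_av h'
  rw [W_t h, h1] at h2
  have : (k : ℚ) ≠ 0 := by positivity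
  exact (mul_left_cancel₀ this h2).symm

theorem W_pos {N : ℕ} (hN : 0 < N) (x : V) : 0 < T.W N x := by
  apply Finset.sum_pos
  · intro k _; exact T.len_pos _
  · simpa using hN.ne'

theorem av_pos {x : V} (h : T.Per x) : 0 < T.av x := by
  have h1 := h.minpos
  have h2 := W_pos (T := T) h1 x
  unfold av
  positivity

theorem len_le_W {N : ℕ} (hN : 0 < N) (x : V) : T.len x ≤ T.W N x := by
  have := Finset.single_le_sum (f := fun k => T.len (T.t^[k] x)) (s := Finset.range N)
    (fun _ _ => Nat.zero_le _) (Finset.mem_range.2 hN)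
  exact this

theorem iter_dvd {p N : ℕ} {x : V} (h : T.t^[p] x = x) (hd : p ∣ N) : T.t^[N] x = x := by
  obtain ⟨q, rfl⟩ := hd
  rw [Function.iterate_mul]
  exact Function.iterate_fixed h q

/-- averaged mesh inequality -/
theorem av_mesh {y : V} (hy : y ∈ T.LS) (hyp : T.Per y) (S : Finset V)
    (hS : ∀ z ∈ S, z ∈ T.LS ∧ T.Per z ∧ T.arr z y) : ∑ z ∈ S, T.av z ≤ 2 * T.av y := by
  classical
  set N := Function.minimalPeriod T.t y * ∏ z ∈ S, Function.minimalPeriod T.t z with hN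
  have hNpos : 0 < N := Nat.mul_pos hyp.minpos (Finset.prod_pos fun z hz => (hS z hz).2.1.minpos)
  have hyN : T.t^[N] y = y := iter_dvd Function.iterate_minimalPeriod (Dvd.intro _ rfl)
  have hzN : ∀ z ∈ S, T.t^[N] z = z := fun z hz =>
    iter_dvd Function.iterate_minimalPeriod (Dvd.dvd.mul_left (Finset.dvd_prod_of_mem _ hz) _)
  have key : ∑ z ∈ S, T.W N z ≤ T.W N (T.t y) + T.W N y := by
    unfold W
    rw [Finset.sum_comm, ← Finset.sum_add_distrib]
    apply Finset.sum_le_sum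
    intro k _
    have hk := t_spec (tk_mem hy k)
    have := T.mesh hk (S.image (T.t^[k])) (by
      intro z hz
      obtain ⟨w, hw, rfl⟩ := Finset.mem_image.1 hz
      exact (arr_tk (hS w hw).1 hy k).2 (hS w hw).2.2)
    rw [Finset.sum_image (fun a ha b hb h => tk_inj (hS a ha).1 (hS b hb).1 k h)] at this
    rwa [show T.t (T.t^[k] y) = T.t^[k] (T.t y) from by
      rw [← Function.iterate_succ_apply, Function.iterate_succ_apply']] at this
  rw [W_t hyN] at key
  have key2 : (∑ z ∈ S, (T.W N z : ℚ)) ≤ T.W N y + T.W N y := by exact_mod_cast key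
  rw [Finset.sum_congr rfl (fun z hz => W_av (hzN z hz)), W_av hyN, ← Finset.mul_sum] at key2
  have hNq : (0 : ℚ) < N := by exact_mod_cast hNpos
  nlinarith

/-- periodic good sets -/
structure PG (T : TQ V) (D : Set V) : Prop where
  good : T.Good D
  per : ∀ x ∈ D, T.Per x

/-- rays -/
structure Ray (T : TQ V) (D : Set V) (c : ℕ → V) : Prop where
  mem : ∀ i, c i ∈ D
  arr : ∀ i, T.arr (c i) (c (i + 1))
  dist : ∀ i j k, T.t^[k] (c i) = c j → i = j

namespace PG

variable {D : Set V} {c : ℕ → V}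

theorem av1 (h : T.PG D) {x y : V} (hx : x ∈ D) (hy : y ∈ D) (hxy : T.arr x y) :
    T.av x ≤ 2 * T.av y := by
  have := av_mesh (h.good.ls y hy) (h.per y hy) {x}
    (by simpa using ⟨h.good.ls x hx, h.per x hx, hxy⟩)
  simpa using this

theorem av2 (h : T.PG D) {x x' y : V} (hx : x ∈ D) (hx' : x' ∈ D) (hy : y ∈ D) (hxy : T.arr x y)
    (hxy' : T.arr x' y) (hne : x ≠ x') : T.av x + T.av x' ≤ 2 * T.av y := by
  classical
  have := av_mesh (h.good.ls y hy) (h.per y hy) {x, x'}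
    (by simpa using ⟨⟨h.good.ls x hx, h.per x hx, hxy⟩, ⟨h.good.ls x' hx', h.per x' hx', hxy'⟩⟩)
  simpa [Finset.sum_pair hne] using this

theorem av3 (h : T.PG D) {x x' z y : V} (hx : x ∈ D) (hx' : x' ∈ D) (hz : z ∈ D) (hy : y ∈ D)
    (hxy : T.arr x y) (hxy' : T.arr x' y) (hzy : T.arr z y) (hne : x ≠ x') (h1 : z ≠ x)
    (h2 : z ≠ x') : T.av z + T.av x + T.av x' ≤ 2 * T.av y := by
  classical
  have := av_mesh (h.good.ls y hy) (h.per y hy) {z, x, x'}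
    (by simpa using ⟨⟨h.good.ls z hz, h.per z hz, hzy⟩, ⟨h.good.ls x hx, h.per x hx, hxy⟩,
      ⟨h.good.ls x' hx', h.per x' hx', hxy'⟩⟩)
  rw [Finset.sum_insert (by simp [h1, h2]), Finset.sum_pair hne] at this
  linarith

theorem arr_t' (h : T.PG D) {x y : V} (hy : y ∈ D) (hxy : T.arr x y) : T.arr (T.t y) x :=
  (arr_t_left (h.good.ls y hy) x).2 hxy

theorem ne_ray (hc : T.Ray D c) (i : ℕ) : c i ≠ T.t (c (i + 2)) := by
  intro e
  have := hc.dist (i + 2) i 1 e.symm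
  omega

theorem av_t (h : T.PG D) {x : V} (hx : x ∈ D) : T.av (T.t x) = T.av x := TQ.av_t (h.per x hx)

theorem concave (h : T.PG D) (hc : T.Ray D c) (i : ℕ) :
    T.av (c i) + T.av (c (i + 2)) ≤ 2 * T.av (c (i + 1)) := by
  have := h.av2 (hc.mem i) (h.good.t_mem (hc.mem (i + 2))) (hc.mem (i + 1)) (hc.arr i)
    (h.arr_t' (hc.mem (i + 2)) (hc.arr (i + 1))) (ne_ray hc i)
  rwa [h.av_t (hc.mem _)] at this

theorem mono1 (h : T.PG D) (hc : T.Ray D c) (i : ℕ) : T.av (c i) ≤ T.av (c (i + 1)) := by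
  by_contra! hlt
  set s := T.av (c (i + 1)) - T.av (c i) with hs
  have hs0 : s < 0 := by linarith
  have key : ∀ n : ℕ, T.av (c (i + n + 1)) - T.av (c (i + n)) ≤ s ∧
      T.av (c (i + n)) ≤ T.av (c i) + n * s := by
    intro n
    induction n with
    | zero => simp [hs]
    | succ n ih =>
      have := h.concave hc (i + n)
      have e1 : i + (n + 1) + 1 = i + n + 2 := by ring
      have e2 : i + (n + 1) = i + n + 1 := by ring
      rw [e1, e2]
      push_cast
      constructor <;> linarith [ih.1, ih.2]
  obtain ⟨n, hn⟩ := exists_nat_gt (T.av (c i) / (-s))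
  have h1 := (key n).2
  have h2 := av_pos (h.per _ (hc.mem (i + n)))
  rw [div_lt_iff₀ (by linarith)] at hn
  linarith

/-- common periods move along the ray -/
theorem per_up {j p : ℕ} (h : T.PG D) (hc : T.Ray D c)
    (hp : ∀ z ∈ D, T.arr z (c (j + 1)) → z = c j ∨ z = T.t (c (j + 2)))
    (e : T.t^[p] (c (j + 1)) = c (j + 1)) : T.t^[p] (c (j + 2)) = c (j + 2) := by
  have hm := hc.mem (j + 2)
  have h1 : T.arr (T.t^[p] (T.t (c (j + 2)))) (c (j + 1)) := by
    rw [← e]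
    exact (arr_tk (h.good.ls _ (h.good.t_mem hm)) (h.good.ls _ (hc.mem _)) p).2
      (h.arr_t' hm (hc.arr (j + 1)))
  rcases hp _ (h.good.tk_mem (h.good.t_mem hm) p) h1 with h2 | h2
  · rw [← Function.iterate_succ_apply] at h2
    have := hc.dist _ _ _ h2
    omega
  · rw [← Function.iterate_succ_apply, Function.iterate_succ_apply'] at h2
    exact t_inj (h.good.ls _ (h.good.tk_mem hm p)) (h.good.ls _ hm) h2

theorem per_down {j p : ℕ} (h : T.PG D) (hc : T.Ray D c)
    (hp : ∀ z ∈ D, T.arr z (c (j + 1)) → z = c j ∨ z = T.t (c (j + 2)))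
    (e : T.t^[p] (c (j + 1)) = c (j + 1)) : T.t^[p] (c j) = c j := by
  have hm := hc.mem j
  have h1 : T.arr (T.t^[p] (c j)) (c (j + 1)) := by
    rw [← e]
    exact (arr_tk (h.good.ls _ hm) (h.good.ls _ (hc.mem _)) p).2 (hc.arr j)
  rcases hp _ (h.good.tk_mem hm p) h1 with h2 | h2
  · exact h2
  · exfalso
    obtain ⟨k, hk, e'⟩ := h.per _ (hc.mem (j + 2))
    have h3 : T.t^[k - 1 + p] (c j) = c (j + 2) := by
      rw [Function.iterate_add_apply, h2, ← Function.iterate_succ_apply,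
        show (k - 1).succ = k by omega, e']
    have := hc.dist _ _ _ h3
    omega

theorem smono (h : T.PG D) (hc : T.Ray D c) (i : ℕ) : T.av (c i) < T.av (c (i + 1)) := by
  by_contra! hle
  have key : ∀ n : ℕ, T.av (c (i + n + 1)) = T.av (c (i + n)) := by
    intro n
    induction n with
    | zero => exact le_antisymm hle (h.mono1 hc i)
    | succ n ih =>
      have := h.concave hc (i + n)
      have h2 := h.mono1 hc (i + n + 1)
      rw [show i + (n + 1) = i + n + 1 by ring]
      apply le_antisymm _ h2
      rw [show i + n + 1 + 1 = i + n + 2 by ring]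
      linarith
  have hp : ∀ n : ℕ, ∀ z ∈ D, T.arr z (c (i + n + 1)) → z = c (i + n) ∨ z = T.t (c (i + n + 2)) := by
    intro n z hz hzc
    by_contra! hne
    have h1 := h.av3 (hc.mem (i + n)) (h.good.t_mem (hc.mem (i + n + 2))) hz (hc.mem (i + n + 1))
      (hc.arr _) (h.arr_t' (hc.mem _) (hc.arr (i + n + 1))) hzc (ne_ray hc _) hne.1 hne.2
    rw [h.av_t (hc.mem _)] at h1
    have h2 := av_pos (h.per z hz)
    have h3 := key n
    have h4 := key (n + 1)
    rw [show i + (n + 1) + 1 = i + n + 2 by ring, show i + (n + 1) = i + n + 1 by ring] at h4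
    linarith
  obtain ⟨p, hp0, hpe⟩ := h.per _ (hc.mem (i + 1))
  have hper : ∀ n : ℕ, T.t^[p] (c (i + n + 1)) = c (i + n + 1) := by
    intro n
    induction n with
    | zero => exact hpe
    | succ n ih =>
      have := per_up h hc (hp n) ih
      rwa [show i + (n + 1) + 1 = i + n + 2 by ring]
  have hav : ∀ n : ℕ, T.av (c (i + n + 1)) = T.av (c (i + 1)) := by
    intro n
    induction n with
    | zero => rfl
    | succ n ih =>
      have := key (n + 1)
      rw [this, show i + (n + 1) = i + n + 1 by ring, ih]
  have hW : ∀ n : ℕ, T.W p (c (i + n + 1)) = T.W p (c (i + 1)) := by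
    intro n
    have h1 := W_av (hper n)
    have h2 := W_av hpe
    rw [hav n, ← h2] at h1
    exact_mod_cast h1
  refine no_bdd (T := T) (c := fun n => c (i + n + 1)) (fun n => hc.arr _) (fun n ht => ?_)
    (T.W p (c (i + 1))) (fun n => ?_)
  · have e := t_eq ht
    have := hc.dist (i + (n + 2) + 1) (i + n + 1) 1 e
    omega
  · exact (len_le_W hp0 _).trans (hW n).le

theorem two (h : T.PG D) (hc : T.Ray D c) (i : ℕ) :
    ∀ z ∈ D, T.arr z (c (i + 1)) → z = c i ∨ z = T.t (c (i + 2)) := by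
  intro z hz hzc
  by_contra! hne
  have h1 := h.av3 (hc.mem i) (h.good.t_mem (hc.mem (i + 2))) hz (hc.mem (i + 1))
    (hc.arr _) (h.arr_t' (hc.mem _) (hc.arr (i + 1))) hzc (ne_ray hc _) hne.1 hne.2
  rw [h.av_t (hc.mem _)] at h1
  have h2 := h.av1 (h.good.t_mem (hc.mem (i + 1))) hz (h.arr_t' (hc.mem _) hzc)
  have h3 := h.av1 (h.good.t_mem (hc.mem (i + 1))) (hc.mem i) (h.arr_t' (hc.mem _) (hc.arr i))
  rw [h.av_t (hc.mem _)] at h2 h3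
  have h4 := h.smono hc (i + 1)
  rw [show i + 1 + 1 = i + 2 by ring] at h4
  linarith

theorem smono' (h : T.PG D) (hc : T.Ray D c) : StrictMono fun i => T.av (c i) :=
  strictMono_nat_of_lt_succ (h.smono hc)

theorem av_tk (h : T.PG D) {x : V} (hx : x ∈ D) (k : ℕ) : T.av (T.t^[k] x) = T.av x := by
  induction k with
  | zero => rfl
  | succ k ih => rw [Function.iterate_succ_apply', h.av_t (h.good.tk_mem hx k), ih]

/-- translation has an inverse -/
theorem back (h : T.PG D) {x : V} (hx : x ∈ D) (k : ℕ) : ∃ m, T.t^[m] (T.t^[k] x) = x := by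
  obtain ⟨p, hp, e⟩ := h.per x hx
  refine ⟨p * k - k, ?_⟩
  rw [← Function.iterate_add_apply, Nat.sub_add_cancel (Nat.le_mul_of_pos_left k hp)]
  exact iter_dvd e (Dvd.intro _ rfl)

theorem exists_pre (h : T.PG D) {x : V} (hx : x ∈ D) (k : ℕ) : ∃ y ∈ D, T.t^[k] y = x := by
  obtain ⟨m, hm⟩ := h.back hx k
  refine ⟨T.t^[m] x, h.good.tk_mem hx m, ?_⟩
  rw [← Function.iterate_add_apply, add_comm, Function.iterate_add_apply, hm]

/-- a pred of the start of a ray outside of t c1 extends the ray -/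
theorem extend (h : T.PG D) (hc : T.Ray D c) {z : V} (hz : z ∈ D) (hzc : T.arr z (c 0))
    (hne : z ≠ T.t (c 1)) : ∃ c', T.Ray D c' ∧ c' 0 = z ∧ c' 1 = c 0 := by
  have hno : ∀ i k, T.t^[k] (c i) ≠ z := by
    intro i k e
    have h1 := h.av2 hz (h.good.t_mem (hc.mem 1)) (hc.mem 0) hzc (h.arr_t' (hc.mem 1) (hc.arr 0)) hne
    rw [h.av_t (hc.mem 1), ← e, h.av_tk (hc.mem i)] at h1
    have h2 : T.av (c 0) ≤ T.av (c i) := (h.smono' hc).monotone (Nat.zero_le i)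
    have h3 := h.smono hc 0
    simp only [zero_add] at h3
    linarith
  refine ⟨fun n => match n with | 0 => z | n + 1 => c n, ⟨?_, ?_, ?_⟩, rfl, rfl⟩
  · rintro (_ | i)
    · exact hz
    · exact hc.mem i
  · rintro (_ | i)
    · exact hzc
    · exact hc.arr i
  · rintro (_ | i) (_ | j) k e
    · rfl
    · exfalso
      obtain ⟨m, hm⟩ := h.back hz k
      simp only at e
      rw [e] at hm
      exact hno _ _ hm
    · exact absurd e (hno _ _)
    · exact congrArg _ (hc.dist _ _ _ e)

/-- minimal rays -/
theorem min_ray (h : T.PG D) (hc : T.Ray D c) : ∃ c', T.Ray D c' ∧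
    ∀ z ∈ D, T.arr z (c' 0) → z = T.t (c' 1) := by
  by_contra! hno
  have key : ∀ n : ℕ, ∀ c, T.Ray D c → T.W (Function.minimalPeriod T.t (c 0)) (c 0) = n → False := by
    intro n
    induction n using Nat.strong_induction_on with
    | _ n ih =>
      intro c hc hn
      obtain ⟨z, hz, hzc, hne⟩ := hno c hc
      obtain ⟨c', hc', e0, e1⟩ := h.extend hc hz hzc hne
      refine ih _ ?_ c' hc' rfl
      rw [← hn]
      have hp := per_down h hc' (h.two hc' 0) (p := Function.minimalPeriod T.t (c 0))
        (by rw [zero_add, e1]; exact Function.iterate_minimalPeriod)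
      have hle : Function.minimalPeriod T.t (c' 0) ≤ Function.minimalPeriod T.t (c 0) :=
        Function.IsPeriodicPt.minimalPeriod_le (h.per _ (hc.mem 0)).minpos hp
      have h1 := W_av (T := T) (x := c' 0) (N := Function.minimalPeriod T.t (c' 0))
        Function.iterate_minimalPeriod
      have h2 := W_av (T := T) (x := c 0) (N := Function.minimalPeriod T.t (c 0))
        Function.iterate_minimalPeriod
      have h3 := h.smono hc' 0
      rw [zero_add, e1] at h3
      have h4 : (Function.minimalPeriod T.t (c' 0) : ℚ) ≤ Function.minimalPeriod T.t (c 0) := by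
        exact_mod_cast hle
      have h5 : (0 : ℚ) < Function.minimalPeriod T.t (c' 0) := by
        exact_mod_cast (h.per _ (hc'.mem 0)).minpos
      have h6 := av_pos (h.per _ (hc'.mem 0))
      have : (T.W (Function.minimalPeriod T.t (c' 0)) (c' 0) : ℚ) <
          T.W (Function.minimalPeriod T.t (c 0)) (c 0) := by
        rw [h1, h2]
        calc _ ≤ (Function.minimalPeriod T.t (c 0) : ℚ) * T.av (c' 0) := by gcongr
          _ < _ := by gcongr; linarith
      exact_mod_cast this
  exact key _ c hc rfl


/-- existence of rays -/
theorem exists_ray (h : T.PG D) (hinf : D.Infinite) : ∃ c, T.Ray D c := by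
  obtain ⟨x0, hx0⟩ := hinf.nonempty
  let B : ℕ → Set V := fun n => Nat.rec (Set.range fun k => T.t^[k] x0)
    (fun _ S => S ∪ {z | z ∈ D ∧ ∃ y ∈ S, T.arr y z}) n
  have B0 : B 0 = Set.range fun k => T.t^[k] x0 := rfl
  have Bs : ∀ n, B (n + 1) = B n ∪ {z | z ∈ D ∧ ∃ y ∈ B n, T.arr y z} := fun n => rfl
  have BD : ∀ n, B n ⊆ D := by
    intro n
    induction n with
    | zero => rintro _ ⟨k, rfl⟩; exact h.good.tk_mem hx0 k
    | succ n ih => rw [Bs]; exact Set.union_subset ih fun z hz => hz.1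
  have Bt : ∀ n, ∀ z ∈ B n, T.t z ∈ B n := by
    intro n
    induction n with
    | zero =>
      rintro _ ⟨k, rfl⟩
      exact ⟨k + 1, Function.iterate_succ_apply' _ _ _⟩
    | succ n ih =>
      rw [Bs]
      rintro z (hz | ⟨hz, y, hy, hyz⟩)
      · exact Or.inl (ih z hz)
      · exact Or.inr ⟨h.good.t_mem hz, T.t y, ih y hy,
          (arr_t (h.good.ls _ (BD n hy)) (h.good.ls _ hz)).2 hyz⟩
  have Btk : ∀ n k, ∀ z ∈ B n, T.t^[k] z ∈ B n := by
    intro n k z hz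
    induction k with
    | zero => exact hz
    | succ k ih => rw [Function.iterate_succ_apply']; exact Bt n _ ih
  have Bfin : ∀ n, (B n).Finite := by
    intro n
    induction n with
    | zero =>
      obtain ⟨p, hp, e⟩ := h.per x0 hx0
      refine ((Finset.range p).finite_toSet.image fun k => T.t^[k] x0).subset ?_
      rintro _ ⟨k, rfl⟩
      refine ⟨k % p, by simpa using Nat.mod_lt k hp, ?_⟩
      exact Function.IsPeriodicPt.iterate_mod_apply (f := T.t) (x := x0) (n := p) e k
    | succ n ih =>
      rw [Bs]
      refine ih.union ((ih.biUnion (t := fun y => {z | T.arr y z})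
        fun y _ => T.succ_fin y).subset ?_)
      rintro z ⟨-, y, hy, hyz⟩
      exact Set.mem_biUnion hy hyz
  have Ball : ∀ z ∈ D, ∃ n, z ∈ B n := by
    intro z hz
    obtain ⟨b, hb⟩ := h.good.far0 hx0 hz
    have : ∀ w, ReflTransGen (T.arrIn D) (T.t^[b] x0) w → ∃ n, w ∈ B n := by
      intro w hw
      induction hw with
      | refl => exact ⟨0, b, rfl⟩
      | tail _ h2 ih =>
        obtain ⟨n, hn⟩ := ih
        exact ⟨n + 1, Or.inr ⟨h2.2.1, _, hn, h2.2.2⟩⟩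
    exact this z hb
  let d : V → ℕ := fun z => sInf {n | z ∈ B n}
  have hd : ∀ z ∈ D, z ∈ B (d z) := fun z hz => Nat.sInf_mem (s := {n | z ∈ B n}) (Ball z hz)
  have hd' : ∀ z n, z ∈ B n → d z ≤ n := fun z n hz => Nat.sInf_le hz
  have dt : ∀ z ∈ D, ∀ k, d (T.t^[k] z) = d z := by
    intro z hz k
    apply le_antisymm (hd' _ _ (Btk _ k _ (hd z hz)))
    obtain ⟨m, hm⟩ := h.back hz k
    have := Btk _ m _ (hd _ (h.good.tk_mem hz k))
    rw [hm] at this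
    exact hd' _ _ this
  let r : V → V → Prop := fun y z => y ∈ D ∧ z ∈ D ∧ T.arr y z ∧ d z = d y + 1
  have hroot : ∀ n, ∀ z ∈ D, d z = n → ∃ y ∈ B 0, ReflTransGen r y z := by
    intro n
    induction n with
    | zero =>
      intro z hz hn
      have := hd z hz
      rw [hn] at this
      exact ⟨z, this, ReflTransGen.refl⟩
    | succ n ih =>
      intro z hz hn
      have h1 := hd z hz
      rw [hn, Bs] at h1
      rcases h1 with h1 | ⟨-, y, hy, hyz⟩
      · have := hd' _ _ h1; omega
      · have hyD := BD n hy
        have h2 := hd' _ _ hy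
        have h3 : z ∈ B (d y + 1) := Or.inr ⟨hz, y, hd y hyD, hyz⟩
        have h4 := hd' z (d y + 1) h3
        obtain ⟨w, hw, hwy⟩ := ih y hyD (by omega)
        exact ⟨w, hw, hwy.tail ⟨hyD, hz, hyz, by omega⟩⟩
  have : ∃ y ∈ B 0, {z | ReflTransGen r y z}.Infinite := by
    by_contra! hno
    apply hinf
    refine ((Bfin 0).biUnion (t := fun y => {z | ReflTransGen r y z})
      fun y hy => hno y hy).subset ?_
    intro z hz
    obtain ⟨y, hy, hyz⟩ := hroot _ z hz rfl
    exact Set.mem_biUnion hy hyz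
  obtain ⟨y, hy, hyinf⟩ := this
  obtain ⟨c, -, hc⟩ := koenig (r := r)
    (fun y => (T.succ_fin y).subset fun z hz => hz.2.2.1) hyinf
  have hdc : ∀ i, d (c i) = d (c 0) + i := by
    intro i
    induction i with
    | zero => rfl
    | succ i ih => rw [(hc i).2.2.2, ih, add_assoc]
  refine ⟨c, fun i => (hc i).1, fun i => (hc i).2.2.1, fun i j k e => ?_⟩
  have h1 := dt _ (hc i).1 k
  rw [e] at h1
  have h2 := hdc i
  have h3 := hdc j
  omega

/-- The tube theorem. -/
theorem tube (h : T.PG D) (hinf : D.Infinite) : ∃ (r : ℕ) (φ : ZMod r × ℕ → V), 0 < r ∧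
    Function.Injective φ ∧ Set.range φ = D ∧
    (∀ u v : ZMod r × ℕ, T.arr (φ u) (φ v) ↔ ((v.1 = u.1 ∧ v.2 = u.2 + 1) ∨
      (v.1 = u.1 + 1 ∧ u.2 = v.2 + 1))) ∧
    ∀ (i : ZMod r) (n : ℕ), T.tau (φ (i - 1, n)) (φ (i, n)) := by
  obtain ⟨c0, hc0⟩ := h.exists_ray hinf
  obtain ⟨c, hc, hmin⟩ := h.min_ray hc0
  have hls : ∀ i, c i ∈ T.LS := fun i => h.good.ls _ (hc.mem i)
  -- preds
  have hpred : ∀ n, ∀ z ∈ D, T.arr z (c n) → (∃ m, n = m + 1 ∧ z = c m) ∨ z = T.t (c (n + 1)) := by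
    rintro (_ | n) z hz hzc
    · exact Or.inr (hmin z hz hzc)
    · rcases h.two hc n z hz hzc with h1 | h1
      · exact Or.inl ⟨n, rfl, h1⟩
      · exact Or.inr h1
  set r := Function.minimalPeriod T.t (c 0) with hr
  have hrpos : 0 < r := (h.per _ (hc.mem 0)).minpos
  -- common period
  have hdown : ∀ n p, T.t^[p] (c n) = c n → T.t^[p] (c 0) = c 0 := by
    intro n p
    induction n with
    | zero => exact id
    | succ n ih => exact fun e => ih (per_down h hc (h.two hc n) e)
  have hup : ∀ n p, T.t^[p] (c 0) = c 0 → T.t^[p] (c n) = c n := by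
    intro n p e
    have h1 : T.t^[p] (c 1) = c 1 := by
      have h2 : T.arr (T.t^[p] (T.t (c 1))) (c 0) := by
        rw [← e]
        exact (arr_tk (h.good.ls _ (h.good.t_mem (hc.mem 1))) (hls 0) p).2
          (h.arr_t' (hc.mem 1) (hc.arr 0))
      have h3 := hmin _ (h.good.tk_mem (h.good.t_mem (hc.mem 1)) p) h2
      rw [← Function.iterate_succ_apply, Function.iterate_succ_apply'] at h3
      exact t_inj (h.good.ls _ (h.good.tk_mem (hc.mem 1) p)) (hls 1) h3
    have h2 : ∀ n, T.t^[p] (c (n + 1)) = c (n + 1) := by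
      intro n
      induction n with
      | zero => exact h1
      | succ n ih => exact per_up h hc (h.two hc n) ih
    cases n with
    | zero => exact e
    | succ n => exact h2 n
  have hper : ∀ n p, T.t^[p] (c n) = c n ↔ r ∣ p := by
    intro n p
    constructor
    · intro e
      exact Function.IsPeriodicPt.minimalPeriod_dvd (f := T.t) (x := c 0) (hdown n p e)
    · intro hd
      exact hup n p (iter_dvd Function.iterate_minimalPeriod hd)
  have heq : ∀ n m m' : ℕ, T.t^[m] (c n) = T.t^[m'] (c n) ↔ (m : ZMod r) = m' := by
    have aux : ∀ n m m' : ℕ, m ≤ m' → (T.t^[m] (c n) = T.t^[m'] (c n) ↔ (m : ZMod r) = m') := by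
      intro n m m' hle
      obtain ⟨k, rfl⟩ := Nat.exists_eq_add_of_le hle
      have : (m : ZMod r) = ((m + k : ℕ) : ZMod r) ↔ r ∣ k := by
        rw [← ZMod.natCast_eq_zero_iff]; push_cast; constructor
        · intro e; simpa using e.symm
        · intro e; simp [e]
      rw [this, ← hper n k]
      constructor
      · intro e
        rw [Function.iterate_add_apply] at e
        exact (tk_inj (hls n) (tk_mem (hls n) k) m e).symm
      · intro e
        rw [Function.iterate_add_apply, e]
    intro n m m'
    rcases le_total m m' with hle | hle
    · exact aux n m m' hle
    · rw [eq_comm, aux n m' m hle, eq_comm]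
  have : NeZero r := ⟨hrpos.ne'⟩
  let φ : ZMod r × ℕ → V := fun u => T.t^[(-u.1).val] (c u.2)
  have hφ : ∀ (m n : ℕ) (i : ZMod r), (m : ZMod r) = -i → φ (i, n) = T.t^[m] (c n) := by
    intro m n i e
    show T.t^[(-i).val] (c n) = _
    rw [heq, e, ZMod.natCast_zmod_val]
  have hφt : ∀ (n m : ℕ), φ (-(m : ZMod r), n) = T.t^[m] (c n) := fun n m =>
    hφ m n _ (neg_neg _).symm
  have hinj : Function.Injective φ := by
    rintro ⟨i, n⟩ ⟨j, m⟩ e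
    have e' : T.t^[(-i).val] (c n) = T.t^[(-j).val] (c m) := e
    obtain ⟨k, hk⟩ := h.back (hc.mem n) (-i).val
    have h2 := congrArg (T.t^[k]) e'
    rw [hk, ← Function.iterate_add_apply] at h2
    have := hc.dist _ _ _ h2.symm
    subst this
    rw [heq, ZMod.natCast_zmod_val, ZMod.natCast_zmod_val] at e'
    rw [neg_inj.1 e']
  have hmem : ∀ u, φ u ∈ D := fun u => h.good.tk_mem (hc.mem _) _
  have harr1 : ∀ (m n : ℕ), T.arr (T.t^[m] (c n)) (T.t^[m] (c (n + 1))) := fun m n =>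
    (arr_tk (hls _) (hls _) m).2 (hc.arr n)
  have harr2 : ∀ (m n : ℕ), T.arr (T.t^[m + 1] (c (n + 1))) (T.t^[m] (c n)) := fun m n => by
    rw [Function.iterate_succ_apply]
    exact (arr_tk (h.good.ls _ (h.good.t_mem (hc.mem _))) (hls _) m).2
      (h.arr_t' (hc.mem _) (hc.arr n))
  have hpredm : ∀ (m n : ℕ), ∀ z ∈ D, T.arr z (T.t^[m] (c n)) →
      (∃ l, n = l + 1 ∧ z = T.t^[m] (c l)) ∨ z = T.t^[m + 1] (c (n + 1)) := by
    intro m n z hz hza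
    obtain ⟨y, hy, rfl⟩ := h.exists_pre hz m
    rw [arr_tk (h.good.ls _ hy) (hls n)] at hza
    rcases hpred n y hy hza with ⟨l, h1, rfl⟩ | rfl
    · exact Or.inl ⟨l, h1, rfl⟩
    · exact Or.inr (Function.iterate_succ_apply _ _ _).symm
  have hmemφ : ∀ (m n : ℕ), T.t^[m] (c n) ∈ Set.range φ := fun m n => ⟨_, hφt n m⟩
  have hrange : Set.range φ = D := by
    apply Set.Subset.antisymm
    · rintro _ ⟨u, rfl⟩; exact hmem u
    intro z hz
    have hcon := h.good.conn _ (hc.mem 0) z hz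
    have hpr : ∀ u ∈ Set.range φ, ∀ z ∈ D, T.arr z u → z ∈ Set.range φ := by
      rintro _ ⟨⟨i, n⟩, rfl⟩ z hz hzu
      rcases hpredm (-i).val n z hz hzu with ⟨l, -, rfl⟩ | rfl
      · exact hmemφ _ _
      · exact hmemφ _ _
    have htk : ∀ u ∈ Set.range φ, ∀ k, T.t^[k] u ∈ Set.range φ := by
      rintro _ ⟨⟨i, n⟩, rfl⟩ k
      show T.t^[k] (T.t^[(-i).val] (c n)) ∈ _
      rw [← Function.iterate_add_apply]
      exact hmemφ _ _
    suffices H : z ∈ D ∧ z ∈ Set.range φ from H.2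
    clear hz
    induction hcon with
    | refl => exact ⟨hc.mem 0, hmemφ 0 0⟩
    | @tail u v _ huv ih =>
      have hv := h.good.closed u ih.1 v huv.2.1 huv.2.2
      refine ⟨hv, ?_⟩
      rcases huv.2.2 with h1 | h1
      · have h2 := hpr u ih.2 _ (h.good.t_mem hv) (h.arr_t' hv h1)
        obtain ⟨k, hk⟩ := h.back hv 1
        have := htk _ h2 k
        rwa [show T.t v = T.t^[1] v from rfl, hk] at this
      · exact hpr u ih.2 v hv h1
  refine ⟨r, φ, hrpos, hinj, hrange, ?_, ?_⟩
  · rintro ⟨i, a⟩ ⟨j, b⟩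
    obtain ⟨m, hm⟩ : ∃ m : ℕ, (m : ZMod r) = -j := ⟨(-j).val, ZMod.natCast_zmod_val _⟩
    simp only
    constructor
    · intro harr
      rw [hφ m b j hm] at harr
      rcases hpredm m b _ (hmem (i, a)) harr with ⟨l, rfl, e⟩ | e
      · rw [← hφ m l j hm] at e
        have := hinj e
        simp only [Prod.mk.injEq] at this
        left; exact ⟨this.1.symm, by rw [this.2]⟩
      · rw [← hφ (m + 1) (b + 1) (j - 1) (by push_cast; rw [hm]; ring)] at e
        have := hinj e
        simp only [Prod.mk.injEq] at this
        right; exact ⟨by rw [this.1]; ring, this.2⟩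
    · rintro (⟨rfl, rfl⟩ | ⟨rfl, rfl⟩)
      · rw [hφ m _ _ hm, hφ m _ _ hm]
        exact harr1 _ _
      · rw [hφ m _ _ hm, hφ (m + 1) _ _ (by push_cast; rw [hm]; ring)]
        exact harr2 _ _
  · intro i n
    obtain ⟨m, hm⟩ : ∃ m : ℕ, (m : ZMod r) = -i := ⟨(-i).val, ZMod.natCast_zmod_val _⟩
    rw [hφ m n i hm, hφ (m + 1) n (i - 1) (by push_cast; rw [hm]; ring), Function.iterate_succ_apply']
    exact t_spec (tk_mem (hls n) m)

end PG

end TQ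

end CF

namespace CF

open Relation

namespace TQ

variable {V : Type*} {T : TQ V}

theorem pigeon {α β : Type*} {S : Set α} {Q : Set β} (hS : S.Infinite) (hQ : Q.Finite)
    {R : α → β → Prop} (h : ∀ x ∈ S, ∃ q ∈ Q, R x q) : ∃ q ∈ Q, {x | x ∈ S ∧ R x q}.Infinite := by
  by_contra hno
  apply hS
  refine (hQ.biUnion (t := fun q => {x | x ∈ S ∧ R x q}) ?_).subset ?_
  · intro q hq
    by_contra h'
    exact hno ⟨q, hq, h'⟩
  · intro x hx
    obtain ⟨q, hq, hr⟩ := h x hx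
    exact Set.mem_biUnion hq ⟨hx, hr⟩

/-- sectional path of given length -/
def Sec (T : TQ V) (n : ℕ) (c : ℕ → V) : Prop :=
  (∀ i < n, T.arr (c i) (c (i + 1))) ∧ (∀ i, i + 1 < n → ¬T.tau (c i) (c (i + 2)))

/-- strongly connected class -/
def cls (T : TQ V) (q : V) : Set V := {y | ReflTransGen T.arr q y ∧ ReflTransGen T.arr y q}

theorem cls_sconv (q : V) : T.SConv (T.cls q) :=
  ⟨fun _ ha _ hb => ha.2.trans hb.1, fun _ ha _ hb _ h1 h2 => ⟨ha.1.trans h1, h2.trans hb.2⟩⟩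

theorem prop_tau {Γ : Set V} (hΓ : T.SConv Γ) (hp : ∀ w ∈ Γ, ∃ u, T.tau u w) {z v : V}
    (hz : z ∈ Γ) (hv : v ∈ Γ) (hvz : T.tau v z) : ∀ w ∈ Γ, ∃ u ∈ Γ, T.tau u w := by
  have key : ∀ w, ReflTransGen T.arr z w → w ∈ Γ → ∃ u ∈ Γ, T.tau u w := by
    intro w h
    induction h with
    | refl => exact fun _ => ⟨v, hv, hvz⟩
    | @tail b w h1 h2 ih =>
      intro hw
      have hb : b ∈ Γ := hΓ.convex z hz w hw b h1 (ReflTransGen.single h2)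
      obtain ⟨v', hv', hvb⟩ := ih hb
      obtain ⟨u, hu⟩ := hp w hw
      have h3 : T.arr u b := (T.arr_tau hu b).2 h2
      have h4 : T.arr v' u := (T.arr_tau hvb u).2 h3
      exact ⟨u, hΓ.convex v' hv' b hb u (ReflTransGen.single h4) (ReflTransGen.single h3), hu⟩
  exact fun w hw => key w (hΓ.conn z hz w hw) hw

/-- a cycle has a hook -/
theorem cycle_hook {x : V} (h : TransGen T.arr x x) :
    ∃ z ∈ T.cls x, ∃ v ∈ T.cls x, T.tau v z := by
  have h' : TransGen (T.arrIn Set.univ) x x := tg_mono (fun a b h => ⟨trivial, trivial, h⟩) h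
  obtain ⟨n, c, hn, hc, h0, hcn⟩ := path_of_tg h'
  have hmem : ∀ i, i ≤ n → c i ∈ T.cls x := by
    intro i hi
    have h1 := rtg_of_path hc (Nat.zero_le i) hi
    have h2 := rtg_of_path hc hi le_rfl
    rw [h0] at h1
    rw [hcn] at h2
    exact ⟨arrIn_arr h1, arrIn_arr h2⟩
  let e : ℕ → V := fun i => c (i % n)
  have he : ∀ i, T.arr (e i) (e (i + 1)) := by
    intro i
    show T.arr (c (i % n)) (c ((i + 1) % n))
    have hlt := Nat.mod_lt i hn
    have h1 := hc.2 (i % n) hlt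
    by_cases hi : i % n + 1 = n
    · rw [hi, hcn, ← h0] at h1
      rwa [show (i + 1) % n = 0 by rw [← Nat.mod_add_mod, hi, Nat.mod_self]]
    · rwa [show (i + 1) % n = i % n + 1 by
        rw [Nat.add_mod, Nat.mod_eq_of_lt (show 1 < n by omega), Nat.mod_eq_of_lt (by omega)]]
  have hem : ∀ i, e i ∈ T.cls x := fun i => hmem _ (Nat.mod_lt i hn).le
  by_contra! hno
  refine no_bdd he (fun i ht => hno _ (hem _) _ (hem _) ht)
    (∑ i ∈ Finset.range n, T.len (c i)) (fun i => ?_)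
  exact Finset.single_le_sum (f := fun i => T.len (c i)) (fun _ _ => Nat.zero_le _)
    (Finset.mem_range.2 (Nat.mod_lt i hn))

theorem closed_univ {C E : Set V} (hC : T.IsComp Set.univ C) {x : V} (hxC : x ∈ C) (hxE : x ∈ E)
    (hE : ∀ a ∈ E, ∀ b, T.step a b → b ∈ E) : C ⊆ E := by
  intro y hy
  have := hC.2.2.2 x hxC y hy
  clear hy
  induction this with
  | refl => exact hxE
  | tail _ h ih => exact hE _ ih _ h.2.2

theorem cls_all {C : Set V} (hC : T.IsComp Set.univ C) {x : V} (hxC : x ∈ C)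
    (h : TransGen T.arr x x) (h1 : ∀ w ∈ T.cls x, ∃ u, T.tau u w)
    (h2 : ∀ w ∈ T.cls x, ∃ u, T.tau w u) : C ⊆ T.cls x := by
  obtain ⟨z, hz, v, hv, hvz⟩ := cycle_hook h
  have hs := cls_sconv (T := T) x
  have p1 := prop_tau hs h1 hz hv hvz
  have p2 := prop_tau (T := T.op) hs.op h2 hv hz hvz
  refine closed_univ hC hxC ⟨ReflTransGen.refl, ReflTransGen.refl⟩ ?_
  rintro a ha b (hab | hab)
  · obtain ⟨u, hu, hau⟩ := p2 a ha
    exact hs.convex a ha u hu b (ReflTransGen.single hab)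
      (ReflTransGen.single ((T.arr_tau hau b).1 hab))
  · obtain ⟨u, hu, hau⟩ := p1 a ha
    exact hs.convex u hu a ha b (ReflTransGen.single ((T.arr_tau hau b).2 hab))
      (ReflTransGen.single hab)

theorem exists_class {C S : Set V} (hC : T.IsComp Set.univ C) (hS : S ⊆ C) (hinf : S.Infinite)
    (hcyc : ∀ x ∈ S, TransGen T.arr x x) : ∃ q, (S ∩ T.cls q).Infinite := by
  by_cases h : ∃ x ∈ S, C ⊆ T.cls x
  · obtain ⟨x, hx, h⟩ := h
    exact ⟨x, by rwa [Set.inter_eq_left.2 (hS.trans h)]⟩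
  · push Not at h
    have h1 : ∀ x ∈ S, ∃ q ∈ {p | ¬∃ x, T.tau x p} ∪ {p | ¬∃ x, T.tau p x}, q ∈ T.cls x := by
      intro x hx
      by_contra hno
      refine h x hx (cls_all hC (hS hx) (hcyc x hx) ?_ ?_)
      · intro w hw
        by_contra hw'
        exact hno ⟨w, Or.inl hw', hw⟩
      · intro w hw
        by_contra hw'
        exact hno ⟨w, Or.inr hw', hw⟩
    obtain ⟨q, -, hq⟩ := pigeon hinf (T.proj_fin.union T.inj_fin) h1
    exact ⟨q, hq.mono fun x hx => ⟨hx.1, hx.2.2, hx.2.1⟩⟩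

theorem C_conn {C : Set V} (hC : T.IsComp Set.univ C) {x y : V} (hx : x ∈ C) (h : T.conn x y) :
    y ∈ C := by
  have key : ∀ a b, T.tau a b → (a ∈ C ↔ b ∈ C) := by
    intro a b h
    obtain ⟨z, hz⟩ := T.pred_ne h
    have hz' := (T.arr_tau h z).2 hz
    constructor
    · intro ha
      exact hC.2.2.1 z (hC.2.2.1 a ha z trivial (Or.inl hz')) b trivial (Or.inl hz)
    · intro hb
      exact hC.2.2.1 z (hC.2.2.1 b hb z trivial (Or.inr hz)) a trivial (Or.inr hz')
  induction h with
  | refl => exact hx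
  | tail _ h ih =>
    rcases h with h | h
    · exact (key _ _ h).1 ih
    · exact (key _ _ h).2 ih

theorem Good.sub {C D : Set V} (hC : T.IsComp Set.univ C) (hD : T.Good D) {x : V} (hx : x ∈ D)
    (hxC : x ∈ C) : D ⊆ C := by
  intro y hy
  have := hD.conn x hx y hy
  clear hy
  induction this with
  | refl => exact hxC
  | tail _ h ih => exact hC.2.2.1 _ ih _ trivial h.2.2

theorem Good.conn' {D : Set V} (hD : T.Good D) {x y : V} (hx : x ∈ D) (hy : y ∈ D) :
    ReflTransGen (fun a b => a ∈ D ∧ b ∈ D ∧ T.step a b) x y := by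
  have h := hD.conn x hx y hy
  clear hy
  suffices H : y ∈ D ∧ ReflTransGen (fun a b => a ∈ D ∧ b ∈ D ∧ T.step a b) x y from H.2
  induction h with
  | refl => exact ⟨hx, ReflTransGen.refl⟩
  | tail _ h ih =>
    have := hD.closed _ ih.1 _ h.2.1 h.2.2
    exact ⟨this, ih.2.tail ⟨ih.1, this, h.2.2⟩⟩

theorem Good.isComp {C D S : Set V} (hD : T.Good D) (hne : D.Nonempty)
    (hDS : D ⊆ S) (hS : S ⊆ T.LS) : T.IsComp S D :=
  ⟨hDS, hne, fun x hx y hy h => hD.closed x hx y (hS hy) h,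
    fun x hx y hy => rtg_mono (fun a b h => ⟨hDS h.1, hDS h.2.1, h.2.2⟩) (hD.conn' hx hy)⟩

theorem orb_full {Y : Set V} {x : V} (hY : ∀ y ∈ Y, ∃ k, T.tn k y x) (hinf : Y.Infinite) :
    x ∈ T.LS ∧ ¬T.Per x ∧ {k | T.t^[k] x ∈ Y}.Infinite ∧
    ∀ K, {y | y ∈ Y ∧ ∀ k, K ≤ k → y ≠ T.t^[k] x}.Finite := by
  have hY' : ∀ y ∈ Y, ∃ k, y = T.t^[k] x := fun y hy => (hY y hy).imp fun k h => tn_t h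
  have hfin : ∀ K, ((fun k => T.t^[k] x) '' (Finset.range K : Set ℕ)).Finite := fun K =>
    (Finset.finite_toSet _).image _
  refine ⟨?_, ?_, ?_, ?_⟩
  · by_contra hx
    obtain ⟨P, m, hP, hm⟩ := not_LS hx
    apply hinf
    refine (hfin (m + 1)).subset ?_
    intro y hy
    obtain ⟨k, hk⟩ := hY y hy
    refine ⟨k, ?_, (tn_t hk).symm⟩
    simp only [Finset.coe_range, Set.mem_Iio]
    by_contra! hlt
    have : ∀ k, m + 1 ≤ k → ∀ y, T.tn k y x → False := by
      intro k hk
      induction k, hk using Nat.le_induction with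
      | base =>
        rintro y ⟨c, h1, h2⟩
        rw [tn_fun h2 hm] at h1
        exact hP ⟨_, h1⟩
      | succ k _ ih =>
        rintro y ⟨c, h1, h2⟩
        exact ih c h2
    exact this k hlt y hk
  · rintro ⟨p, hp, e⟩
    apply hinf
    refine (hfin p).subset ?_
    intro y hy
    obtain ⟨k, rfl⟩ := hY' y hy
    refine ⟨k % p, by simpa using Nat.mod_lt k hp, ?_⟩
    exact Function.IsPeriodicPt.iterate_mod_apply (f := T.t) (x := x) (n := p) e k
  · intro hf
    apply hinf
    refine (hf.image fun k => T.t^[k] x).subset ?_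
    intro y hy
    obtain ⟨k, rfl⟩ := hY' y hy
    exact ⟨k, hy, rfl⟩
  · intro K
    refine (hfin K).subset ?_
    rintro y ⟨hy, h⟩
    obtain ⟨k, rfl⟩ := hY' y hy
    refine ⟨k, ?_, rfl⟩
    simp only [Finset.coe_range, Set.mem_Iio]
    by_contra! hlt
    exact h k hlt rfl

/-- conclusion (ii) -/
def Con2 (T : TQ V) (C S : Set V) : Prop :=
  ∃ D : Set V, T.IsComp (C ∩ T.LS) D ∧ (∃ x ∈ D, T.OnCyc D x) ∧ (∃ y ∈ D, ¬∃ z, T.tau y z) ∧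
    ({x ∈ D | T.OnCyc D x} ∩ S).Infinite

theorem stepA_con {C Γ S : Set V} (hC : T.IsComp Set.univ C) (hΓ : T.SConv Γ) (hSC : S ⊆ C)
    (hSΓ : S ⊆ Γ) {x : V} (h : {y | y ∈ S ∧ ∃ k, T.tn k y x}.Infinite) : T.Con2 C S := by
  obtain ⟨hx, hnp, hk, hf⟩ := orb_full (T := T) (fun y hy => hy.2) h
  obtain ⟨D, F, G, hD, hFD, -, hFc, ⟨K, hK⟩, -, -, hinj⟩ :=
    stepA_full hΓ hx hnp (hk.mono fun k hk => hSΓ hk.1)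
  have hxC : x ∈ C := by
    obtain ⟨y, hy, k, hk⟩ := h.nonempty
    exact C_conn hC (hSC hy) (conn_tn hk)
  have hKF := hK K le_rfl
  have hDC : D ⊆ C := hD.sub hC (hFD hKF) (C_conn hC hxC (tk_conn hx K))
  refine ⟨D, hD.isComp (C := C) ⟨_, hFD hKF⟩ (fun y hy => ⟨hDC hy, hD.ls y hy⟩) Set.inter_subset_right,
    ⟨_, hFD hKF, hFc _ hKF⟩, hinj, ?_⟩
  intro hfin
  apply h
  refine ((hf K).union hfin).subset ?_
  intro y hy
  by_cases hy' : ∀ k, K ≤ k → y ≠ T.t^[k] x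
  · exact Or.inl ⟨hy, hy'⟩
  · push Not at hy'
    obtain ⟨k, hk, rfl⟩ := hy'
    have := hK k hk
    exact Or.inr ⟨⟨hFD this, hFc _ this⟩, hy.1⟩

theorem isComp_op {S D : Set V} : T.op.IsComp S D ↔ T.IsComp S D := by
  have : T.op.step = T.step := by
    funext a b
    exact propext or_comm
  unfold IsComp
  rw [this]

theorem onCyc_op {D : Set V} {x : V} : T.op.OnCyc D x ↔ T.OnCyc D x := by
  unfold OnCyc
  rw [← transGen_swap]
  constructor <;> intro h <;> exact tg_mono (fun a b h => ⟨h.2.1, h.1, h.2.2⟩) h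

/-- orbits -/
theorem orb_con {C Γ S : Set V} (hC : T.IsComp Set.univ C) (hΓ : T.SConv Γ) (hSC : S ⊆ C)
    (hSΓ : S ⊆ Γ) (h : ∃ x, {y | y ∈ S ∧ T.conn x y}.Infinite) :
    T.Con2 C S ∨ T.op.Con2 C S := by
  obtain ⟨x, hx⟩ := h
  by_cases h1 : {y | y ∈ S ∧ ∃ k, T.tn k y x}.Infinite
  · exact Or.inl (stepA_con hC hΓ hSC hSΓ h1)
  · by_cases h2 : {y | y ∈ S ∧ ∃ k, T.op.tn k y x}.Infinite
    · exact Or.inr (stepA_con (T := T.op) (isComp_op.2 hC) hΓ.op hSC hSΓ h2)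
    · exfalso
      rw [Set.not_infinite] at h1 h2
      apply hx
      refine (h1.union h2).subset ?_
      rintro y ⟨hy, hxy⟩
      obtain ⟨k, hk | hk⟩ := tn_of_conn hxy
      · exact Or.inr ⟨hy, k, tn_op.2 hk⟩
      · exact Or.inl ⟨hy, k, hk⟩

/-- Step B: a good component -/
theorem exists_good {C S : Set V} (hC : T.IsComp Set.univ C) (hSC : S ⊆ C) (hinf : S.Infinite)
    (hcyc : ∀ x ∈ S, TransGen T.arr x x) (horb : ∀ x, {y | y ∈ S ∧ T.conn x y}.Finite) :
    ∃ D, T.Good D ∧ D ⊆ C ∧ (D ∩ S).Infinite := by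
  have hni : {y | y ∈ S ∧ T.NI y}.Infinite := by
    intro hf
    apply hinf
    refine (((T.proj_fin.biUnion (t := fun P => {y | y ∈ S ∧ T.conn P y}) fun P _ => horb P).union
      (T.N_fin.biUnion (t := fun P => {y | y ∈ S ∧ T.conn P y}) fun P _ => horb P)).union hf).subset ?_
    intro y hy
    by_cases hls : y ∈ T.LS
    · by_cases hn : T.NI y
      · exact Or.inr ⟨hy, hn⟩
      · obtain ⟨w, -, hw⟩ := TransGen.tail'_iff.1 (hcyc y hy)
        have hwl : w ∉ T.LS := fun h => hn ⟨hls, w, h, hw⟩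
        obtain ⟨m, hm⟩ := N_of_arr hwl hls (Or.inl hw)
        exact Or.inl (Or.inr (Set.mem_biUnion hm ⟨hy, (tk_conn hls m).symm⟩))
    · obtain ⟨P, m, hP, hm⟩ := not_LS hls
      exact Or.inl (Or.inl (Set.mem_biUnion (show P ∈ {p | ¬∃ x, T.tau x p} from hP)
        ⟨hy, conn_tn hm⟩))
  by_cases h : ∃ y, y ∈ S ∧ T.NI y ∧ C ⊆ T.comp y
  · obtain ⟨y, hy, hn, hCy⟩ := h
    have hg := good_comp hn
    refine ⟨_, hg, hg.sub hC (mem_comp y) (hSC hy), ?_⟩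
    rwa [Set.inter_eq_right.2 (hSC.trans hCy)]
  · have h1 : ∀ y ∈ {y | y ∈ S ∧ T.NI y}, ∃ z ∈ T.N, z ∈ T.comp y := by
      rintro y ⟨hy, hn⟩
      have hg := good_comp hn
      by_contra hno
      refine h ⟨y, hy, hn, closed_univ hC (hSC hy) (mem_comp y) ?_⟩
      intro a ha b hab
      by_cases hb : b ∈ T.LS
      · exact hg.closed a ha b hb hab
      · exfalso
        obtain ⟨m, hm⟩ := N_of_arr hb (hg.ls a ha) hab.symm
        exact hno ⟨_, hm, hg.tk_mem ha m⟩
    obtain ⟨z, -, hz⟩ := pigeon hni T.N_fin h1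
    obtain ⟨y0, ⟨hy0, hn0⟩, hy0z⟩ := hz.nonempty
    have hg := good_comp hn0
    refine ⟨_, hg, hg.sub hC (mem_comp y0) (hSC hy0), hz.mono ?_⟩
    rintro y ⟨⟨hy, hn⟩, hyz⟩
    exact ⟨ReflTransGen.trans hy0z (rtg_symm (fun _ _ h => lstep_symm h) hyz), hy⟩

theorem per_RS {x : V} (hx : x ∈ T.LS) (hp : T.Per x) : x ∈ T.op.LS := by
  obtain ⟨p, hp, e⟩ := hp
  rintro ⟨y, hy, hyn⟩
  rw [conn_op] at hy
  apply hyn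
  have hyk : ∃ k, y = T.t^[k] x := by
    obtain ⟨k, hk | hk⟩ := tn_of_conn hy
    · refine ⟨p * k - k, ?_⟩
      have hyl := LS_conn hx hy
      apply tk_inj hyl (tk_mem hx _) k
      rw [← tn_t hk, ← Function.iterate_add_apply, Nat.add_sub_cancel' (Nat.le_mul_of_pos_left k hp)]
      exact (iter_dvd e (Dvd.intro _ rfl)).symm
    · exact ⟨k, tn_t hk⟩
  obtain ⟨k, rfl⟩ := hyk
  refine ⟨T.t^[k + (p - 1)] x, ?_⟩
  show T.tau _ _
  have := t_spec (tk_mem hx (k + (p - 1)))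
  rwa [← Function.iterate_succ_apply' T.t, show (k + (p - 1)).succ = k + p by omega,
    Function.iterate_add_apply, e] at this

theorem rtg_exit {r : V → V → Prop} {F : Set V} {u v : V} (h : ReflTransGen r u v) (hu : u ∈ F)
    (hv : v ∉ F) : ∃ y w, y ∈ F ∧ w ∉ F ∧ r y w ∧ ReflTransGen r u y ∧ ReflTransGen r w v := by
  induction h with
  | refl => exact absurd hu hv
  | @tail b c h1 h2 ih =>
    by_cases hb : b ∈ F
    · exact ⟨b, c, hb, hv, h2, h1, ReflTransGen.refl⟩
    · obtain ⟨y, w, a1, a2, a3, a4, a5⟩ := ih hb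
      exact ⟨y, w, a1, a2, a3, a4, a5.tail h2⟩

theorem rtg_entry {r : V → V → Prop} {F : Set V} {u v : V} (h : ReflTransGen r u v) (hu : u ∉ F)
    (hv : v ∈ F) : ∃ y w, y ∉ F ∧ w ∈ F ∧ r y w ∧ ReflTransGen r u y ∧ ReflTransGen r w v := by
  obtain ⟨y, w, a1, a2, a3⟩ := rtg_exit (F := Fᶜ) h hu (fun h => h hv)
  exact ⟨y, w, a1, not_not.1 a2, a3⟩

theorem collapse {D : Set V} (hD : T.Good D) : ∀ (n : ℕ) (c : ℕ → V), T.PathIn D n c →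
    ∃ k c', 2 * k ≤ n ∧ T.PathIn D (n - 2 * k) c' ∧ T.Sec (n - 2 * k) c' ∧ c' 0 = c 0 ∧
      c' (n - 2 * k) = T.t^[k] (c n) := by
  intro n
  induction n using Nat.strong_induction_on with
  | _ n ih =>
    intro c hc
    by_cases hs : T.Sec n c
    · exact ⟨0, c, by omega, hc, hs, rfl, rfl⟩
    · have : ∃ i, i + 1 < n ∧ T.tau (c i) (c (i + 2)) := by
        by_contra! hno
        exact hs ⟨hc.2, hno⟩
      obtain ⟨i, hi, hti⟩ := this
      have hci : c i = T.t (c (i + 2)) := (t_eq hti).symm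
      let c1 : ℕ → V := fun j => if j ≤ i then c j else T.t (c (j + 2))
      have h1 : ∀ j, j ≤ i → c1 j = c j := fun j hj => if_pos hj
      have h2 : ∀ j, i ≤ j → c1 j = T.t (c (j + 2)) := by
        intro j hj
        rcases hj.eq_or_lt with rfl | hj
        · rw [h1 i le_rfl, hci]
        · exact if_neg (by omega)
      have hp : T.PathIn D (n - 2) c1 := by
        constructor
        · intro j hj
          by_cases hji : j ≤ i
          · rw [h1 j hji]; exact hc.1 j (by omega)
          · rw [h2 j (by omega)]; exact hD.t_mem (hc.1 _ (by omega))
        · intro j hj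
          by_cases hji : j < i
          · rw [h1 j hji.le, h1 (j + 1) hji]; exact hc.2 j (by omega)
          · rw [h2 j (by omega), h2 (j + 1) (by omega), show j + 1 + 2 = j + 2 + 1 by ring,
              arr_t (hD.ls _ (hc.1 _ (by omega))) (hD.ls _ (hc.1 _ (by omega)))]
            exact hc.2 _ (by omega)
      obtain ⟨k, c', a1, a2, a3, a4, a5⟩ := ih (n - 2) (by omega) c1 hp
      have e : n - 2 * (k + 1) = n - 2 - 2 * k := by omega
      refine ⟨k + 1, c', by omega, by rwa [e], by rwa [e], ?_, ?_⟩
      · rw [a4, h1 0 (Nat.zero_le _)]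
      · rw [e, a5, h2 (n - 2) (by omega), Function.iterate_succ_apply,
          show n - 2 + 2 = n by omega]

theorem reach_fin (D : Set V) (a : V) (n : ℕ) :
    {x | ∃ m ≤ n, ∃ c, T.PathIn D m c ∧ c 0 = a ∧ c m = x}.Finite := by
  induction n with
  | zero =>
    refine (Set.finite_singleton a).subset ?_
    rintro x ⟨m, hm, c, -, h0, hx⟩
    obtain rfl : m = 0 := by omega
    exact hx.symm.trans h0
  | succ n ih =>
    refine (ih.union (ih.biUnion (t := fun y => {z | T.arr y z}) fun y _ => T.succ_fin y)).subset ?_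
    rintro x ⟨m, hm, c, hc, h0, hx⟩
    rcases Nat.lt_or_ge m (n + 1) with hlt | hge
    · exact Or.inl ⟨m, by omega, c, hc, h0, hx⟩
    · obtain rfl : m = n + 1 := by omega
      refine Or.inr (Set.mem_biUnion (x := c n) ⟨n, le_rfl, c,
        ⟨fun i hi => hc.1 i (by omega), fun i hi => hc.2 i (by omega)⟩, h0, rfl⟩ ?_)
      rw [← hx]
      exact hc.2 n (by omega)

theorem path_append {D : Set V} {n m : ℕ} {c d : ℕ → V} (hc : T.PathIn D n c) (hd : T.PathIn D m d)
    (h : c n = d 0) : ∃ e, T.PathIn D (n + m) e ∧ e 0 = c 0 ∧ e (n + m) = d m := by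
  let e : ℕ → V := fun i => if i ≤ n then c i else d (i - n)
  have h1 : ∀ i, i ≤ n → e i = c i := fun i hi => if_pos hi
  have h2 : ∀ i, n ≤ i → e i = d (i - n) := by
    intro i hi
    rcases hi.eq_or_lt with rfl | hi
    · rw [h1 n le_rfl, h, Nat.sub_self]
    · exact if_neg (by omega)
  refine ⟨e, ⟨?_, ?_⟩, h1 0 (Nat.zero_le _), ?_⟩
  · intro i hi
    by_cases hin : i ≤ n
    · rw [h1 i hin]; exact hc.1 i hin
    · rw [h2 i (by omega)]; exact hd.1 _ (by omega)
  · intro i hi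
    by_cases hin : i < n
    · rw [h1 i hin.le, h1 (i + 1) hin]; exact hc.2 i hin
    · rw [h2 i (by omega), h2 (i + 1) (by omega), show i + 1 - n = i - n + 1 by omega]
      exact hd.2 _ (by omega)
  · rw [h2 _ (by omega), Nat.add_sub_cancel_left]

/-- infinitely many vertices between two vertices in an acyclic good set is impossible -/
theorem between {D Γ : Set V} (hD : T.Good D) (hac : ∀ x, ¬T.OnCyc D x) (hΓ : T.SConv Γ)
    (hbd : ∀ a ∈ Γ, ∀ b ∈ Γ, ∃ L, ∀ n c, T.Sec n c → c 0 = a → c n = b → n ≤ L)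
    {a b : V} (ha : a ∈ Γ) (hb : b ∈ Γ) (haD : a ∈ D) (hbD : b ∈ D)
    (hinf : {x | ReflTransGen (T.arrIn D) a x ∧ ReflTransGen (T.arrIn D) x b}.Infinite) : False := by
  obtain ⟨c0, hc0⟩ := hD.far0 hbD haD
  have hbd' : ∀ k, ∃ L, T.t^[k] b ∈ Γ → ∀ n c, T.Sec n c → c 0 = a → c n = T.t^[k] b → n ≤ L := by
    intro k
    by_cases h : T.t^[k] b ∈ Γ
    · obtain ⟨L, hL⟩ := hbd a ha _ h
      exact ⟨L, fun _ => hL⟩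
    · exact ⟨0, fun h' => absurd h' h⟩
  choose L hL using hbd'
  set M := 2 * c0 + ∑ k ∈ Finset.range (c0 + 1), L k with hM
  obtain ⟨x, ⟨hax, hxb⟩, hxn⟩ := hinf.exists_notMem_finite (reach_fin (T := T) D a M)
  obtain ⟨n, c, hc, h0, hn⟩ := path_of_rtg hax haD
  have hnM : M < n := by
    by_contra! hle
    exact hxn ⟨n, hle, c, hc, h0, hn⟩
  have hxD : x ∈ D := by rw [← hn]; exact hc.1 n le_rfl
  obtain ⟨m, d, hd, h0', hm⟩ := path_of_rtg hxb hxD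
  obtain ⟨e, he, e0, en⟩ := path_append hc hd (by rw [hn, h0'])
  obtain ⟨k, c', a1, a2, a3, a4, a5⟩ := collapse hD _ e he
  rw [e0, h0] at a4
  rw [en, hm] at a5
  have hpath := rtg_of_path a2 (Nat.zero_le _) le_rfl
  rw [a4, a5] at hpath
  have hk : k ≤ c0 := by
    by_contra! hlt
    have h1 := hD.desc' (hD.tk_mem hbD c0) (show 0 < k - c0 by omega)
    rw [← Function.iterate_add_apply, Nat.sub_add_cancel hlt.le] at h1
    exact hac _ ((TransGen.trans_right hpath h1).trans_left hc0)
  have hkΓ : T.t^[k] b ∈ Γ := hΓ.convex a ha b hb _ (arrIn_arr hpath) (desc_arr (hD.ls b hbD) k)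
  have h1 := hL k hkΓ _ _ a3 a4 a5
  have h2 : L k ≤ ∑ k ∈ Finset.range (c0 + 1), L k :=
    Finset.single_le_sum (f := L) (fun _ _ => Nat.zero_le _) (Finset.mem_range.2 (by omega))
  omega

end TQ
end CF

namespace CF

open Relation

namespace TQ

variable {V : Type*} {T : TQ V}

theorem caseB3_Q {D Γ : Set V} (hΓ : T.SConv Γ) (hls : ∀ y ∈ D, y ∈ T.LS) (z : V) :
    ∃ Q F G : Set V, Q.Finite ∧ G.Finite ∧ (∀ y ∈ F, ∃ g ∈ G, T.conn y g) ∧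
      {y | y ∈ Γ ∧ y ∈ D ∧ ∃ i, T.t^[i] y = z} ⊆ Q ∪ F ∧
      {v | v ∉ F ∧ ∃ y ∈ F, T.step y v} ⊆ Q := by
  by_cases hf : {y | y ∈ Γ ∧ y ∈ D ∧ ∃ i, T.t^[i] y = z}.Finite
  · exact ⟨_, ∅, ∅, hf, Set.finite_empty, by simp, by simp, by simp⟩
  · have hY : ∀ y ∈ {y | y ∈ Γ ∧ y ∈ D ∧ ∃ i, T.t^[i] y = z}, ∃ k, T.op.tn k y z := by
      rintro y ⟨-, hyD, i, rfl⟩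
      exact ⟨i, tn_op.2 (t_tn (hls y hyD))⟩
    obtain ⟨h1, h2, h3, h4⟩ := orb_full (T := T.op) hY hf
    obtain ⟨D', F, G, hD', hFD', hG, -, ⟨K, hK⟩, hb, hcov, -⟩ :=
      stepA_full (T := T.op) hΓ.op h1 h2 (h3.mono fun k hk => hk.1)
    refine ⟨_, F, G, hb.union (h4 K), hG, ?_, ?_, ?_⟩
    · intro y hy
      obtain ⟨g, hg, hc⟩ := hcov y (hFD' hy)
      exact ⟨g, hg, conn_op.1 hc⟩
    · intro y hy
      by_cases hy' : ∀ k, K ≤ k → y ≠ T.op.t^[k] z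
      · exact Or.inl (Or.inr ⟨hy, hy'⟩)
      · push Not at hy'
        obtain ⟨k, hk, rfl⟩ := hy'
        exact Or.inr (hK k hk)
    · rintro v ⟨hv, y, hy, h⟩
      exact Or.inl ⟨hv, y, hy, h.symm⟩

theorem caseB3 {D Γ S : Set V} (hD : T.Good D) (hac : ∀ x, ¬T.OnCyc D x) (hΓ : T.SConv Γ)
    (hSΓ : S ⊆ Γ) (hcyc : ∀ x ∈ S, TransGen T.arr x x)
    (horb : ∀ x, {y | y ∈ S ∧ T.conn x y}.Finite)
    (hbd : ∀ a ∈ Γ, ∀ b ∈ Γ, ∃ L, ∀ n c, T.Sec n c → c 0 = a → c n = b → n ≤ L)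
    (hinf : (D ∩ S).Infinite) : False := by
  choose Q F G hQ hG hcov hYQ hbQ using caseB3_Q (D := D) hΓ hD.ls
  -- boundary points
  have hNof : ∀ y ∈ D, ∀ w, w ∉ D → T.step w y → ∃ m, T.t^[m] y ∈ T.N := by
    intro y hy w hw h
    exact N_of_arr (fun hl => hw (hD.closed y hy w hl h.symm)) (hD.ls y hy) h
  have hexit : ∀ x ∈ D ∩ S, ∃ b ∈ Γ, b ∈ D ∧ (∃ m, T.t^[m] b ∈ T.N) ∧
      ReflTransGen (T.arrIn D) x b := by
    rintro x ⟨hxD, hxS⟩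
    have hxΓ := hSΓ hxS
    obtain ⟨x1, h1, h2⟩ := TransGen.head'_iff.1 (hcyc x hxS)
    by_cases hx1 : x1 ∈ D
    · rcases first_exit h2 hx1 with ⟨-, h3⟩ | ⟨y, w, hy, hw, hyw, h3, h4⟩
      · exact absurd (TransGen.head' ⟨hxD, hx1, h1⟩ h3) (hac x)
      · have h5 := ReflTransGen.head (r := T.arrIn D) ⟨hxD, hx1, h1⟩ h3
        exact ⟨y, hΓ.convex x hxΓ x hxΓ y (arrIn_arr h5) (ReflTransGen.head hyw h4), hy,
          hNof y hy w hw (Or.inr hyw), h5⟩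
    · exact ⟨x, hxΓ, hxD, hNof x hxD x1 hx1 (Or.inr h1), ReflTransGen.refl⟩
  have hentry : ∀ x ∈ D ∩ S, ∃ a ∈ Γ, a ∈ D ∧ (∃ m, T.t^[m] a ∈ T.N) ∧
      ReflTransGen (T.arrIn D) a x := by
    rintro x ⟨hxD, hxS⟩
    have hxΓ := hSΓ hxS
    obtain ⟨x1, h2, h1⟩ := TransGen.tail'_iff.1 (hcyc x hxS)
    by_cases hx1 : x1 ∈ D
    · rcases last_entry h2 hx1 with ⟨-, h3⟩ | ⟨w, y, hw, hy, hwy, h3, h4⟩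
      · exact absurd (TransGen.tail' h3 ⟨hx1, hxD, h1⟩) (hac x)
      · have h5 := ReflTransGen.tail (r := T.arrIn D) h4 ⟨hx1, hxD, h1⟩
        exact ⟨y, hΓ.convex x hxΓ x hxΓ y (h3.tail hwy) (arrIn_arr h5), hy,
          hNof y hy w hw (Or.inl hwy), h5⟩
    · exact ⟨x, hxΓ, hxD, hNof x hxD x1 hx1 (Or.inl h1), ReflTransGen.refl⟩
  set Qa : Set V := ⋃ z ∈ T.N, Q z with hQa
  have hQaf : Qa.Finite := T.N_fin.biUnion fun z _ => hQ z
  set Fa : Set V := ⋃ z ∈ T.N, F z with hFa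
  have hinf' : {x | x ∈ D ∩ S ∧ x ∉ Fa}.Infinite := by
    intro hf
    apply hinf
    refine (hf.union (T.N_fin.biUnion (t := fun z => ⋃ g ∈ G z, {y | y ∈ S ∧ T.conn g y})
      fun z _ => (hG z).biUnion fun g _ => horb g)).subset ?_
    intro x hx
    by_cases hxF : x ∈ Fa
    · right
      obtain ⟨z, hz, hxz⟩ := Set.mem_iUnion₂.1 hxF
      obtain ⟨g, hg, hc⟩ := hcov z x hxz
      exact Set.mem_biUnion hz (Set.mem_biUnion hg ⟨hx.2, hc.symm⟩)
    · exact Or.inl ⟨hx, hxF⟩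
  have hab : ∀ x ∈ {x | x ∈ D ∩ S ∧ x ∉ Fa}, ∃ p ∈ Qa ×ˢ Qa, p.1 ∈ Γ ∧ p.2 ∈ Γ ∧ p.1 ∈ D ∧ p.2 ∈ D ∧
      ReflTransGen (T.arrIn D) p.1 x ∧ ReflTransGen (T.arrIn D) x p.2 := by
    rintro x ⟨hx, hxF⟩
    have hxΓ := hSΓ hx.2
    have hxF' : ∀ z ∈ T.N, x ∉ F z := fun z hz h => hxF (Set.mem_biUnion hz h)
    have h1 : ∃ a ∈ Qa, a ∈ Γ ∧ a ∈ D ∧ ReflTransGen (T.arrIn D) a x := by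
      obtain ⟨a, haΓ, haD, ⟨m, hm⟩, hax⟩ := hentry x hx
      rcases hYQ _ ⟨haΓ, haD, m, rfl⟩ with h | h
      · exact ⟨a, Set.mem_biUnion hm h, haΓ, haD, hax⟩
      · obtain ⟨y, w, hy, hw, hyw, h3, h4⟩ := rtg_exit hax h (hxF' _ hm)
        refine ⟨w, Set.mem_biUnion hm (hbQ _ ⟨hw, y, hy, Or.inl hyw.2.2⟩), ?_, hyw.2.1, h4⟩
        exact hΓ.convex a haΓ x hxΓ w (arrIn_arr (h3.tail hyw)) (arrIn_arr h4)
    have h2 : ∃ b ∈ Qa, b ∈ Γ ∧ b ∈ D ∧ ReflTransGen (T.arrIn D) x b := by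
      obtain ⟨b, hbΓ, hbD, ⟨m, hm⟩, hxb⟩ := hexit x hx
      rcases hYQ _ ⟨hbΓ, hbD, m, rfl⟩ with h | h
      · exact ⟨b, Set.mem_biUnion hm h, hbΓ, hbD, hxb⟩
      · obtain ⟨y, w, hy, hw, hyw, h3, h4⟩ := rtg_entry hxb (hxF' _ hm) h
        refine ⟨y, Set.mem_biUnion hm (hbQ _ ⟨hy, w, hw, Or.inr hyw.2.2⟩), ?_, hyw.1, h3⟩
        exact hΓ.convex x hxΓ b hbΓ y (arrIn_arr h3) (arrIn_arr (ReflTransGen.head hyw h4))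
    obtain ⟨a, a1, a2, a3, a4⟩ := h1
    obtain ⟨b, b1, b2, b3, b4⟩ := h2
    exact ⟨(a, b), ⟨a1, b1⟩, a2, b2, a3, b3, a4, b4⟩
  obtain ⟨⟨a, b⟩, -, hp⟩ := pigeon hinf' (hQaf.prod hQaf) hab
  obtain ⟨x, -, h1, h2, h3, h4, -⟩ := hp.nonempty
  exact between hD hac hΓ hbd h1 h2 h3 h4 (hp.mono fun x hx => hx.2.2.2.2.2)

/-- tubes -/
def Tube (T : TQ V) (D : Set V) : Prop := ∃ (r : ℕ) (φ : ZMod r × ℕ → V), 0 < r ∧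
    Function.Injective φ ∧ Set.range φ = D ∧
    (∀ u v : ZMod r × ℕ, T.arr (φ u) (φ v) ↔ ((v.1 = u.1 ∧ v.2 = u.2 + 1) ∨
      (v.1 = u.1 + 1 ∧ u.2 = v.2 + 1))) ∧
    ∀ (i : ZMod r) (n : ℕ), T.tau (φ (i - 1, n)) (φ (i, n))

/-- abstract main theorem -/
theorem main {C S0 : Set V} (hC : T.IsComp Set.univ C) (hS0 : S0 ⊆ C) (hinf0 : S0.Infinite)
    (hcyc0 : ∀ x ∈ S0, TransGen T.arr x x)
    (hbd0 : ∀ x ∈ S0, ∀ a ∈ T.cls x, ∀ b ∈ T.cls x,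
      ∃ L, ∀ n c, T.Sec n c → c 0 = a → c n = b → n ≤ L) :
    (∃ D, T.IsComp (C ∩ T.LS ∩ (C ∩ T.op.LS)) D ∧ T.Tube D ∧ (D ∩ S0).Infinite) ∨
    T.Con2 C S0 ∨ T.op.Con2 C S0 := by
  obtain ⟨q, hq⟩ := exists_class hC hS0 hinf0 hcyc0
  set Γ := T.cls q with hΓdef
  have hΓ : T.SConv Γ := cls_sconv q
  set S := S0 ∩ Γ with hS
  have hSC : S ⊆ C := fun x hx => hS0 hx.1
  have hSΓ : S ⊆ Γ := fun x hx => hx.2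
  have hcyc : ∀ x ∈ S, TransGen T.arr x x := fun x hx => hcyc0 x hx.1
  have hbd : ∀ a ∈ Γ, ∀ b ∈ Γ, ∃ L, ∀ n c, T.Sec n c → c 0 = a → c n = b → n ≤ L := by
    obtain ⟨x, hx⟩ := hq.nonempty
    intro a ha b hb
    exact hbd0 x hx.1 a ⟨hΓ.conn x hx.2 a ha, hΓ.conn a ha x hx.2⟩ b
      ⟨hΓ.conn x hx.2 b hb, hΓ.conn b hb x hx.2⟩
  have up2 : ∀ T' : TQ V, T'.Con2 C S → T'.Con2 C S0 := by
    rintro T' ⟨D, h1, h2, h3, h4⟩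
    exact ⟨D, h1, h2, h3, h4.mono fun x hx => ⟨hx.1, hx.2.1⟩⟩
  by_cases horb : ∃ x, {y | y ∈ S ∧ T.conn x y}.Infinite
  · exact Or.inr ((orb_con hC hΓ hSC hSΓ horb).imp (up2 _) (up2 _))
  replace horb : ∀ x, {y | y ∈ S ∧ T.conn x y}.Finite := by
    intro x
    by_contra h
    exact horb ⟨x, h⟩
  obtain ⟨D, hD, hDC, hDinf⟩ := exists_good hC hSC hq hcyc horb
  left
  by_cases hper : ∃ x ∈ D, T.Per x
  · obtain ⟨x, hx, hxp⟩ := hper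
    have hpg : T.PG D := ⟨hD, fun y hy => hD.per hx hy hxp⟩
    refine ⟨D, hD.isComp (C := C) ⟨x, hx⟩ ?_ fun y hy => hy.1.2, hpg.tube (hDinf.mono Set.inter_subset_left),
      hDinf.mono fun y hy => ⟨hy.1, hy.2.1⟩⟩
    intro y hy
    exact ⟨⟨hDC hy, hD.ls y hy⟩, hDC hy, per_RS (hD.ls y hy) (hpg.per y hy)⟩
  · exfalso
    push Not at hper
    by_cases hcy : ∃ x, T.OnCyc D x
    · obtain ⟨F, G, -, hG, -, -, -, hcov, -⟩ := structure_thm hD hper hcy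
      apply hDinf
      refine (hG.biUnion (t := fun g => {y | y ∈ S ∧ T.conn g y}) fun g _ => horb g).subset ?_
      rintro y ⟨hy, hyS⟩
      obtain ⟨g, hg, hc⟩ := hcov y hy
      exact Set.mem_biUnion hg ⟨hyS, hc.symm⟩
    · push Not at hcy
      exact caseB3 hD hcy hΓ hSΓ hcyc horb hbd hDinf

end TQ
end CF

namespace CF
set_option linter.all false
open Function

variable {R : Type u} [Ring R]

instance (X : ModA R) : IsNoetherian R X.M := (isFiniteLength_iff_isNoetherian_isArtinian.1 X.finLen).1
instance (X : ModA R) : IsArtinian R X.M := (isFiniteLength_iff_isNoetherian_isArtinian.1 X.finLen).2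

lemma comp_sum' {X Y Z : Type*} [AddCommGroup X] [Module R X] [AddCommGroup Y] [Module R Y]
    [AddCommGroup Z] [Module R Z] {ι : Type*} (s : Finset ι) (f : Y →ₗ[R] Z)
    (g : ι → (X →ₗ[R] Y)) : f.comp (∑ i ∈ s, g i) = ∑ i ∈ s, f.comp (g i) := by
  ext x; simp [LinearMap.sum_apply]

lemma sum_comp' {X Y Z : Type*} [AddCommGroup X] [Module R X] [AddCommGroup Y] [Module R Y]
    [AddCommGroup Z] [Module R Z] {ι : Type*} (s : Finset ι) (g : ι → (Y →ₗ[R] Z))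
    (f : X →ₗ[R] Y) : (∑ i ∈ s, g i).comp f = ∑ i ∈ s, (g i).comp f := by
  ext x; simp [LinearMap.sum_apply]

/-- Length of a finite length module as a natural number. -/
noncomputable def mlen (X : ModA R) : ℕ := (Module.length R X.M).toNat

lemma mlen_eq (X : ModA R) : (mlen X : ℕ∞) = Module.length R X.M :=
  ENat.natCast_toNat (Module.length_ne_top)

lemma mlen_iso {X Y : ModA R} (h : X.Iso Y) : mlen X = mlen Y := by
  obtain ⟨e⟩ := h; unfold mlen; rw [e.length_eq]

lemma mlen_le_inj {X Y : ModA R} (f : X.M →ₗ[R] Y.M) (hf : Injective f) : mlen X ≤ mlen Y := by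
  have := Module.length_le_of_injective f hf
  rw [← mlen_eq, ← mlen_eq] at this; exact_mod_cast this

lemma mlen_le_surj {X Y : ModA R} (f : X.M →ₗ[R] Y.M) (hf : Surjective f) : mlen Y ≤ mlen X := by
  have := Module.length_le_of_surjective f hf
  rw [← mlen_eq, ← mlen_eq] at this; exact_mod_cast this

lemma mlen_exact {X Y Z : ModA R} (f : X.M →ₗ[R] Y.M) (g : Y.M →ₗ[R] Z.M) (hf : Injective f)
    (hg : Surjective g) (h : LinearMap.range f = LinearMap.ker g) : mlen Y = mlen X + mlen Z := by
  have := Module.length_eq_add_of_exact f g hf hg (LinearMap.exact_iff.2 h.symm)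
  rw [← mlen_eq, ← mlen_eq, ← mlen_eq] at this; exact_mod_cast this

lemma mlen_pos_of_indec {X : ModA R} (h : X.IsIndec) : 0 < mlen X := by
  have : 0 < Module.length R X.M := Module.length_pos_iff.2 h.1
  rw [← mlen_eq] at this; exact_mod_cast this

/-- an injective endomorphism-like map between modules of the same length is bijective -/
lemma bij_of_inj_len {X Y : ModA R} (f : X.M →ₗ[R] Y.M) (hf : Injective f) (h : mlen Y ≤ mlen X) :
    Bijective f := by
  refine ⟨hf, ?_⟩
  rw [← LinearMap.range_eq_top]
  by_contra hne
  have h1 := Submodule.length_lt hne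
  rw [← (LinearEquiv.ofInjective f hf).length_eq, ← mlen_eq, ← mlen_eq] at h1
  have : mlen X < mlen Y := by exact_mod_cast h1
  omega

lemma indec_endo {X : ModA R} (hX : X.IsIndec) (f : Module.End R X.M) :
    IsUnit f ∨ IsNilpotent f := by
  obtain ⟨n, hn, hn1⟩ := (f.eventually_isCompl_ker_pow_range_pow.and
    (Filter.eventually_ge_atTop 1)).exists
  set e := Submodule.projection _ _ hn with he
  have hid : e * e = e := by
    ext x
    exact Submodule.projection_apply_of_mem_left hn (Submodule.projection_apply_mem hn x)
  rcases hX.2 e hid with h | h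
  · left
    have hk : LinearMap.ker (f ^ n) = ⊥ := by
      rw [← Submodule.range_projection hn, ← he, h, LinearMap.range_zero]
    have hinj : Injective (f ^ n) := LinearMap.ker_eq_bot.1 hk
    have hb : Bijective (f ^ n) := bij_of_inj_len (X := X) (Y := X) _ hinj le_rfl
    have hu : IsUnit (f ^ n) := (Module.End.isUnit_iff _).2 hb
    exact (isUnit_pow_iff (by omega)).1 hu
  · right
    refine ⟨n, ?_⟩
    rw [← LinearMap.ker_eq_top, ← Submodule.range_projection hn, ← he, h]
    exact LinearMap.range_id

lemma indec_local {X : ModA R} (hX : X.IsIndec) : IsLocalRing (Module.End R X.M) := by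
  haveI := hX.1
  refine IsLocalRing.of_isUnit_or_isUnit_one_sub_self fun f => ?_
  rcases indec_endo hX f with h | h
  · exact Or.inl h
  · exact Or.inr h.isUnit_one_sub

lemma indec_add {X : ModA R} (hX : X.IsIndec) {f g : X.M →ₗ[R] X.M} (h : Bijective (f + g)) :
    Bijective f ∨ Bijective g := by
  haveI := indec_local hX
  have hu : IsUnit ((f : Module.End R X.M) + g) := (Module.End.isUnit_iff _).2 h
  obtain ⟨u, hu⟩ := hu
  have h1 : (↑u⁻¹ : Module.End R X.M) * f + ↑u⁻¹ * g = 1 := by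
    rw [← mul_add, ← hu, Units.inv_mul]
  rcases IsLocalRing.isUnit_or_isUnit_of_add_one h1 with h | h
  · left
    have := (Units.isUnit_units_mul u⁻¹ f).1 h
    exact (Module.End.isUnit_iff _).1 this
  · right
    have := (Units.isUnit_units_mul u⁻¹ g).1 h
    exact (Module.End.isUnit_iff _).1 this

lemma indec_not_bij_zero {X : ModA R} (hX : X.IsIndec) : ¬ Bijective (0 : X.M →ₗ[R] X.M) := by
  intro h
  obtain ⟨a, b, hab⟩ := hX.1
  exact hab (h.1 rfl)

lemma indec_sum {X : ModA R} (hX : X.IsIndec) {ι : Type*} (s : Finset ι) (f : ι → (X.M →ₗ[R] X.M))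
    (h : Bijective (∑ i ∈ s, f i : X.M →ₗ[R] X.M)) : ∃ i ∈ s, Bijective (f i) := by
  classical
  induction s using Finset.induction_on with
  | empty => exact absurd (by simpa using h) (indec_not_bij_zero hX)
  | insert a s ha ih =>
    rw [Finset.sum_insert ha] at h
    rcases indec_add hX h with h | h
    · exact ⟨a, by simp, h⟩
    · obtain ⟨i, hi, h⟩ := ih h
      exact ⟨i, by simp [hi], h⟩

lemma bij_id (X : ModA R) : Bijective (LinearMap.id : X.M →ₗ[R] X.M) := bijective_id

/-- inverse of bijective linear map -/
lemma exists_inv {X Y : ModA R} {f : X.M →ₗ[R] Y.M} (h : Bijective f) :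
    ∃ g : Y.M →ₗ[R] X.M, g.comp f = LinearMap.id ∧ f.comp g = LinearMap.id := by
  refine ⟨(LinearEquiv.ofBijective f h).symm.toLinearMap, ?_, ?_⟩
  · ext x; exact (LinearEquiv.ofBijective f h).symm_apply_apply x
  · ext x; exact (LinearEquiv.ofBijective f h).apply_symm_apply x

lemma bij_of_inv {X Y : ModA R} {f : X.M →ₗ[R] Y.M} {g : Y.M →ₗ[R] X.M}
    (h1 : g.comp f = LinearMap.id) (h2 : f.comp g = LinearMap.id) : Bijective f :=
  bijective_iff_has_inverse.2 ⟨g, fun x => LinearMap.congr_fun h1 x, fun x => LinearMap.congr_fun h2 x⟩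

lemma iso_of_bij {X Y : ModA R} {f : X.M →ₗ[R] Y.M} (h : Bijective f) : X.Iso Y :=
  ⟨LinearEquiv.ofBijective f h⟩

lemma splitMono_of_bij_comp {X Y Z : ModA R} {s : X.M →ₗ[R] Y.M} {r : Y.M →ₗ[R] Z.M}
    (h : Bijective (r.comp s)) : SplitMonoMap s := by
  obtain ⟨g, h1, -⟩ := exists_inv h
  exact ⟨g.comp r, by rw [LinearMap.comp_assoc, h1]⟩

lemma splitEpi_of_bij_comp {X Y Z : ModA R} {s : X.M →ₗ[R] Y.M} {r : Y.M →ₗ[R] Z.M}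
    (h : Bijective (r.comp s)) : SplitEpiMap r := by
  obtain ⟨g, -, h1⟩ := exists_inv h
  exact ⟨s.comp g, by rw [← LinearMap.comp_assoc, h1]⟩

lemma splitMono_bij {X Y : ModA R} (hX : Nontrivial X.M) (hY : Y.IsIndec) {s : X.M →ₗ[R] Y.M}
    (h : SplitMonoMap s) : Bijective s := by
  obtain ⟨r, hr⟩ := h
  have : (s.comp r : Module.End R Y.M) * (s.comp r) = s.comp r := by
    ext y
    exact congrArg s (LinearMap.congr_fun hr (r y))
  rcases hY.2 _ this with h | h
  · exfalso
    obtain ⟨a, b, hab⟩ := hX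
    apply hab
    have h2 : ∀ x, x = (0 : X.M) := fun x => by
      have h1 := LinearMap.congr_fun hr x
      have h3 := congrArg r (LinearMap.congr_fun h (s x))
      simp only [LinearMap.comp_apply, LinearMap.id_apply, LinearMap.zero_apply, map_zero] at h1 h3
      rw [h1, h1] at h3
      exact h3
    rw [h2 a, h2 b]
  · exact bij_of_inv hr h

lemma splitEpi_bij {X Y : ModA R} (hX : X.IsIndec) (hY : Nontrivial Y.M) {r : X.M →ₗ[R] Y.M}
    (h : SplitEpiMap r) : Bijective r := by
  obtain ⟨s, hs⟩ := h
  have := splitMono_bij hY hX ⟨r, hs⟩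
  obtain ⟨g, h1, h2⟩ := exists_inv this
  have : g = r := by
    have := congrArg (fun t => t.comp g) hs
    simpa [LinearMap.comp_assoc, h2] using this.symm
  subst this
  exact bij_of_inv h2 h1

lemma bij_of_comp {X Y : ModA R} (hX : X.IsIndec) (hY : Y.IsIndec) {Z : ModA R} (hZ : Z.IsIndec)
    {s : X.M →ₗ[R] Y.M} {r : Y.M →ₗ[R] Z.M}
    (h : Bijective (r.comp s)) : Bijective s ∧ Bijective r :=
  ⟨splitMono_bij hX.1 hY (splitMono_of_bij_comp h), splitEpi_bij hY hZ.1 (splitEpi_of_bij_comp h)⟩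

lemma inRad_iff {X Y : ModA R} (hX : X.IsIndec) (hY : Y.IsIndec) (f : X.M →ₗ[R] Y.M) :
    InRad f ↔ ¬ Bijective f := by
  constructor
  · intro h hb
    obtain ⟨g, h1, h2⟩ := exists_inv hb
    exact h X hX LinearMap.id g (by rw [LinearMap.comp_id, h1]; exact bij_id X)
  · intro h Z hZ g k hb
    have h1 : Bijective ((k.comp f).comp g) := hb
    exact h (bij_of_comp hX hY hZ (bij_of_comp hZ hX hZ h1).2).1

lemma isIndec_iso {X Y : ModA R} (h : X.Iso Y) (hX : X.IsIndec) : Y.IsIndec := by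
  obtain ⟨e⟩ := h
  refine ⟨?_, fun f hf => ?_⟩
  · haveI := hX.1; exact e.symm.toEquiv.nontrivial
  · have := hX.2 (e.symm.toLinearMap.comp (f.comp e.toLinearMap)) (by
      ext x
      have := LinearMap.congr_fun hf (e x)
      simp only [Module.End.mul_apply] at this
      simp [this])
    rcases this with h | h
    · left
      ext y
      have := congrArg e (LinearMap.congr_fun h (e.symm y))
      simpa using this
    · right
      ext y
      have := congrArg e (LinearMap.congr_fun h (e.symm y))
      simpa using this

/-- A decomposition into indecomposables. -/
structure Dec (N : ModA R) where
  I : Type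
  [fin : Fintype I]
  S : I → ModA R
  indec : ∀ j, (S j).IsIndec
  i : ∀ j, (S j).M →ₗ[R] N.M
  p : ∀ j, N.M →ₗ[R] (S j).M
  pi_self : ∀ j, (p j).comp (i j) = LinearMap.id
  pi_ne : ∀ j l, j ≠ l → (p j).comp (i l) = 0
  total : ∑ j, (i j).comp (p j) = LinearMap.id

attribute [instance] Dec.fin

/-- The submodule as object -/
def subM (N : ModA R) (P : Submodule R N.M) : ModA R :=
  ⟨P, N.finLen.of_injective P.injective_subtype⟩

lemma exists_dec (N : ModA R) : Nonempty (Dec N) := by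
  generalize hn : mlen N = n
  induction n using Nat.strong_induction_on generalizing N with
  | _ n ih =>
  by_cases hs : Nontrivial N.M
  swap
  · rw [not_nontrivial_iff_subsingleton] at hs
    refine ⟨⟨Empty, fun j => j.elim, fun j => j.elim, fun j => j.elim, fun j => j.elim,
      fun j => j.elim, fun j => j.elim, ?_⟩⟩
    ext x; exact Subsingleton.elim _ _
  by_cases hi : N.IsIndec
  · refine ⟨⟨Unit, fun _ => N, fun _ => hi, fun _ => LinearMap.id, fun _ => LinearMap.id,
      fun _ => rfl, fun j l h => absurd (Subsingleton.elim j l) h, ?_⟩⟩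
    simp
  have : ∃ f : Module.End R N.M, f * f = f ∧ f ≠ 0 ∧ f ≠ 1 := by
    by_contra hcon
    push Not at hcon
    refine hi ⟨hs, fun f hf => ?_⟩
    by_cases h0 : f = 0
    · exact Or.inl h0
    · exact Or.inr (hcon f hf h0)
  obtain ⟨f, hf, h0, h1⟩ := this
  have hf' : ∀ x, f (f x) = f x := fun x => LinearMap.congr_fun hf x
  let A := subM N (LinearMap.range f)
  let B := subM N (LinearMap.ker f)
  let iA : A.M →ₗ[R] N.M := (LinearMap.range f).subtype
  let iB : B.M →ₗ[R] N.M := (LinearMap.ker f).subtype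
  let pA : N.M →ₗ[R] A.M := f.rangeRestrict
  let pB : N.M →ₗ[R] B.M := LinearMap.codRestrict _ (LinearMap.id - f) (by
    intro x; simp [hf'])
  have eA : pA.comp iA = LinearMap.id := by
    ext ⟨_, y, rfl⟩; exact Subtype.ext (hf' y)
  have eB : pB.comp iB = LinearMap.id := by
    ext ⟨y, hy⟩; apply Subtype.ext
    have : f y = 0 := hy
    show y - f y = y
    simp [this]
  have eAB : pA.comp iB = 0 := by
    ext ⟨y, hy⟩; exact Subtype.ext hy
  have eBA : pB.comp iA = 0 := by
    ext ⟨_, y, rfl⟩; apply Subtype.ext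
    show f y - f (f y) = 0
    simp [hf']
  have eS : iA.comp pA + iB.comp pB = LinearMap.id := by
    ext y
    show f y + (y - f y) = y
    simp
  have lA : mlen A < mlen N := by
    by_contra hcon
    have := bij_of_inj_len iA Subtype.val_injective (by omega)
    apply h1
    ext y
    obtain ⟨⟨_, z, rfl⟩, rfl⟩ := this.2 y
    exact hf' z
  have lB : mlen B < mlen N := by
    by_contra hcon
    have := bij_of_inj_len iB Subtype.val_injective (by omega)
    apply h0
    ext y
    obtain ⟨⟨z, hz⟩, rfl⟩ := this.2 y
    exact hz
  obtain ⟨dA⟩ := ih _ (hn ▸ lA) A rfl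
  obtain ⟨dB⟩ := ih _ (hn ▸ lB) B rfl
  refine ⟨⟨dA.I ⊕ dB.I, Sum.elim dA.S dB.S, ?_, fun j => match j with
      | Sum.inl j => iA.comp (dA.i j)
      | Sum.inr j => iB.comp (dB.i j), fun j => match j with
      | Sum.inl j => (dA.p j).comp pA
      | Sum.inr j => (dB.p j).comp pB, ?_, ?_, ?_⟩⟩
  · rintro (j | j)
    · exact dA.indec j
    · exact dB.indec j
  · have key : ∀ {X Y Z : ModA R} (a : Z.M →ₗ[R] X.M) (b : X.M →ₗ[R] Y.M)
      (c : Y.M →ₗ[R] X.M) (d : X.M →ₗ[R] Z.M), c.comp b = LinearMap.id → d.comp a = LinearMap.id →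
        (d.comp c).comp (b.comp a) = LinearMap.id := by
      intro X Y Z a b c d h1 h2
      ext x
      have := LinearMap.congr_fun h1 (a x)
      have h3 := LinearMap.congr_fun h2 x
      simp at this h3
      simp [this, h3]
    rintro (j | j)
    · exact key _ _ _ _ eA (dA.pi_self j)
    · exact key _ _ _ _ eB (dB.pi_self j)
  · have keyA : ∀ j l, j ≠ l → ((dA.p j).comp pA).comp (iA.comp (dA.i l)) = 0 := by
      intro j l h
      ext x
      have := LinearMap.congr_fun eA (dA.i l x)
      have h3 := LinearMap.congr_fun (dA.pi_ne j l h) x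
      simp at this h3
      simp [this, h3]
    have keyB : ∀ j l, j ≠ l → ((dB.p j).comp pB).comp (iB.comp (dB.i l)) = 0 := by
      intro j l h
      ext x
      have := LinearMap.congr_fun eB (dB.i l x)
      have h3 := LinearMap.congr_fun (dB.pi_ne j l h) x
      simp at this h3
      simp [this, h3]
    rintro (j | j) (l | l) h
    · exact keyA j l (fun e => h (by rw [e]))
    · show ((dA.p j).comp pA).comp (iB.comp (dB.i l)) = 0
      rw [LinearMap.comp_assoc, ← LinearMap.comp_assoc (dB.i l), eAB]; simp
    · show ((dB.p j).comp pB).comp (iA.comp (dA.i l)) = 0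
      rw [LinearMap.comp_assoc, ← LinearMap.comp_assoc (dA.i l), eBA]; simp
    · exact keyB j l (fun e => h (by rw [e]))
  · rw [Fintype.sum_sum_type]
    have h1 : ∑ j, (iA.comp (dA.i j)).comp ((dA.p j).comp pA) = iA.comp pA := by
      have : ∀ j, (iA.comp (dA.i j)).comp ((dA.p j).comp pA)
          = iA.comp (((dA.i j).comp (dA.p j)).comp pA) := fun j => rfl
      simp_rw [this]
      rw [← comp_sum', ← sum_comp', dA.total]; rfl
    have h2 : ∑ j, (iB.comp (dB.i j)).comp ((dB.p j).comp pB) = iB.comp pB := by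
      have : ∀ j, (iB.comp (dB.i j)).comp ((dB.p j).comp pB)
          = iB.comp (((dB.i j).comp (dB.p j)).comp pB) := fun j => rfl
      simp_rw [this]
      rw [← comp_sum', ← sum_comp', dB.total]; rfl
    rw [← eS, ← h1, ← h2]
    rfl

/-- sum over a decomposition -/
lemma Dec.total_apply {N : ModA R} (d : Dec N) (x : N.M) : ∑ j, d.i j (d.p j x) = x := by
  have := LinearMap.congr_fun d.total x
  simpa [LinearMap.sum_apply] using this

/-- the isomorphism with the product -/
noncomputable def Dec.equiv {N : ModA R} (d : Dec N) : N.M ≃ₗ[R] (∀ j, (d.S j).M) := by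
  classical
  exact LinearEquiv.ofLinear (LinearMap.pi d.p) (∑ j, (d.i j).comp (LinearMap.proj j)) (by
    ext j x l
    simp only [LinearMap.comp_apply, LinearMap.sum_apply, LinearMap.proj_apply, map_sum,
      LinearMap.pi_apply, LinearMap.single_apply, LinearMap.id_apply]
    rw [Finset.sum_eq_single j]
    · by_cases h : l = j
      · subst h
        simpa using LinearMap.congr_fun (d.pi_self l) x
      · simpa [h] using LinearMap.congr_fun (d.pi_ne l j h) x
    · intro b _ hb
      simp [hb]
    · simp) (by
    ext x
    simpa [LinearMap.sum_apply] using d.total_apply x)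

lemma Dec.mlen_eq {N : ModA R} (d : Dec N) : mlen N = ∑ j, mlen (d.S j) := by
  have h := d.equiv.length_eq
  rw [Module.length_pi_of_fintype] at h
  have h2 : ∀ j, Module.length R (d.S j).M = (mlen (d.S j) : ℕ∞) := fun j => (CF.mlen_eq _).symm
  simp_rw [h2] at h
  rw [← CF.mlen_eq] at h
  exact_mod_cast h

/-- `X` is a retract of `N` -/
def Retr (X N : ModA R) : Prop := ∃ (s : X.M →ₗ[R] N.M) (r : N.M →ₗ[R] X.M), Bijective (r.comp s)

lemma Dec.exists_of_retr {X N : ModA R} (hX : X.IsIndec) (d : Dec N) {s : X.M →ₗ[R] N.M}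
    {r : N.M →ₗ[R] X.M} (h : Bijective (r.comp s)) :
    ∃ j, Bijective ((d.p j).comp s) ∧ Bijective (r.comp (d.i j)) := by
  have e : r.comp s = ∑ j, (r.comp (d.i j)).comp ((d.p j).comp s) := by
    have : ∀ j, (r.comp (d.i j)).comp ((d.p j).comp s) = r.comp (((d.i j).comp (d.p j)).comp s) :=
      fun j => rfl
    simp_rw [this]
    rw [← comp_sum', ← sum_comp', d.total]; rfl
  rw [e] at h
  obtain ⟨j, -, hj⟩ := indec_sum hX _ _ h
  exact ⟨j, bij_of_comp hX (d.indec j) hX hj⟩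

lemma Dec.retr {N : ModA R} (d : Dec N) (j : d.I) : Retr (d.S j) N :=
  ⟨d.i j, d.p j, by rw [d.pi_self]; exact bij_id _⟩

lemma retr_exists_iso {X N : ModA R} (hX : X.IsIndec) (d : Dec N) (h : Retr X N) :
    ∃ j, X.Iso (d.S j) := by
  obtain ⟨s, r, h⟩ := h
  obtain ⟨j, hj, -⟩ := d.exists_of_retr hX h
  exact ⟨j, iso_of_bij hj⟩

lemma sum_mlen_le {ι : Type*} (s : Finset ι) (Z : ι → ModA R) (hZ : ∀ a ∈ s, (Z a).IsIndec)
    (N : ModA R) (hr : ∀ a ∈ s, Retr (Z a) N)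
    (hne : ∀ a ∈ s, ∀ b ∈ s, (Z a).Iso (Z b) → a = b) : ∑ a ∈ s, mlen (Z a) ≤ mlen N := by
  classical
  obtain ⟨d⟩ := exists_dec N
  have h1 : ∀ a : s, ∃ j, (Z a).Iso (d.S j) := fun a => retr_exists_iso (hZ a a.2) d (hr a a.2)
  choose j hj using h1
  have hinj : Injective j := by
    intro a b hab
    apply Subtype.ext
    apply hne a a.2 b b.2
    obtain ⟨e⟩ := hj a
    obtain ⟨e'⟩ := hj b
    rw [← hab] at e'
    exact ⟨e.trans e'.symm⟩
  rw [d.mlen_eq, ← Finset.sum_coe_sort]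
  calc ∑ a : s, mlen (Z a) = ∑ a : s, mlen (d.S (j a)) :=
        Finset.sum_congr rfl fun a _ => mlen_iso (hj a)
    _ = ∑ b ∈ Finset.univ.map ⟨j, hinj⟩, mlen (d.S b) := by rw [Finset.sum_map]; rfl
    _ ≤ _ := Finset.sum_le_sum_of_subset (Finset.subset_univ _)

end CF

namespace CF
open Function
set_option linter.all false

section Hull
variable {K : Type u} [CommRing K]

lemma exists_inj_embed (S : Type u) [AddCommGroup S] [Module K S] :
    ∃ (I : Type u) (_ : AddCommGroup I) (_ : Module K I) (i : S →ₗ[K] I),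
      Module.Injective K I ∧ Injective i := by
  let S' := ModuleCat.of K S
  let I := CategoryTheory.Injective.under S'
  refine ⟨I, inferInstance, inferInstance, (CategoryTheory.Injective.ι S').hom, ?_, ?_⟩
  · rw [Module.injective_iff_injective_object]
    exact CategoryTheory.Injective.injective_under S'
  · exact (ModuleCat.mono_iff_injective _).1 inferInstance

lemma exists_max_disj {I : Type u} [AddCommGroup I] [Module K I] (P T0 : Submodule K I)
    (h : Disjoint T0 P) : ∃ T, T0 ≤ T ∧ Disjoint T P ∧ ∀ T', T ≤ T' → Disjoint T' P → T' = T := by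
  obtain ⟨T, h1, h2⟩ := zorn_le_nonempty₀ {T : Submodule K I | Disjoint T P} (by
    intro c hc hchain y hy
    refine ⟨sSup c, ?_, fun z hz => le_sSup hz⟩
    have : DirectedOn (· ≤ ·) c := hchain.directedOn
    exact (this.disjoint_sSup_right.2 (fun b hb => (hc hb : Disjoint b P).symm)).symm) T0 h
  exact ⟨T, h1, h2.prop, fun T' h3 h4 => le_antisymm (h2.2 h4 h3) h3⟩

lemma exists_hull (S : Type u) [AddCommGroup S] [Module K S] :
    ∃ (J : Type u) (_ : AddCommGroup J) (_ : Module K J) (i : S →ₗ[K] J),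
      Module.Injective K J ∧ Injective i ∧
      ∀ N : Submodule K J, N ≠ ⊥ → ∃ x ∈ N, x ∈ LinearMap.range i ∧ x ≠ 0 := by
  obtain ⟨I, _, _, i, hI, hi⟩ := exists_inj_embed (K := K) S
  obtain ⟨T, -, hT, hTm⟩ := exists_max_disj (LinearMap.range i) ⊥ disjoint_bot_left
  obtain ⟨J, hsJ, hJ, hJm⟩ := exists_max_disj T (LinearMap.range i) hT.symm
  have hTJ : ∀ W : Submodule K I, T ≤ W → Disjoint W J → W = T := fun W h1 h2 =>
    hTm W h1 (h2.mono_right hsJ)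
  have hj : Injective (T.mkQ.comp J.subtype) := by
    rw [← LinearMap.ker_eq_bot, eq_bot_iff]
    intro x hx
    have : (x : I) ∈ T := by simpa using hx
    have := Submodule.disjoint_def.1 hJ x x.2 this
    simpa using this
  obtain ⟨θ, hθ⟩ := hI.out (T.mkQ.comp J.subtype) hj J.subtype
  have hθ' : ∀ x ∈ J, θ (T.mkQ x) = x := fun x hx => hθ ⟨x, hx⟩
  have hW : (T.comap (θ.comp T.mkQ)) = T := by
    apply hTJ
    · intro x hx
      have h0 : T.mkQ x = 0 := by simpa using hx
      rw [Submodule.mem_comap, LinearMap.comp_apply, h0, map_zero]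
      exact T.zero_mem
    · rw [Submodule.disjoint_def]
      intro x hx hxJ
      have h1 : θ (T.mkQ x) ∈ T := hx
      rw [hθ' x hxJ] at h1
      exact Submodule.disjoint_def.1 hJ x hxJ h1
  have hinj : ∀ x, θ (T.mkQ x) ∈ T → x ∈ T := by
    intro x hx
    rw [← hW]; exact hx
  have hr : LinearMap.range θ = J := by
    apply hJm
    · intro x hx; exact ⟨T.mkQ x, hθ' x hx⟩
    · rw [Submodule.disjoint_def]
      rintro _ ⟨y, rfl⟩ hy
      obtain ⟨x, rfl⟩ := T.mkQ_surjective y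
      have := hinj x hy
      have h0 : T.mkQ x = 0 := by simpa using this
      rw [h0, map_zero]
  have hc : IsCompl J T := by
    refine ⟨hJ, ?_⟩
    rw [codisjoint_iff, eq_top_iff]
    intro x _
    have hz : θ (T.mkQ x) ∈ J := by rw [← hr]; exact ⟨_, rfl⟩
    have h2 := hθ' _ hz
    have h3 : x - θ (T.mkQ x) ∈ T := by
      apply hinj
      rw [map_sub, map_sub, h2, sub_self]; exact T.zero_mem
    have := Submodule.add_mem_sup hz h3
    simpa using this
  refine ⟨J, inferInstance, inferInstance, LinearMap.codRestrict J i (fun x => hsJ ⟨x, rfl⟩),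
    ⟨?_⟩, ?_, ?_⟩
  · intro X Y _ _ _ _ f hf g
    obtain ⟨h, hh⟩ := hI.out f hf (J.subtype.comp g)
    refine ⟨(J.projectionOnto T hc).comp h, fun x => ?_⟩
    rw [LinearMap.comp_apply, hh]
    exact Submodule.projectionOnto_apply_left hc (g x)
  · intro x y hxy
    exact hi (congrArg Subtype.val hxy)
  · intro N hN
    by_contra hcon
    push Not at hcon
    have h1 : N.map J.subtype ⊔ T = T := by
      apply hTm _ le_sup_right
      rw [Submodule.disjoint_def]
      rintro _ hx ⟨s, rfl⟩
      obtain ⟨_, ⟨n, hn, rfl⟩, t, ht, e⟩ := Submodule.mem_sup.1 hx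
      have e' : t = i s - J.subtype n := by rw [← e]; abel
      have h0 : t = 0 := Submodule.disjoint_def.1 hJ t
        (by rw [e']; exact J.sub_mem (hsJ ⟨s, rfl⟩) n.2) ht
      rw [h0, add_zero] at e
      have := hcon n hn ⟨s, Subtype.ext e.symm⟩
      rw [← e, this]; rfl
    apply hN
    rw [eq_bot_iff]
    intro n hn
    have h2 : (n : I) ∈ T := by
      rw [← h1]; exact Submodule.mem_sup_left ⟨n, hn, rfl⟩
    exact Subtype.ext (Submodule.disjoint_def.1 hJ n n.2 h2)

/-- A dualizing module: injective cogenerator such that duals of finite length modules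
are not longer. -/
structure IsDualizing (K : Type u) [CommRing K] (J : Type u) [AddCommGroup J] [Module K J] :
    Prop where
  inj : Module.Injective K J
  cogen : ∀ (M : Type u) [AddCommGroup M] [Module K M] (x : M), x ≠ 0 → ∃ f : M →ₗ[K] J, f x ≠ 0
  simple : ∀ (k : Type u) [AddCommGroup k] [Module K k], IsSimpleModule K k →
    ∀ f g : k →ₗ[K] J, f ≠ 0 → ∃ c : K, g = c • f

lemma exists_dualizing (K : Type u) [CommRing K] : ∃ (J : Type u) (_ : AddCommGroup J)
    (_ : Module K J), IsDualizing K J := by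
  classical
  obtain ⟨J, _, _, i, hJ, hi, hess⟩ :=
    exists_hull (K := K) (∀ m : MaximalSpectrum K, K ⧸ m.asIdeal)
  refine ⟨J, inferInstance, inferInstance, hJ, ?_, ?_⟩
  · intro M _ _ x hx
    set I : Ideal K := LinearMap.ker (LinearMap.toSpanSingleton K M x) with hI
    have hIne : I ≠ ⊤ := by
      intro h
      have : (1 : K) ∈ I := h ▸ Submodule.mem_top
      rw [hI] at this
      simp at this
      exact hx this
    obtain ⟨m, hm, hIm⟩ := Ideal.exists_le_maximal I hIne
    let m' : MaximalSpectrum K := ⟨m, hm⟩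
    let a : (K ⧸ I) →ₗ[K] M := Submodule.liftQ I (LinearMap.toSpanSingleton K M x) le_rfl
    have ha : Injective a := by
      rw [← LinearMap.ker_eq_bot]
      exact Submodule.ker_liftQ_eq_bot _ _ _ le_rfl
    let b : (K ⧸ I) →ₗ[K] (K ⧸ m'.asIdeal) := Submodule.liftQ I m.mkQ (by
      rw [Submodule.ker_mkQ]; exact hIm)
    let c := i.comp ((LinearMap.single K (fun m : MaximalSpectrum K => K ⧸ m.asIdeal) m').comp b)
    obtain ⟨f, hf⟩ := hJ.out a ha c
    refine ⟨f, ?_⟩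
    have h1 : a (I.mkQ 1) = x := by
      show (1 : K) • x = x
      rw [one_smul]
    rw [← h1, hf]
    intro h0
    have h2 : i ((LinearMap.single K (fun m : MaximalSpectrum K => K ⧸ m.asIdeal) m')
      (b (I.mkQ 1))) = i 0 := by rw [map_zero]; exact h0
    have h3 := congrFun (hi h2) m'
    simp [b] at h3
    have h4 : (m.mkQ 1 : K ⧸ m) = 0 := h3
    rw [Submodule.mkQ_apply, Submodule.Quotient.mk_eq_zero] at h4
    exact hm.ne_top ((Ideal.eq_top_iff_one _).2 h4)
  · intro k _ _ hk f g hf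
    obtain ⟨v, hv⟩ : ∃ v, f v ≠ 0 := by
      by_contra hcon
      push Not at hcon
      exact hf (LinearMap.ext hcon)
    have hv0 : v ≠ 0 := by rintro rfl; simp at hv
    have hsurj : ∀ w : k, w ≠ 0 → ∀ y : k, ∃ c : K, c • w = y := fun w hw y =>
      IsSimpleModule.toSpanSingleton_surjective K hw y
    have hmem : ∀ h : k →ₗ[K] J, ∃ s, i s = h v := by
      intro h
      by_cases h0 : h v = 0
      · exact ⟨0, by rw [map_zero, h0]⟩
      obtain ⟨x, hx, ⟨s, hs⟩, hx0⟩ := hess (Submodule.span K {h v}) (by simpa using h0)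
      obtain ⟨a, rfl⟩ := Submodule.mem_span_singleton.1 hx
      have hav : a • v ≠ 0 := by
        intro e
        apply hx0
        rw [← map_smul, e, map_zero]
      obtain ⟨b, hb⟩ := hsurj _ hav v
      refine ⟨b • s, ?_⟩
      rw [map_smul, hs, ← map_smul, ← map_smul, hb]
    set m : Ideal K := LinearMap.ker (LinearMap.toSpanSingleton K k v) with hm
    have hmax : m.IsMaximal := IsSimpleModule.ker_toSpanSingleton_isMaximal K hv0
    let m' : MaximalSpectrum K := ⟨m, hmax⟩
    have hkill : ∀ a ∈ m, a • v = 0 := fun a ha => ha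
    have hsupp : ∀ (h : k →ₗ[K] J) s, i s = h v → ∀ n, n ≠ m' → s n = 0 := by
      intro h s hs n hn
      have hnle : ¬ m ≤ n.asIdeal := by
        intro hle
        apply hn
        have := hmax.eq_of_le n.isMaximal.ne_top hle
        exact MaximalSpectrum.ext this.symm
      obtain ⟨a, ha, han⟩ := SetLike.not_le_iff_exists.1 hnle
      have h1 : a • s = 0 := by
        apply hi
        rw [map_smul, hs, ← map_smul, hkill a ha, map_zero, map_zero]
      have h2 := congrFun h1 n
      obtain ⟨z, hz⟩ := Submodule.mkQ_surjective _ (s n)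
      rw [Pi.smul_apply, ← hz, ← map_smul, Pi.zero_apply] at h2
      rw [← hz]
      rw [Submodule.mkQ_apply, Submodule.Quotient.mk_eq_zero] at h2 ⊢
      exact (n.isMaximal.isPrime.mem_or_mem h2).resolve_left han
    obtain ⟨s, hs⟩ := hmem f
    obtain ⟨t, ht⟩ := hmem g
    have hsm : s m' ≠ 0 := by
      intro h0
      apply hv
      rw [← hs]
      have : s = 0 := by
        funext n
        by_cases hn : n = m'
        · rw [hn, h0]; rfl
        · exact hsupp f s hs n hn
      rw [this, map_zero]
    have : IsSimpleModule K (K ⧸ m'.asIdeal) := isSimpleModule_iff_isCoatom.2 hmax.out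
    obtain ⟨c, hc⟩ := IsSimpleModule.toSpanSingleton_surjective K hsm (t m')
    have htc : t = c • s := by
      funext n
      by_cases hn : n = m'
      · subst hn; exact hc.symm
      · rw [Pi.smul_apply, hsupp f s hs n hn, hsupp g t ht n hn, smul_zero]
    refine ⟨c, ?_⟩
    ext w
    obtain ⟨a, rfl⟩ := hsurj v hv0 w
    rw [map_smul, LinearMap.smul_apply, map_smul, ← ht, ← hs, htc, map_smul, smul_comm]

variable {J : Type u} [AddCommGroup J] [Module K J]

lemma IsDualizing.extend (hJ : IsDualizing K J) {X Y : Type u} [AddCommGroup X] [Module K X]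
    [AddCommGroup Y] [Module K Y] (f : X →ₗ[K] Y) (hf : Injective f) (g : X →ₗ[K] J) :
    ∃ h : Y →ₗ[K] J, h.comp f = g := by
  obtain ⟨h, hh⟩ := hJ.inj.out f hf g
  exact ⟨h, LinearMap.ext hh⟩

lemma IsDualizing.length_le (hJ : IsDualizing K J) (M : Type u) [AddCommGroup M] [Module K M]
    (hM : IsFiniteLength K M) : Module.length K (M →ₗ[K] J) ≤ Module.length K M := by
  induction hM with
  | of_subsingleton => 
    rw [Module.length_eq_zero_iff.2]
    · exact zero_le
    · exact ⟨fun f g => LinearMap.ext fun x => by rw [Subsingleton.elim x 0, map_zero, map_zero]⟩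
  | @of_simple_quotient M _ _ N hs hN ih =>
    have h1 : Module.length K M = Module.length K N + Module.length K (M ⧸ N) :=
      Module.length_eq_add_of_exact N.subtype N.mkQ N.injective_subtype N.mkQ_surjective
        (LinearMap.exact_subtype_mkQ N)
    have h2 : Module.length K (M →ₗ[K] J) = Module.length K ((M ⧸ N) →ₗ[K] J) +
        Module.length K (N →ₗ[K] J) := by
      refine Module.length_eq_add_of_exact (LinearMap.lcomp K J N.mkQ)
        (LinearMap.lcomp K J N.subtype) ?_ ?_ ?_
      · intro f g h
        ext x
        exact LinearMap.congr_fun h x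
      · intro g
        exact hJ.extend N.subtype N.injective_subtype g
      · intro f
        constructor
        · intro h
          refine ⟨N.liftQ f ?_, ?_⟩
          · intro x hx
            exact LinearMap.congr_fun h ⟨x, hx⟩
          · ext x; rfl
        · rintro ⟨g, rfl⟩
          ext x
          have : N.mkQ (N.subtype x) = 0 := by simp
          show g (N.mkQ (N.subtype x)) = 0
          rw [this, map_zero]
    rw [h1, h2, add_comm]
    refine add_le_add ih ?_
    have hlen : Module.length K (M ⧸ N) = 1 := Module.length_eq_one_iff.2 hs
    rw [hlen]
    by_cases hnt : Nontrivial ((M ⧸ N) →ₗ[K] J)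
    · refine (Module.length_eq_one_iff.2 ?_).le
      rw [isSimpleModule_iff_toSpanSingleton_surjective]
      refine ⟨hnt, fun f hf g => ?_⟩
      obtain ⟨c, hc⟩ := hJ.simple _ hs f g hf
      exact ⟨c, hc.symm⟩
    · rw [not_nontrivial_iff_subsingleton] at hnt
      rw [Module.length_eq_zero]; exact zero_le

end Hull
end CF

namespace CF
open Function
set_option linter.all false

section KM
variable {K : Type u} [CommRing K] {R : Type u} [Ring R] [Algebra K R]

/-- the `K`-module structure -/
instance kmod (X : ModA R) : Module K X.M := Module.compHom X.M (algebraMap K R)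

lemma kmod_smul (X : ModA R) (k : K) (x : X.M) : k • x = algebraMap K R k • x := rfl

instance ktower (X : ModA R) : IsScalarTower K R X.M :=
  ⟨fun k r x => by rw [kmod_smul, Algebra.smul_def, mul_smul]⟩

instance kcomm (X : ModA R) : SMulCommClass R K X.M :=
  ⟨fun r k x => by rw [kmod_smul, kmod_smul, smul_smul, smul_smul, Algebra.commutes]⟩

instance kcomm' (X : ModA R) : SMulCommClass K R X.M := SMulCommClass.symm _ _ _

variable (K) in
/-- `K`-linear version -/
def kl {X Y : ModA R} (f : X.M →ₗ[R] Y.M) : X.M →ₗ[K] Y.M where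
  toFun := f
  map_add' := map_add f
  map_smul' k x := by rw [kmod_smul, kmod_smul, map_smul]; rfl

@[simp] lemma kl_apply {X Y : ModA R} (f : X.M →ₗ[R] Y.M) (x : X.M) : kl K f x = f x := rfl

variable [IsArtinianRing K] [Module.Finite K R]

lemma kfin (X : ModA R) : Module.Finite K X.M := Module.Finite.trans R X.M

variable (K) in
lemma kFL (X : ModA R) : IsFiniteLength K X.M := by
  have := kfin (K := K) X
  exact isFiniteLength_iff_isNoetherian_isArtinian.2 ⟨inferInstance, inferInstance⟩

variable (K R) in
/-- dual of the ring -/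
def DR (J : Type u) [AddCommGroup J] [Module K J] : Type u := R →ₗ[K] J

variable {J : Type u} [AddCommGroup J] [Module K J]

instance : AddCommGroup (DR K R J) := inferInstanceAs (AddCommGroup (R →ₗ[K] J))
instance : Module K (DR K R J) := inferInstanceAs (Module K (R →ₗ[K] J))

/-- evaluation -/
def DR.ap (w : DR K R J) : R →ₗ[K] J := w

lemma DR.ext' {w w' : DR K R J} (h : ∀ r, w.ap r = w'.ap r) : w = w' := LinearMap.ext h

instance : SMul R (DR K R J) := ⟨fun s w => (w.ap.comp (LinearMap.mulRight K s) : R →ₗ[K] J)⟩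

lemma DR.smul_ap (s : R) (w : DR K R J) (r : R) : (s • w).ap r = w.ap (r * s) := rfl
lemma DR.add_ap (w w' : DR K R J) (r : R) : (w + w').ap r = w.ap r + w'.ap r := rfl
lemma DR.zero_ap (r : R) : (0 : DR K R J).ap r = 0 := rfl
lemma DR.ksmul_ap (k : K) (w : DR K R J) (r : R) : (k • w).ap r = k • w.ap r := rfl

instance : Module R (DR K R J) where
  one_smul w := DR.ext' fun r => by rw [DR.smul_ap, mul_one]
  mul_smul s t w := DR.ext' fun r => by simp only [DR.smul_ap, mul_assoc]
  smul_zero s := DR.ext' fun r => by simp only [DR.smul_ap, DR.zero_ap]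
  smul_add s w w' := DR.ext' fun r => by simp only [DR.smul_ap, DR.add_ap]
  add_smul s t w := DR.ext' fun r => by simp only [DR.smul_ap, DR.add_ap, mul_add, map_add]
  zero_smul w := DR.ext' fun r => by simp only [DR.smul_ap, DR.zero_ap, mul_zero, map_zero]

instance : IsScalarTower K R (DR K R J) := ⟨fun k s w => DR.ext' fun r => by
  simp only [DR.smul_ap, DR.ksmul_ap, mul_smul_comm, map_smul]⟩

lemma DR_fl (hJ : IsDualizing K J) : IsFiniteLength R (DR K R J) := by
  have h1 : IsFiniteLength K R :=
    isFiniteLength_iff_isNoetherian_isArtinian.2 ⟨inferInstance, inferInstance⟩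
  have h2 := hJ.length_le R h1
  have h3 : Module.length K (DR K R J) ≠ ⊤ := by
    intro h
    have h4 : Module.length K (R →ₗ[K] J) = ⊤ := h
    rw [h4, top_le_iff] at h2
    exact Module.length_ne_top_iff.2 h1 h2
  have h4 := isFiniteLength_iff_isNoetherian_isArtinian.1 (Module.length_ne_top_iff.1 h3)
  obtain ⟨_, _⟩ := h4
  exact isFiniteLength_iff_isNoetherian_isArtinian.2
    ⟨isNoetherian_of_tower K inferInstance, isArtinian_of_tower K inferInstance⟩

/-- `g` is right almost split -/
def RAS {E M : ModA R} (g : E.M →ₗ[R] M.M) : Prop := ¬ SplitEpiMap g ∧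
  ∀ (Z : ModA R) (h : Z.M →ₗ[R] M.M), ¬SplitEpiMap h → ∃ h' : Z.M →ₗ[R] E.M, g.comp h' = h

/-- `f` is left almost split -/
def LAS {M E : ModA R} (f : M.M →ₗ[R] E.M) : Prop := ¬ SplitMonoMap f ∧
  ∀ (Z : ModA R) (h : M.M →ₗ[R] Z.M), ¬SplitMonoMap h → ∃ h' : E.M →ₗ[R] Z.M, h'.comp f = h


end KM

section Presentation
variable {R : Type u} [Ring R]

lemma exists_pres [IsNoetherianRing R] (M : ModA R) : ∃ (a b : ℕ) (m : Fin a → M.M)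
    (ρ : Fin b → Fin a → R),
    (∀ j, ∑ i, ρ j i • m i = 0) ∧
    (∀ (Z : ModA R) (u v : M.M →ₗ[R] Z.M), (∀ i, u (m i) = v (m i)) → u = v) ∧
    (∀ (Z : ModA R) (z : Fin a → Z.M), (∀ j, ∑ i, ρ j i • z i = 0) →
      ∃ u : M.M →ₗ[R] Z.M, ∀ i, u (m i) = z i) := by
  obtain ⟨a, m, hm⟩ := Module.Finite.exists_fin (R := R) (M := M.M)
  set π : (Fin a → R) →ₗ[R] M.M := Fintype.linearCombination R m with hπ
  have hsurj : Surjective π := by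
    rw [← LinearMap.range_eq_top, hπ, Fintype.range_linearCombination, hm]
  obtain ⟨b, ρ, hρ⟩ := Module.Finite.exists_fin (R := R) (M := LinearMap.ker π)
  have hspan : LinearMap.ker π = Submodule.span R (Set.range fun j => (ρ j : Fin a → R)) := by
    have := congrArg (Submodule.map (LinearMap.ker π).subtype) hρ
    rw [Submodule.map_span, Submodule.map_top, Submodule.range_subtype, ← Set.range_comp] at this
    exact this.symm
  refine ⟨a, b, m, fun j => ρ j, fun j => ?_, fun Z u v h => ?_, fun Z z hz => ?_⟩
  · have := (ρ j).2
    rw [LinearMap.mem_ker] at this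
    exact this
  · apply LinearMap.ext_on_range hm h
  · let ζ : (Fin a → R) →ₗ[R] Z.M := Fintype.linearCombination R z
    have hker : LinearMap.ker π ≤ LinearMap.ker ζ := by
      rw [hspan, Submodule.span_le]
      rintro _ ⟨j, rfl⟩
      show ζ (ρ j) = 0
      rw [Fintype.linearCombination_apply]
      exact hz j
    let e := π.quotKerEquivOfSurjective hsurj
    refine ⟨((LinearMap.ker π).liftQ ζ hker).comp e.symm.toLinearMap, fun i => ?_⟩
    have h1 : π (Pi.single i 1) = m i := by
      rw [hπ, Fintype.linearCombination_apply_single, one_smul]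
    have h2 : e.symm (m i) = (LinearMap.ker π).mkQ (Pi.single i 1) := by
      rw [LinearEquiv.symm_apply_eq, ← h1]; rfl
    rw [LinearMap.comp_apply, LinearEquiv.coe_coe, h2]
    show ζ (Pi.single i 1) = z i
    rw [Fintype.linearCombination_apply_single, one_smul]

end Presentation

section RASex

lemma exists_phi (K : Type u) [CommRing K] [IsArtinianRing K] {R : Type u} [Ring R] [Algebra K R]
    {J : Type u} [AddCommGroup J] [Module K J] (hJ : IsDualizing K J)
    (M : ModA R) (hM : M.IsIndec) : ∃ φ : (M.M →ₗ[R] M.M) →ₗ[K] J, φ LinearMap.id ≠ 0 ∧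
      ∀ f : M.M →ₗ[R] M.M, ¬ Bijective f → φ f = 0 := by
  let N : Submodule K (M.M →ₗ[R] M.M) :=
    { carrier := {f | ¬ Bijective f}
      add_mem' := by
        intro f g hf hg h
        exact (indec_add hM h).elim hf hg
      zero_mem' := indec_not_bij_zero hM
      smul_mem' := by
        intro k f hf h
        apply hf
        have e : k • f = f.comp (k • LinearMap.id) := by
          ext x
          show k • f x = f (algebraMap K R k • x)
          rw [map_smul]; rfl
        rw [e] at h
        exact (bij_of_comp hM hM hM h).2 }
  have h1 : N.mkQ LinearMap.id ≠ 0 := by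
    rw [Submodule.mkQ_apply, Ne, Submodule.Quotient.mk_eq_zero]
    intro h
    exact h (bij_id M)
  obtain ⟨f, hf⟩ := hJ.cogen _ _ h1
  refine ⟨f.comp N.mkQ, hf, fun g hg => ?_⟩
  have : N.mkQ g = 0 := by
    rw [Submodule.mkQ_apply, Submodule.Quotient.mk_eq_zero]; exact hg
  rw [LinearMap.comp_apply, this, map_zero]

theorem exists_ras (K : Type u) [CommRing K] [IsArtinianRing K] {R : Type u} [Ring R] [Algebra K R]
    [Module.Finite K R] (M : ModA R) (hM : M.IsIndec) :
    ∃ (E : ModA R) (g : E.M →ₗ[R] M.M), RAS g := by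
  classical
  obtain ⟨J, _, _, hJ⟩ := exists_dualizing K
  have hnoeth : IsNoetherianRing R := isNoetherian_of_tower K inferInstance
  obtain ⟨a, b, m, ρ, hrel, huniq, hlift⟩ := exists_pres M
  obtain ⟨φ, hφ1, hφ0⟩ := exists_phi K hJ M hM
  let ev : (M.M →ₗ[R] M.M) →ₗ[K] (Fin a → M.M) :=
    { toFun := fun f i => f (m i)
      map_add' := fun f g => rfl
      map_smul' := fun k f => rfl }
  have hev : Injective ev := fun f g h => huniq M f g (fun i => congrFun h i)
  obtain ⟨Φ, hΦ⟩ := hJ.extend ev hev φ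
  let y : Fin a → M.M →ₗ[K] J := fun i => Φ.comp (LinearMap.single K (fun _ => M.M) i)
  have hΦy : ∀ z : Fin a → M.M, Φ z = ∑ i, y i (z i) := by
    intro z
    have : z = ∑ i, (LinearMap.single K (fun _ => M.M) i) (z i) := by
      ext l
      simp [Finset.sum_apply, Pi.single_apply]
    conv_lhs => rw [this]
    rw [map_sum]; rfl
  have hφy : ∀ f : M.M →ₗ[R] M.M, φ f = ∑ i, y i (f (m i)) := by
    intro f
    rw [← hΦ, LinearMap.comp_apply, hΦy]; rfl
  let P := M.M × (Fin b → DR K R J)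
  obtain ⟨_, _⟩ := isFiniteLength_iff_isNoetherian_isArtinian.1 (DR_fl (R := R) hJ)
  let Esub : Submodule R (M.M × (Fin b → DR K R J)) :=
    { carrier := {q | ∀ i r, y i (r • q.1) = ∑ j, (q.2 j).ap (ρ j i * r)}
      add_mem' := by
        intro q q' hq hq' i r
        have h1 := hq i r
        have h2 := hq' i r
        simp only [Prod.fst_add, Prod.snd_add, Pi.add_apply, smul_add, map_add, DR.add_ap,
          Finset.sum_add_distrib, h1, h2]
      zero_mem' := by
        intro i r
        simp only [Prod.fst_zero, Prod.snd_zero, Pi.zero_apply, smul_zero, map_zero, DR.zero_ap,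
          Finset.sum_const_zero]
      smul_mem' := by
        intro s q hq i r
        have h1 := hq i (r * s)
        simp only [Prod.smul_fst, Prod.smul_snd, Pi.smul_apply, DR.smul_ap, smul_smul, mul_assoc]
        exact h1 }
  let E : ModA R := ⟨Esub, isFiniteLength_iff_isNoetherian_isArtinian.2
    ⟨inferInstance, inferInstance⟩⟩
  let g : E.M →ₗ[R] M.M := (LinearMap.fst R M.M (Fin b → DR K R J)).comp Esub.subtype
  refine ⟨E, g, ?_, ?_⟩
  · rintro ⟨s, hs⟩
    apply hφ1
    rw [hφy]
    let w : M.M →ₗ[R] (Fin b → DR K R J) :=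
      (LinearMap.snd R M.M (Fin b → DR K R J)).comp (Esub.subtype.comp s)
    have h1 : ∀ i, y i (m i) = ∑ j, (w (m i) j).ap (ρ j i) := by
      intro i
      have := (s (m i)).2 i 1
      rw [one_smul] at this
      have h2 : (Esub.subtype (s (m i))).1 = m i := LinearMap.congr_fun hs (m i)
      have h3 : y i ((Esub.subtype (s (m i))).1) = ∑ j, (w (m i) j).ap (ρ j i * 1) := this
      rw [h2] at h3
      simpa only [mul_one] using h3
    simp only [LinearMap.id_apply, h1]
    rw [Finset.sum_comm]
    apply Finset.sum_eq_zero
    intro j _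
    have h4 := congrArg (fun t => (w t j).ap 1) (hrel j)
    simp only [map_sum, map_smul, Finset.sum_apply, Pi.smul_apply, map_zero, Pi.zero_apply,
      DR.zero_ap] at h4
    have h5 : ∀ (s : Finset (Fin a)) (d : Fin a → DR K R J), (∑ i ∈ s, d i).ap 1 = ∑ i ∈ s, (d i).ap 1 := by
      intro s d
      induction s using Finset.induction_on with
      | empty => rfl
      | insert x s hx ih => rw [Finset.sum_insert hx, Finset.sum_insert hx, DR.add_ap, ih]
    rw [h5] at h4
    simpa only [DR.smul_ap, one_mul] using h4
  · intro Z h hh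
    let Pm : (Fin a → Z.M) →ₗ[K] (Fin b → Z.M) :=
      { toFun := fun z j => ∑ i, ρ j i • z i
        map_add' := by
          intro z z'; funext j
          simp only [Pi.add_apply, smul_add, Finset.sum_add_distrib]
        map_smul' := by
          intro k z; funext j
          simp only [Pi.smul_apply, RingHom.id_apply, Finset.smul_sum]
          exact Finset.sum_congr rfl fun i _ => smul_comm _ _ _ }
    let Ψ : (Fin a → Z.M) →ₗ[K] J := ∑ i, (y i).comp ((kl K h).comp (LinearMap.proj i))
    have hΨ : ∀ z, Ψ z = ∑ i, y i (h (z i)) := by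
      intro z
      simp only [Ψ, LinearMap.sum_apply, LinearMap.comp_apply, LinearMap.proj_apply, kl_apply]
    have hker : LinearMap.ker Pm ≤ LinearMap.ker Ψ := by
      intro z hz
      obtain ⟨u, hu⟩ := hlift Z z (fun j => congrFun (hz : Pm z = 0) j)
      show Ψ z = 0
      rw [hΨ]
      have h1 := hφy (h.comp u)
      simp only [LinearMap.comp_apply, hu] at h1
      rw [← h1]
      apply hφ0
      intro hb
      exact hh (splitEpi_of_bij_comp hb)
    let Pq : ((Fin a → Z.M) ⧸ LinearMap.ker Pm) →ₗ[K] (Fin b → Z.M) :=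
      (LinearMap.ker Pm).liftQ Pm le_rfl
    have hPq : Injective Pq := by
      rw [← LinearMap.ker_eq_bot]
      exact Submodule.ker_liftQ_eq_bot _ _ _ le_rfl
    obtain ⟨W, hW⟩ := hJ.extend Pq hPq ((LinearMap.ker Pm).liftQ Ψ hker)
    have hW' : ∀ z, W (Pm z) = Ψ z := fun z =>
      LinearMap.congr_fun hW ((LinearMap.ker Pm).mkQ z)
    let Wj : Fin b → Z.M →ₗ[K] J := fun j => W.comp (LinearMap.single K (fun _ => Z.M) j)
    have hWj : ∀ z : Fin b → Z.M, W z = ∑ j, Wj j (z j) := by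
      intro z
      have : z = ∑ i, (LinearMap.single K (fun _ => Z.M) i) (z i) := by
        ext l
        simp [Finset.sum_apply, Pi.single_apply]
      conv_lhs => rw [this]
      rw [map_sum]; rfl
    have key : ∀ i z, y i (h z) = ∑ j, Wj j (ρ j i • z) := by
      intro i z
      have h1 := hW' (Pi.single i z)
      rw [hWj, hΨ] at h1
      have h2 : ∀ j, Pm (Pi.single i z) j = ρ j i • z := by
        intro j
        show ∑ l, ρ j l • (Pi.single i z : Fin a → Z.M) l = _
        rw [Finset.sum_eq_single i]
        · simp
        · intro l _ hl; simp [hl]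
        · simp
      simp only [h2] at h1
      rw [h1, Finset.sum_eq_single i]
      · simp
      · intro l _ hl; simp [hl]
      · simp
    let wz : Fin b → Z.M →ₗ[R] DR K R J := fun j =>
      { toFun := fun z => ((Wj j).comp (LinearMap.toSpanSingleton R Z.M z |>.restrictScalars K) : R →ₗ[K] J)
        map_add' := by
          intro z z'
          apply DR.ext'; intro r
          show Wj j (r • (z + z')) = Wj j (r • z) + Wj j (r • z')
          rw [smul_add, map_add]
        map_smul' := by
          intro s z
          apply DR.ext'; intro r
          show Wj j (r • (s • z)) = Wj j ((r * s) • z)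
          rw [mul_smul] }
    have hwz : ∀ j z r, (wz j z).ap r = Wj j (r • z) := fun _ _ _ => rfl
    refine ⟨LinearMap.codRestrict Esub (LinearMap.prod h (LinearMap.pi wz)) ?_, ?_⟩
    · intro z i r
      show y i (r • h z) = ∑ j, (wz j z).ap (ρ j i * r)
      simp only [hwz, mul_smul]
      rw [← map_smul, key]
    · ext z; rfl

end RASex
end CF

namespace CF
open Function
set_option linter.all false

section Dual
variable {K : Type u} [CommRing K] {J : Type u} [AddCommGroup J] [Module K J]
variable {R S : Type u} [Ring R] [Ring S] [Algebra K R] [Algebra K S]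

/-- action of a ring element as `K`-linear map -/
def kact (X : ModA R) (r : R) : X.M →ₗ[K] X.M where
  toFun x := r • x
  map_add' := smul_add _
  map_smul' k x := smul_comm r k x

/-- dual action -/
@[reducible] def dualMod (σ : S →ₐ[K] Rᵐᵒᵖ) (X : ModA R) : Module S (X.M →ₗ[K] J) where
  smul s w := w.comp (kact X (σ s).unop)
  one_smul w := LinearMap.ext fun x => congrArg w (by
    show (σ 1).unop • x = x
    rw [map_one, MulOpposite.unop_one, one_smul])
  mul_smul s t w := LinearMap.ext fun x => congrArg w (by
    show (σ (s * t)).unop • x = (σ t).unop • ((σ s).unop • x)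
    rw [map_mul, MulOpposite.unop_mul, mul_smul])
  smul_zero s := rfl
  smul_add s w w' := rfl
  add_smul s t w := LinearMap.ext fun x => by
    show w ((σ (s + t)).unop • x) = w ((σ s).unop • x) + w ((σ t).unop • x)
    rw [map_add, MulOpposite.unop_add, add_smul, map_add]
  zero_smul w := LinearMap.ext fun x => by
    show w ((σ 0).unop • x) = 0
    rw [map_zero, MulOpposite.unop_zero, zero_smul, map_zero]

variable [IsArtinianRing K] [Module.Finite K R] [Module.Finite K S]

lemma homJ_fl (hJ : IsDualizing K J) (X : ModA R) : IsFiniteLength K (X.M →ₗ[K] J) := by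
  have h2 := hJ.length_le X.M (kFL K X)
  apply Module.length_ne_top_iff.1
  intro h4
  rw [h4, top_le_iff] at h2
  exact Module.length_ne_top_iff.2 (kFL K X) h2

/-- dual module -/
def dual (hJ : IsDualizing K J) (σ : S →ₐ[K] Rᵐᵒᵖ) (X : ModA R) : ModA S :=
  letI := dualMod (J := J) σ X
  { M := X.M →ₗ[K] J
    finLen := by
      obtain ⟨_, _⟩ := isFiniteLength_iff_isNoetherian_isArtinian.1 (homJ_fl hJ X)
      haveI : IsScalarTower K S (X.M →ₗ[K] J) := ⟨fun k s w => LinearMap.ext fun x => by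
        show w ((σ (k • s)).unop • x) = k • w ((σ s).unop • x)
        rw [map_smul σ, MulOpposite.unop_smul, smul_assoc, map_smul w]⟩
      exact isFiniteLength_iff_isNoetherian_isArtinian.2
        ⟨isNoetherian_of_tower K inferInstance, isArtinian_of_tower K inferInstance⟩ }

variable {hJ : IsDualizing K J} {σ : S →ₐ[K] Rᵐᵒᵖ} {σ' : R →ₐ[K] Sᵐᵒᵖ}

/-- evaluation of dual elements -/
def dap {X : ModA R} (w : (dual hJ σ X).M) : X.M →ₗ[K] J := w

/-- elements of the dual -/
def dmk {X : ModA R} (w : X.M →ₗ[K] J) : (dual hJ σ X).M := w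

@[simp] lemma dap_dmk {X : ModA R} (w : X.M →ₗ[K] J) : dap (dmk w : (dual hJ σ X).M) = w := rfl

lemma dext {X : ModA R} {w w' : (dual hJ σ X).M} (h : ∀ x, dap w x = dap w' x) : w = w' :=
  LinearMap.ext (f := dap w) (g := dap w') h

@[simp] lemma dap_add {X : ModA R} (w w' : (dual hJ σ X).M) (x : X.M) :
    dap (w + w') x = dap w x + dap w' x := rfl
@[simp] lemma dap_zero {X : ModA R} (x : X.M) : dap (0 : (dual hJ σ X).M) x = 0 := rfl
@[simp] lemma dap_smul {X : ModA R} (s : S) (w : (dual hJ σ X).M) (x : X.M) :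
    dap (s • w) x = dap w ((σ s).unop • x) := rfl
@[simp] lemma dap_ksmul {X : ModA R} (k : K) (w : (dual hJ σ X).M) (x : X.M) :
    dap (k • w) x = k • dap w x := by
  rw [kmod_smul, dap_smul, AlgHom.commutes, ← map_smul]
  rfl

/-- dual map -/
def dmap (hJ : IsDualizing K J) (σ : S →ₐ[K] Rᵐᵒᵖ) {X Y : ModA R} (f : X.M →ₗ[R] Y.M) :
    (dual hJ σ Y).M →ₗ[S] (dual hJ σ X).M where
  toFun w := dmk ((dap w).comp (kl K f))
  map_add' w w' := rfl
  map_smul' s w := dext fun x => by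
    simp

@[simp] lemma dap_dmap {X Y : ModA R} (f : X.M →ₗ[R] Y.M) (w : (dual hJ σ Y).M) (x : X.M) :
    dap (dmap hJ σ f w) x = dap w (f x) := rfl

/-- biduality map -/
def dev (hJ : IsDualizing K J) (σ : S →ₐ[K] Rᵐᵒᵖ) (σ' : R →ₐ[K] Sᵐᵒᵖ)
    (h : ∀ r, (σ (σ' r).unop).unop = r) (X : ModA R) :
    X.M →ₗ[R] (dual hJ σ' (dual hJ σ X)).M where
  toFun x := dmk
    { toFun := fun w => dap w x
      map_add' := fun w w' => rfl
      map_smul' := fun k w => dap_ksmul k w x }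
  map_add' x x' := dext fun w => by
    show dap w (x + x') = dap w x + dap w x'
    rw [map_add]
  map_smul' r x := dext fun w => by
    show dap w (r • x) = dap ((σ' r).unop • w) x
    rw [dap_smul, h]

lemma dap_dev (h : ∀ r, (σ (σ' r).unop).unop = r) (X : ModA R) (x : X.M) (w : (dual hJ σ X).M) :
    dap (dev hJ σ σ' h X x) w = dap w x := rfl

lemma dev_bij (h : ∀ r, (σ (σ' r).unop).unop = r) (X : ModA R) :
    Bijective (dev hJ σ σ' h X) := by
  have hinj : Injective (dev hJ σ σ' h X) := by
    rw [← LinearMap.ker_eq_bot, eq_bot_iff]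
    intro x hx
    by_contra hne
    obtain ⟨w, hw⟩ := hJ.cogen X.M x hne
    apply hw
    have : dap (dev hJ σ σ' h X x) (dmk w) = 0 := by
      rw [show dev hJ σ σ' h X x = 0 from hx]; rfl
    exact this
  refine ⟨hinj, ?_⟩
  have h1 := hJ.length_le X.M (kFL K X)
  have h2 := hJ.length_le (dual hJ σ X).M (kFL K _)
  let f := kl K (dev hJ σ σ' h X)
  obtain ⟨_, _⟩ := isFiniteLength_iff_isNoetherian_isArtinian.1
    (kFL K (dual hJ σ' (dual hJ σ X)))
  suffices LinearMap.range f = ⊤ from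
    fun y => (LinearMap.range_eq_top (f := f)).1 this y
  by_contra hne
  have h3 := Submodule.length_lt hne
  rw [← (LinearEquiv.ofInjective f hinj).length_eq] at h3
  have e1 : Module.length K (dual hJ σ X).M = Module.length K (X.M →ₗ[K] J) := by
    let e : (dual hJ σ X).M ≃ₗ[K] (X.M →ₗ[K] J) :=
      { toFun := dap, invFun := dmk, left_inv := fun _ => rfl, right_inv := fun _ => rfl
        map_add' := fun _ _ => rfl
        map_smul' := fun k w => LinearMap.ext fun x => dap_ksmul k w x }
    exact e.length_eq
  have e2 : Module.length K (dual hJ σ' (dual hJ σ X)).M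
      = Module.length K ((dual hJ σ X).M →ₗ[K] J) := by
    let e : (dual hJ σ' (dual hJ σ X)).M ≃ₗ[K] ((dual hJ σ X).M →ₗ[K] J) :=
      { toFun := dap, invFun := dmk, left_inv := fun _ => rfl, right_inv := fun _ => rfl
        map_add' := fun _ _ => rfl
        map_smul' := fun k w => LinearMap.ext fun x => dap_ksmul k w x }
    exact e.length_eq
  rw [e2] at h3
  exact absurd (h3.trans_le (h2.trans (e1.le.trans h1))) (lt_irrefl _)

lemma dev_nat (h : ∀ r, (σ (σ' r).unop).unop = r) {X Y : ModA R} (f : X.M →ₗ[R] Y.M) (x : X.M) :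
    dmap hJ σ' (dmap hJ σ f) (dev hJ σ σ' h X x) = dev hJ σ σ' h Y (f x) := rfl

lemma dual_indec (h : ∀ r, (σ (σ' r).unop).unop = r) (X : ModA R) (hX : X.IsIndec) :
    (dual hJ σ X).IsIndec := by
  constructor
  · obtain ⟨x, hx⟩ := (nontrivial_iff_exists_ne (0 : X.M)).1 hX.1
    obtain ⟨w, hw⟩ := hJ.cogen X.M x hx
    refine ⟨⟨dmk w, 0, fun h => hw ?_⟩⟩
    have : dap (dmk w : (dual hJ σ X).M) x = 0 := by rw [h]; rfl
    exact this
  · intro e he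
    obtain ⟨i, hi1, hi2⟩ := exists_inv (dev_bij (hJ := hJ) h X)
    have hi1' : ∀ x, i (dev hJ σ σ' h X x) = x := LinearMap.congr_fun hi1
    have hi2' : ∀ x, dev hJ σ σ' h X (i x) = x := LinearMap.congr_fun hi2
    let f : X.M →ₗ[R] X.M := i.comp ((dmap hJ σ' e).comp (dev hJ σ σ' h X))
    have hf : ∀ x w, dap w (f x) = dap (e w) x := by
      intro x w
      rw [← dap_dev h, ← dap_dev (hJ := hJ) h X x]
      show dap (dev hJ σ σ' h X (i _)) w = _
      rw [hi2']; rfl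
    have hinj : ∀ x x' : X.M, (∀ w : (dual hJ σ X).M, dap w x = dap w x') → x = x' := by
      intro x x' hw
      apply (dev_bij (hJ := hJ) h X).1
      exact dext hw
    have hff : (f : Module.End R X.M) * f = f := by
      ext x
      apply hinj
      intro w
      show dap w (f (f x)) = dap w (f x)
      rw [hf, hf, hf, show e (e w) = e w from LinearMap.congr_fun he w]
    rcases hX.2 f hff with h0 | h1
    · left
      ext w
      apply dext
      intro x
      rw [← hf, h0]
      simp
    · right
      ext w
      apply dext
      intro x
      rw [← hf, h1]
      simp

end Dual

section LASex

theorem exists_las (K : Type u) [CommRing K] [IsArtinianRing K] {R : Type u} [Ring R] [Algebra K R]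
    [Module.Finite K R] (X : ModA R) (hX : X.IsIndec) :
    ∃ (E : ModA R) (f : X.M →ₗ[R] E.M), LAS f := by
  obtain ⟨J, _, _, hJ⟩ := exists_dualizing K
  let σ : Rᵐᵒᵖ →ₐ[K] Rᵐᵒᵖ := AlgHom.id K _
  let σ' : R →ₐ[K] Rᵐᵒᵖᵐᵒᵖ := (AlgEquiv.opOp K R).toAlgHom
  have h : ∀ r, (σ (σ' r).unop).unop = r := fun r => rfl
  have h' : ∀ r, (σ' (σ r).unop).unop = r := fun r => rfl
  haveI : Module.Finite K Rᵐᵒᵖ := Module.Finite.equiv (MulOpposite.opLinearEquiv K)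
  obtain ⟨E, g, hg1, hg2⟩ := exists_ras K (dual hJ σ X) (dual_indec h X hX)
  obtain ⟨iE, hiE1, hiE2⟩ := exists_inv (dev_bij (hJ := hJ) h' E)
  have hiE2' : ∀ x, dev hJ σ' σ h' E (iE x) = x := LinearMap.congr_fun hiE2
  obtain ⟨iX, hiX1, hiX2⟩ := exists_inv (dev_bij (hJ := hJ) h X)
  have hiX1' : ∀ x, iX (dev hJ σ σ' h X x) = x := LinearMap.congr_fun hiX1
  refine ⟨dual hJ σ' E, (dmap hJ σ' g).comp (dev hJ σ σ' h X), ?_, ?_⟩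
  · rintro ⟨r, hr⟩
    have hr' : ∀ x, r (dmap hJ σ' g (dev hJ σ σ' h X x)) = x := LinearMap.congr_fun hr
    apply hg1
    refine ⟨iE.comp (dmap hJ σ r), ?_⟩
    ext w
    apply dext
    intro x
    rw [← dap_dev h]
    show dap (dmap hJ σ' g (dev hJ σ σ' h X x)) (iE (dmap hJ σ r w)) = dap w x
    rw [← dap_dev h', hiE2', dap_dmap, hr']
  · intro Z k hk
    obtain ⟨iZ, hiZ1, hiZ2⟩ := exists_inv (dev_bij (hJ := hJ) h Z)
    have hiZ1' : ∀ x, iZ (dev hJ σ σ' h Z x) = x := LinearMap.congr_fun hiZ1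
    have hns : ¬ SplitEpiMap (dmap hJ σ k) := by
      rintro ⟨s, hs⟩
      apply hk
      refine ⟨iX.comp ((dmap hJ σ' s).comp (dev hJ σ σ' h Z)), ?_⟩
      ext x
      show iX (dmap hJ σ' s (dev hJ σ σ' h Z (k x))) = x
      rw [← hiX1' x]
      congr 1
      apply dext
      intro w
      have h1 := LinearMap.congr_fun hs w
      rw [hiX1', dap_dmap, dap_dev, dap_dev]
      conv_rhs => rw [show w = dmap hJ σ k (s w) from h1.symm]
      rw [dap_dmap]
    obtain ⟨l, hl⟩ := hg2 _ _ hns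
    refine ⟨iZ.comp (dmap hJ σ' l), ?_⟩
    ext x
    show iZ (dmap hJ σ' l (dmap hJ σ' g (dev hJ σ σ' h X x))) = k x
    rw [← hiZ1' (k x)]
    congr 1
    apply dext
    intro w
    have h1 := LinearMap.congr_fun hl w
    rw [dap_dmap, dap_dmap, dap_dev, dap_dev]
    show dap (g (l w)) x = _
    rw [show g (l w) = dmap hJ σ k w from h1, dap_dmap]

end LASex
end CF

namespace CF
open Function
set_option linter.all false

section Gen
variable {R : Type u} [Ring R]

/-- quotient module -/
abbrev quotM (N : ModA R) (P : Submodule R N.M) : ModA R :=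
  ⟨N.M ⧸ P, N.finLen.of_surjective P.mkQ_surjective⟩

/-- product of two modules -/
abbrev prodM (X Y : ModA R) : ModA R :=
  ⟨X.M × Y.M, isFiniteLength_iff_isNoetherian_isArtinian.2 ⟨inferInstance, inferInstance⟩⟩

/-- finite power -/
abbrev powM (N : ModA R) (n : ℕ) : ModA R :=
  ⟨Fin n → N.M, isFiniteLength_iff_isNoetherian_isArtinian.2 ⟨inferInstance, inferInstance⟩⟩

lemma factor_surj {E M Z : ModA R} (g : E.M →ₗ[R] M.M) (hg : Surjective g) (h : E.M →ₗ[R] Z.M)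
    (hk : ∀ x, g x = 0 → h x = 0) : ∃ h' : M.M →ₗ[R] Z.M, h'.comp g = h := by
  let e := g.quotKerEquivOfSurjective hg
  have hker : LinearMap.ker g ≤ LinearMap.ker h := fun x hx => hk x hx
  refine ⟨((LinearMap.ker g).liftQ h hker).comp e.symm.toLinearMap, ?_⟩
  ext x
  have h2 : e.symm (g x) = (LinearMap.ker g).mkQ x := by
    rw [LinearEquiv.symm_apply_eq]; rfl
  rw [LinearMap.comp_apply, LinearMap.comp_apply, LinearEquiv.coe_coe, h2]
  rfl

lemma factor_inj {L E Z : ModA R} (f : L.M →ₗ[R] E.M) (hf : Injective f) (h : Z.M →ₗ[R] E.M)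
    (hk : ∀ x, ∃ y, f y = h x) : ∃ h' : Z.M →ₗ[R] L.M, f.comp h' = h := by
  let e := LinearEquiv.ofInjective f hf
  refine ⟨e.symm.toLinearMap.comp (h.codRestrict (LinearMap.range f) hk), ?_⟩
  ext x
  have : e (e.symm ((h.codRestrict (LinearMap.range f) hk) x)) =
    (h.codRestrict (LinearMap.range f) hk) x := e.apply_symm_apply _
  exact congrArg Subtype.val this

lemma splitEpi_of_splitMono {L E M : ModA R} (f : L.M →ₗ[R] E.M) (g : E.M →ₗ[R] M.M)
    (hg : Surjective g) (hex : LinearMap.range f = LinearMap.ker g) (h : SplitMonoMap f) :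
    SplitEpiMap g := by
  obtain ⟨r, hr⟩ := h
  obtain ⟨s, hs⟩ := factor_surj g hg (LinearMap.id - f.comp r) (by
    intro x hx
    have : x ∈ LinearMap.range f := by rw [hex]; exact hx
    obtain ⟨y, rfl⟩ := this
    have := LinearMap.congr_fun hr y
    simp only [LinearMap.comp_apply, LinearMap.id_apply] at this
    simp [this])
  refine ⟨s, ?_⟩
  ext y
  obtain ⟨x, rfl⟩ := hg y
  have h1 := LinearMap.congr_fun hs x
  simp only [LinearMap.comp_apply, LinearMap.sub_apply, LinearMap.id_apply] at h1 ⊢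
  rw [h1, map_sub]
  have : g (f (r x)) = 0 := by
    have : f (r x) ∈ LinearMap.ker g := hex ▸ ⟨_, rfl⟩
    exact this
  rw [this, sub_zero]

lemma splitMono_of_splitEpi {L E M : ModA R} (f : L.M →ₗ[R] E.M) (g : E.M →ₗ[R] M.M)
    (hf : Injective f) (hex : LinearMap.range f = LinearMap.ker g) (h : SplitEpiMap g) :
    SplitMonoMap f := by
  obtain ⟨s, hs⟩ := h
  obtain ⟨r, hr⟩ := factor_inj f hf (LinearMap.id - s.comp g) (by
    intro x
    have := LinearMap.congr_fun hs (g x)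
    simp only [LinearMap.comp_apply, LinearMap.id_apply] at this
    have : x - s (g x) ∈ LinearMap.range f := by
      rw [hex, LinearMap.mem_ker, map_sub, this, sub_self]
    exact this)
  refine ⟨r, ?_⟩
  ext y
  apply hf
  have h1 := LinearMap.congr_fun hr (f y)
  simp only [LinearMap.comp_apply, LinearMap.sub_apply, LinearMap.id_apply] at h1 ⊢
  rw [h1]
  have : g (f y) = 0 := by
    have : f y ∈ LinearMap.ker g := hex ▸ ⟨_, rfl⟩
    exact this
  rw [this, map_zero, sub_zero]

lemma bij_of_surj_endo {E : ModA R} (φ : E.M →ₗ[R] E.M) (h : Surjective φ) : Bijective φ :=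
  ⟨IsNoetherian.injective_of_surjective_endomorphism φ h, h⟩

lemma bij_of_inj_endo {E : ModA R} (φ : E.M →ₗ[R] E.M) (h : Injective φ) : Bijective φ :=
  bij_of_inj_len φ h le_rfl

lemma retr_pow {X N : ModA R} (hX : X.IsIndec) {n : ℕ} (h : Retr X (powM N n)) : Retr X N := by
  obtain ⟨s, r, h⟩ := h
  let a : Fin n → (X.M →ₗ[R] N.M) := fun j =>
    (LinearMap.proj j : (Fin n → N.M) →ₗ[R] N.M).comp s
  let b : Fin n → (N.M →ₗ[R] X.M) := fun j =>
    r.comp (LinearMap.single R (fun _ : Fin n => N.M) j)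
  have e : r.comp s = ∑ j, (b j).comp (a j) := by
    ext x
    rw [LinearMap.sum_apply]
    have h1 : s x = ∑ j, LinearMap.single R (fun _ : Fin n => N.M) j (a j x) :=
      (Finset.univ_sum_single (s x)).symm
    show r (s x) = ∑ j, r (LinearMap.single R (fun _ : Fin n => N.M) j (a j x))
    exact (congrArg r h1).trans (map_sum r _ _)
  rw [e] at h
  obtain ⟨j, -, hj⟩ := indec_sum hX _ _ h
  exact ⟨_, _, hj⟩

lemma retr_finite (N : ModA R) : {p : ARVertex R | ∃ X, ARVertex.mk X = p ∧ Retr X.1 N}.Finite := by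
  obtain ⟨d⟩ := exists_dec N
  refine (Set.finite_range fun j => ARVertex.mk (⟨d.S j, d.indec j⟩ : IndecModA R)).subset ?_
  rintro p ⟨X, rfl, hX⟩
  obtain ⟨j, hj⟩ := retr_exists_iso X.2 d hX
  refine ⟨j, Eq.symm ?_⟩
  exact Quotient.sound hj

lemma inj_of_retract {P Q : Type u} [AddCommGroup P] [Module R P] [AddCommGroup Q] [Module R Q]
    (hQ : Module.Injective R Q) (s : P →ₗ[R] Q) (r : Q →ₗ[R] P) (h : ∀ x, r (s x) = x) :
    Module.Injective R P := by
  constructor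
  intro X Y _ _ _ _ f hf g
  obtain ⟨k, hk⟩ := hQ.out f hf (s.comp g)
  exact ⟨r.comp k, fun x => by rw [LinearMap.comp_apply, hk, LinearMap.comp_apply, h]⟩

lemma inj_iso {X Y : ModA R} (h : X.Iso Y) (hX : Module.Injective R X.M) :
    Module.Injective R Y.M := by
  obtain ⟨e⟩ := h
  exact inj_of_retract hX e.symm.toLinearMap e.toLinearMap (fun x => e.apply_symm_apply x)

lemma proj_iso {X Y : ModA R} (h : X.Iso Y) (hX : Module.Projective R X.M) :
    Module.Projective R Y.M := by
  obtain ⟨e⟩ := h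
  exact Module.Projective.of_equiv e

end Gen

section Inj
variable {K : Type u} [CommRing K] [IsArtinianRing K] {R : Type u} [Ring R] [Algebra K R]
    [Module.Finite K R] {J : Type u} [AddCommGroup J] [Module K J]

lemma DR_inj (hJ : IsDualizing K J) : Module.Injective R (DR K R J) := by
  constructor
  intro X Y _ _ _ _ f hf g
  letI iX : Module K X := Module.compHom X (algebraMap K R)
  letI iY : Module K Y := Module.compHom Y (algebraMap K R)
  have sX : ∀ (k : K) (x : X), k • x = algebraMap K R k • x := fun _ _ => rfl
  have sY : ∀ (k : K) (x : Y), k • x = algebraMap K R k • x := fun _ _ => rfl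
  let f' : X →ₗ[K] Y :=
    { toFun := f, map_add' := map_add f, map_smul' := fun k x => by
        rw [sX, sY, map_smul]; rfl }
  let g' : X →ₗ[K] J :=
    { toFun := fun x => (g x).ap 1
      map_add' := fun x y => by rw [map_add]; rfl
      map_smul' := fun k x => by
        rw [sX, map_smul, DR.smul_ap, one_mul, Algebra.algebraMap_eq_smul_one, map_smul]; rfl }
  obtain ⟨h, hh⟩ := hJ.extend f' hf g'
  let w : Y → DR K R J := fun y =>
    ({ toFun := fun r => h (r • y)
       map_add' := fun r s => by rw [add_smul, map_add]
       map_smul' := fun k r => by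
        rw [Algebra.smul_def, mul_smul, ← sY, map_smul]; rfl } : R →ₗ[K] J)
  have hw : ∀ y r, (w y).ap r = h (r • y) := fun _ _ => rfl
  refine ⟨{ toFun := w
            map_add' := fun y y' => DR.ext' fun r => by
              rw [DR.add_ap, hw, hw, hw, smul_add, map_add]
            map_smul' := fun s y => DR.ext' fun r => by
              rw [hw]
              show _ = (s • w y).ap r
              rw [DR.smul_ap, hw, mul_smul] }, fun x => DR.ext' fun r => ?_⟩
  show h (r • f x) = _
  rw [← map_smul]
  have := LinearMap.congr_fun hh (r • x)
  refine Eq.trans this ?_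
  show (g (r • x)).ap 1 = _
  rw [map_smul, DR.smul_ap, one_mul]

/-- dual of the ring as object -/
abbrev DRM (hJ : IsDualizing K J) : ModA R := ⟨DR K R J, DR_fl hJ⟩

lemma pow_inj (hJ : IsDualizing K J) (n : ℕ) :
    Module.Injective R (powM (DRM (R := R) hJ) n).M := by
  constructor
  intro X Y _ _ _ _ f hf g
  have h1 : ∀ i : Fin n, ∃ h : Y →ₗ[R] (DRM (R := R) hJ).M, ∀ x, h (f x) = g x i := fun i =>
    (DR_inj (R := R) hJ).out f hf
      ((LinearMap.proj i : (Fin n → (DRM (R := R) hJ).M) →ₗ[R] _).comp g)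
  choose h hh using h1
  exact ⟨LinearMap.pi h, fun x => funext fun i => hh i x⟩

lemma exists_embed (hJ : IsDualizing K J) (X : ModA R) :
    ∃ n, ∃ f : X.M →ₗ[R] (powM (DRM (R := R) hJ) n).M, Injective f := by
  obtain ⟨_, _⟩ := isFiniteLength_iff_isNoetherian_isArtinian.1 (homJ_fl hJ X)
  obtain ⟨n, w, hw⟩ := Module.Finite.exists_fin (R := K) (M := X.M →ₗ[K] J)
  let e : Fin n → (X.M →ₗ[R] (DRM (R := R) hJ).M) := fun i =>
    { toFun := fun x =>
        ({ toFun := fun r => w i (r • x)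
           map_add' := fun r s => by rw [add_smul, map_add]
           map_smul' := fun k r => by rw [smul_assoc, map_smul]; rfl } : R →ₗ[K] J)
      map_add' := fun x y => DR.ext' fun r => by
        show w i (r • (x + y)) = w i (r • x) + w i (r • y)
        rw [smul_add, map_add]
      map_smul' := fun s x => DR.ext' fun r => by
        show w i (r • s • x) = w i ((r * s) • x)
        rw [mul_smul] }
  refine ⟨n, LinearMap.pi e, ?_⟩
  suffices h : ∀ x, LinearMap.pi e x = 0 → x = 0 from
    (injective_iff_map_eq_zero (LinearMap.pi e)).2 h
  intro x hx
  by_contra hne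
  obtain ⟨v, hv⟩ := hJ.cogen X.M x hne
  apply hv
  have h0 : ∀ i, w i x = 0 := by
    intro i
    have h1 : e i x = 0 := congrFun hx i
    have h2 : w i ((1 : R) • x) = 0 := by
      show DR.ap (e i x) 1 = 0
      rw [h1]; rfl
    rwa [one_smul] at h2
  have hv' : v ∈ Submodule.span K (Set.range w) := by rw [hw]; trivial
  induction hv' using Submodule.span_induction with
  | mem _ h => obtain ⟨i, rfl⟩ := h; exact h0 i
  | zero => rfl
  | add a b _ _ ha hb =>
    by_cases h : a x = 0
    · by_cases h' : b x = 0
      · rw [LinearMap.add_apply, h, h', add_zero]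
      · exact absurd (hb h') h'
    · exact absurd (ha h) h
  | smul k a _ ha =>
    by_cases h : a x = 0
    · rw [LinearMap.smul_apply, h, smul_zero]
    · exact absurd (ha h) h

end Inj

section PI
lemma inj_vertices (K : Type u) [CommRing K] [IsArtinianRing K] {R : Type u} [Ring R] [Algebra K R]
    [Module.Finite K R] : ∃ N : ModA R, ∀ X : ModA R, X.IsIndec → Module.Injective R X.M → Retr X N := by
  obtain ⟨J, _, _, hJ⟩ := exists_dualizing K
  refine ⟨DRM (R := R) hJ, fun X hX hi => ?_⟩
  obtain ⟨n, f, hf⟩ := exists_embed hJ X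
  obtain ⟨r, hr⟩ := hi.out f hf LinearMap.id
  apply retr_pow hX (n := n)
  refine ⟨f, r, ?_⟩
  have : r.comp f = LinearMap.id := LinearMap.ext hr
  rw [this]; exact bij_id _

lemma las_inj (K : Type u) [CommRing K] [IsArtinianRing K] {R : Type u} [Ring R] [Algebra K R]
    [Module.Finite K R] {X E : ModA R} (hni : ¬ Module.Injective R X.M) (f : X.M →ₗ[R] E.M) (hf : LAS f) :
    Injective f := by
  obtain ⟨J, _, _, hJ⟩ := exists_dualizing K
  obtain ⟨n, e, he⟩ := exists_embed hJ X
  have : ¬ SplitMonoMap e := by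
    rintro ⟨r, hr⟩
    exact hni (inj_of_retract (pow_inj hJ n) e r (LinearMap.congr_fun hr))
  obtain ⟨h, hh⟩ := hf.2 _ e this
  intro x y hxy
  apply he
  rw [← hh, LinearMap.comp_apply, LinearMap.comp_apply, hxy]

lemma ring_fl (K : Type u) [CommRing K] [IsArtinianRing K] {R : Type u} [Ring R] [Algebra K R]
    [Module.Finite K R] : IsFiniteLength R R := by
  have h1 : IsNoetherian K R := inferInstance
  have h2 : IsArtinian K R := inferInstance
  exact isFiniteLength_iff_isNoetherian_isArtinian.2
    ⟨isNoetherian_of_tower K h1, isArtinian_of_tower K h2⟩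

lemma proj_vertices (K : Type u) [CommRing K] [IsArtinianRing K] {R : Type u} [Ring R] [Algebra K R]
    [Module.Finite K R] : ∃ N : ModA R, ∀ X : ModA R, X.IsIndec → Module.Projective R X.M → Retr X N := by
  refine ⟨⟨R, ring_fl K⟩, fun X hX hp => ?_⟩
  obtain ⟨a, m, hm⟩ := Module.Finite.exists_fin (R := R) (M := X.M)
  let π : (powM ⟨R, ring_fl (R := R) K⟩ a).M →ₗ[R] X.M := Fintype.linearCombination R m
  have hsurj : Surjective π := by
    have : LinearMap.range π = ⊤ := by
      show LinearMap.range (Fintype.linearCombination R m) = ⊤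
      rw [Fintype.range_linearCombination, hm]
    exact LinearMap.range_eq_top.1 this
  obtain ⟨s, hs⟩ := Module.projective_lifting_property π LinearMap.id hsurj
  apply retr_pow hX (n := a)
  refine ⟨s, π, ?_⟩
  rw [hs]; exact bij_id _

lemma ras_surj (K : Type u) [CommRing K] [IsArtinianRing K] {R : Type u} [Ring R] [Algebra K R]
    [Module.Finite K R] {M E : ModA R} (hnp : ¬ Module.Projective R M.M) (g : E.M →ₗ[R] M.M) (hg : RAS g) :
    Surjective g := by
  obtain ⟨a, m, hm⟩ := Module.Finite.exists_fin (R := R) (M := M.M)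
  let π : (powM ⟨R, ring_fl (R := R) K⟩ a).M →ₗ[R] M.M := Fintype.linearCombination R m
  have hsurj : Surjective π := by
    have : LinearMap.range π = ⊤ := by
      show LinearMap.range (Fintype.linearCombination R m) = ⊤
      rw [Fintype.range_linearCombination, hm]
    exact LinearMap.range_eq_top.1 this
  have : ¬ SplitEpiMap π := by
    rintro ⟨s, hs⟩
    exact hnp (Module.Projective.of_split (P := M.M) (M := Fin a → R) s π hs)
  obtain ⟨h, hh⟩ := hg.2 _ π this
  intro x
  obtain ⟨y, rfl⟩ := hsurj x
  exact ⟨h y, LinearMap.congr_fun hh y⟩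

end PI

section Min
variable {R : Type u} [Ring R]

/-- right minimal -/
def RMin {E M : ModA R} (g : E.M →ₗ[R] M.M) : Prop :=
  ∀ φ : E.M →ₗ[R] E.M, g.comp φ = g → Bijective φ

/-- left minimal -/
def LMin {L E : ModA R} (f : L.M →ₗ[R] E.M) : Prop :=
  ∀ φ : E.M →ₗ[R] E.M, φ.comp f = f → Bijective φ

lemma surj_of_range_len {E : ModA R} (φ : E.M →ₗ[R] E.M)
    (h : mlen E ≤ mlen (subM E (LinearMap.range φ))) : Surjective φ := by
  have := bij_of_inj_len (X := subM E (LinearMap.range φ)) (Y := E) (LinearMap.range φ).subtype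
    (Submodule.injective_subtype _) h
  intro y
  obtain ⟨⟨x, z, rfl⟩, rfl⟩ := this.2 y
  exact ⟨z, rfl⟩

lemma exists_ras_min {M : ModA R} (h : ∃ (E : ModA R) (g : E.M →ₗ[R] M.M), RAS g) :
    ∃ (E : ModA R) (g : E.M →ₗ[R] M.M), RAS g ∧ RMin g := by
  classical
  have hex : ∃ n, ∃ (E : ModA R) (g : E.M →ₗ[R] M.M), RAS g ∧ mlen E = n := by
    obtain ⟨E, g, hg⟩ := h
    exact ⟨_, E, g, hg, rfl⟩
  obtain ⟨E, g, hg, hE⟩ := Nat.find_spec hex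
  refine ⟨E, g, hg, fun φ hφ => bij_of_surj_endo φ (surj_of_range_len φ ?_)⟩
  rw [hE]
  apply Nat.find_min' hex
  refine ⟨subM E (LinearMap.range φ), g.comp (LinearMap.range φ).subtype, ⟨?_, ?_⟩, rfl⟩
  · rintro ⟨s, hs⟩
    exact hg.1 ⟨(LinearMap.range φ).subtype.comp s, hs⟩
  · intro Z h hh
    obtain ⟨h', hh'⟩ := hg.2 Z h hh
    refine ⟨φ.rangeRestrict.comp h', ?_⟩
    rw [← hh']
    conv_rhs => rw [← hφ]
    rfl

lemma exists_las_min {M : ModA R} (h : ∃ (E : ModA R) (g : M.M →ₗ[R] E.M), LAS g) :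
    ∃ (E : ModA R) (g : M.M →ₗ[R] E.M), LAS g ∧ LMin g := by
  classical
  have hex : ∃ n, ∃ (E : ModA R) (g : M.M →ₗ[R] E.M), LAS g ∧ mlen E = n := by
    obtain ⟨E, g, hg⟩ := h
    exact ⟨_, E, g, hg, rfl⟩
  obtain ⟨E, g, hg, hE⟩ := Nat.find_spec hex
  refine ⟨E, g, hg, fun φ hφ => bij_of_surj_endo φ (surj_of_range_len φ ?_)⟩
  rw [hE]
  apply Nat.find_min' hex
  refine ⟨subM E (LinearMap.range φ), φ.rangeRestrict.comp g, ⟨?_, ?_⟩, rfl⟩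
  · rintro ⟨s, hs⟩
    exact hg.1 ⟨s.comp φ.rangeRestrict, hs⟩
  · intro Z h hh
    obtain ⟨h', hh'⟩ := hg.2 Z h hh
    refine ⟨h'.comp (LinearMap.range φ).subtype, ?_⟩
    rw [← hh']
    conv_rhs => rw [← hφ]
    rfl

end Min
end CF

namespace CF
open Function
set_option linter.all false

section Seq
variable {R : Type u} [Ring R]

lemma ker_las {L E M : ModA R} (f : L.M →ₗ[R] E.M) (g : E.M →ₗ[R] M.M) (hf : Injective f)
    (hsurj : Surjective g) (hex : LinearMap.range f = LinearMap.ker g)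
    (hg : RAS g) (hmin : RMin g) (Z : ModA R) (h : L.M →ₗ[R] Z.M)
    (hh : ¬ SplitMonoMap h) : ∃ h' : E.M →ₗ[R] Z.M, h'.comp f = h := by
  have hgf : ∀ y, g (f y) = 0 := fun y => by
    have : f y ∈ LinearMap.ker g := hex ▸ ⟨_, rfl⟩
    exact this
  let D : Submodule R (prodM E Z).M := LinearMap.range (f.prod (-h))
  let P := quotM (prodM E Z) D
  let q : (prodM E Z).M →ₗ[R] P.M := D.mkQ
  let j : E.M →ₗ[R] P.M := q.comp (LinearMap.inl R E.M Z.M)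
  let i : Z.M →ₗ[R] P.M := q.comp (LinearMap.inr R E.M Z.M)
  have hq : ∀ a b, q (a, b) = j a + i b := by
    intro a b
    show q (a, b) = q (a, 0) + q (0, b)
    rw [← map_add]; simp
  have hji : ∀ l, j (f l) = i (h l) := by
    intro l
    rw [← sub_eq_zero]
    show q (f l, 0) - q (0, h l) = 0
    rw [← map_sub]
    have : (f l, (0 : Z.M)) - (0, h l) = (f.prod (-h)) l := by simp
    rw [this]
    exact (Submodule.Quotient.mk_eq_zero D).2 ⟨l, rfl⟩
  have hqs : Surjective q := D.mkQ_surjective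
  obtain ⟨gP, hgP⟩ : ∃ gP : P.M →ₗ[R] M.M, gP.comp q = g.comp (LinearMap.fst R E.M Z.M) := by
    refine factor_surj (E := prodM E Z) q hqs (g.comp (LinearMap.fst R E.M Z.M)) ?_
    intro x hx
    have : x ∈ D := (Submodule.Quotient.mk_eq_zero D).1 hx
    obtain ⟨l, rfl⟩ := this
    exact hgf l
  have hgj : ∀ a, gP (j a) = g a := fun a => LinearMap.congr_fun hgP (a, 0)
  have hgi : ∀ b, gP (i b) = 0 := fun b => (LinearMap.congr_fun hgP (0, b)).trans (map_zero g)
  have hgPs : Surjective gP := fun y => by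
    obtain ⟨x, rfl⟩ := hsurj y
    exact ⟨j x, hgj x⟩
  have hii : Injective i := by
    rw [injective_iff_map_eq_zero]
    intro b hb
    have : ((0 : E.M), b) ∈ D := (Submodule.Quotient.mk_eq_zero D).1 hb
    obtain ⟨l, hl⟩ := this
    have h1 : f l = 0 := congrArg Prod.fst hl
    have h2 : -h l = b := congrArg Prod.snd hl
    rw [← h2, (injective_iff_map_eq_zero f).1 hf l h1, map_zero, neg_zero]
  have hexP : LinearMap.range i = LinearMap.ker gP := by
    ext p
    constructor
    · rintro ⟨b, rfl⟩
      exact hgi b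
    · intro hp
      obtain ⟨⟨a, b⟩, rfl⟩ := hqs p
      have h1 : g a = 0 := by
        have h2 : gP (q (a, b)) = 0 := hp
        rw [hq, map_add, hgj, hgi, add_zero] at h2
        exact h2
      have h3 : a ∈ LinearMap.range f := hex ▸ h1
      obtain ⟨l, rfl⟩ := h3
      refine ⟨h l + b, ?_⟩
      rw [hq, hji, map_add]
  by_cases hsp : SplitEpiMap gP
  · obtain ⟨r, hr⟩ := splitMono_of_splitEpi i gP hii hexP hsp
    refine ⟨r.comp j, ?_⟩
    ext l
    show r (j (f l)) = h l
    rw [hji]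
    exact LinearMap.congr_fun hr (h l)
  · exfalso
    obtain ⟨u, hu⟩ := hg.2 P gP hsp
    have hu' : ∀ x, g (u x) = gP x := LinearMap.congr_fun hu
    have hb : Bijective (u.comp j) := hmin _ (by
      ext a
      show g (u (j a)) = g a
      rw [hu', hgj])
    obtain ⟨v, hv⟩ := factor_inj f hf (u.comp i) (by
      intro b
      have : u (i b) ∈ LinearMap.range f := by
        rw [hex]; show g (u (i b)) = 0
        rw [hu', hgi]
      exact this)
    have hv' : ∀ b, f (v b) = u (i b) := LinearMap.congr_fun hv
    have hvh : Injective (v.comp h) := by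
      intro x y hxy
      apply hf
      apply hb.1
      show u (j (f x)) = u (j (f y))
      rw [hji, hji, ← hv', ← hv']
      exact congrArg f hxy
    exact hh (splitMono_of_bij_comp (bij_of_inj_endo _ hvh))

lemma ker_indec {L E M : ModA R} (f : L.M →ₗ[R] E.M) (hf : Injective f)
    (hns : ¬ SplitMonoMap f) (hl : ∀ (Z : ModA R) (h : L.M →ₗ[R] Z.M), ¬SplitMonoMap h →
      ∃ h' : E.M →ₗ[R] Z.M, h'.comp f = h) : L.IsIndec := by
  constructor
  · by_contra hn
    have hsub : Subsingleton L.M := not_nontrivial_iff_subsingleton.1 hn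
    exact hns ⟨0, LinearMap.ext fun x => Subsingleton.elim _ _⟩
  · intro e he
    have he' : ∀ x, e (e x) = e x := LinearMap.congr_fun he
    by_contra hcon
    push Not at hcon
    have h1 : ¬ SplitMonoMap (X := L) (Y := L) e := by
      rintro ⟨r, hr⟩
      apply hcon.2
      ext x
      have := LinearMap.congr_fun hr
      simp only [LinearMap.comp_apply, LinearMap.id_apply] at this
      rw [← this (e x), he', this]; rfl
    have h2 : ¬ SplitMonoMap (X := L) (Y := L) (LinearMap.id - e) := by
      rintro ⟨r, hr⟩
      apply hcon.1
      ext x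
      have := LinearMap.congr_fun hr (e x)
      simp only [LinearMap.comp_apply, LinearMap.id_apply, LinearMap.sub_apply, he', sub_self,
        map_zero] at this
      exact this.symm
    obtain ⟨a, ha⟩ := hl _ _ h1
    obtain ⟨b, hb⟩ := hl _ _ h2
    apply hns
    refine ⟨a + b, ?_⟩
    rw [LinearMap.add_comp, ha, hb]
    simp

lemma coker_ras {L E M : ModA R} (f : L.M →ₗ[R] E.M) (g : E.M →ₗ[R] M.M) (hf : Injective f)
    (hsurj : Surjective g) (hex : LinearMap.range f = LinearMap.ker g)
    (hl : LAS f) (hmin : LMin f) (Z : ModA R) (h : Z.M →ₗ[R] M.M)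
    (hh : ¬ SplitEpiMap h) : ∃ h' : Z.M →ₗ[R] E.M, g.comp h' = h := by
  have hgf : ∀ y, g (f y) = 0 := fun y => by
    have : f y ∈ LinearMap.ker g := hex ▸ ⟨_, rfl⟩
    exact this
  let D : Submodule R (prodM E Z).M :=
    LinearMap.ker (g.comp (LinearMap.fst R E.M Z.M) - h.comp (LinearMap.snd R E.M Z.M))
  let P := subM (prodM E Z) D
  let j : P.M →ₗ[R] E.M := (LinearMap.fst R E.M Z.M).comp D.subtype
  let q : P.M →ₗ[R] Z.M := (LinearMap.snd R E.M Z.M).comp D.subtype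
  have hD : ∀ p : P.M, g (j p) = h (q p) := by
    intro p
    have := p.2
    rw [LinearMap.mem_ker, LinearMap.sub_apply, sub_eq_zero] at this
    exact this
  have hmk : ∀ a b, g a = h b → ∃ p : P.M, j p = a ∧ q p = b := by
    intro a b hab
    refine ⟨⟨(a, b), ?_⟩, rfl, rfl⟩
    rw [LinearMap.mem_ker, LinearMap.sub_apply, sub_eq_zero]
    exact hab
  have hext : ∀ p p' : P.M, j p = j p' → q p = q p' → p = p' := fun p p' h1 h2 =>
    Subtype.ext (Prod.ext h1 h2)
  let fP : L.M →ₗ[R] P.M := (LinearMap.inl R E.M Z.M ∘ₗ f).codRestrict D (by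
    intro x
    rw [LinearMap.mem_ker, LinearMap.sub_apply, sub_eq_zero]
    show g (f x) = h 0
    rw [hgf, map_zero])
  have hjf : ∀ x, j (fP x) = f x := fun x => rfl
  have hqf : ∀ x, q (fP x) = 0 := fun x => rfl
  have hqs : Surjective q := fun b => by
    obtain ⟨a, ha⟩ := hsurj (h b)
    obtain ⟨p, -, hp⟩ := hmk a b ha
    exact ⟨p, hp⟩
  have hexP : LinearMap.range fP = LinearMap.ker q := by
    ext p
    constructor
    · rintro ⟨b, rfl⟩
      exact hqf b
    · intro hp
      have hp' : q p = 0 := hp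
      have h1 : j p ∈ LinearMap.range f := by
        rw [hex]; show g (j p) = 0
        rw [hD, hp', map_zero]
      obtain ⟨l, hl⟩ := h1
      exact ⟨l, hext _ _ ((hjf l).trans hl) ((hqf l).trans hp'.symm)⟩
  by_cases hsp : SplitMonoMap fP
  · obtain ⟨s, hs⟩ := splitEpi_of_splitMono fP q hqs hexP hsp
    refine ⟨j.comp s, ?_⟩
    ext b
    show g (j (s b)) = h b
    rw [hD]
    exact congrArg h (LinearMap.congr_fun hs b)
  · exfalso
    obtain ⟨u, hu⟩ := hl.2 P fP hsp
    have hu' : ∀ x, u (f x) = fP x := LinearMap.congr_fun hu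
    have hb : Bijective (j.comp u) := hmin _ (by
      ext a
      show j (u (f a)) = f a
      rw [hu', hjf])
    obtain ⟨v, hv⟩ := factor_surj g hsurj (q.comp u) (by
      intro x hx
      have : x ∈ LinearMap.range f := hex ▸ hx
      obtain ⟨l, rfl⟩ := this
      show q (u (f l)) = 0
      rw [hu', hqf])
    have hv' : ∀ b, v (g b) = q (u b) := LinearMap.congr_fun hv
    have hvh : Surjective (h.comp v) := by
      intro y
      obtain ⟨e, rfl⟩ := hsurj y
      obtain ⟨e', he⟩ := hb.2 e
      refine ⟨g e', ?_⟩
      show h (v (g e')) = g e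
      rw [hv', ← hD]
      exact congrArg g he
    exact hh (splitEpi_of_bij_comp (bij_of_surj_endo _ hvh))

lemma coker_indec {E M : ModA R} (g : E.M →ₗ[R] M.M)
    (hns : ¬ SplitEpiMap g) (hl : ∀ (Z : ModA R) (h : Z.M →ₗ[R] M.M), ¬SplitEpiMap h →
      ∃ h' : Z.M →ₗ[R] E.M, g.comp h' = h) : M.IsIndec := by
  constructor
  · by_contra hn
    have hsub : Subsingleton M.M := not_nontrivial_iff_subsingleton.1 hn
    exact hns ⟨0, LinearMap.ext fun x => Subsingleton.elim _ _⟩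
  · intro e he
    have he' : ∀ x, e (e x) = e x := LinearMap.congr_fun he
    by_contra hcon
    push Not at hcon
    have h1 : ¬ SplitEpiMap (X := M) (Y := M) e := by
      rintro ⟨r, hr⟩
      apply hcon.2
      ext x
      have := LinearMap.congr_fun hr
      simp only [LinearMap.comp_apply, LinearMap.id_apply] at this
      rw [← this x, he']; rfl
    have h2 : ¬ SplitEpiMap (X := M) (Y := M) (LinearMap.id - e) := by
      rintro ⟨r, hr⟩
      apply hcon.1
      ext x
      have := congrArg e (LinearMap.congr_fun hr x)
      simp only [LinearMap.comp_apply, LinearMap.id_apply, LinearMap.sub_apply, map_sub, he',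
        sub_self] at this
      exact this.symm
    obtain ⟨a, ha⟩ := hl _ _ h1
    obtain ⟨b, hb⟩ := hl _ _ h2
    apply hns
    refine ⟨a + b, ?_⟩
    rw [LinearMap.comp_add, ha, hb]
    simp

end Seq

theorem exists_seq_right (K : Type u) [CommRing K] [IsArtinianRing K] {R : Type u} [Ring R]
    [Algebra K R] [Module.Finite K R] (M : ModA R) (hM : M.IsIndec)
    (hnp : ¬ Module.Projective R M.M) : ∃ s : AlmostSplitSeq R, s.r = M := by
  obtain ⟨E, g, hg, hmin⟩ := exists_ras_min (exists_ras K M hM)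
  have hs := ras_surj K hnp g hg
  let L := subM E (LinearMap.ker g)
  let f : L.M →ₗ[R] E.M := (LinearMap.ker g).subtype
  have hf : Injective f := Submodule.injective_subtype _
  have hex : LinearMap.range f = LinearMap.ker g := Submodule.range_subtype _
  have hl := ker_las f g hf hs hex hg hmin
  have hns : ¬ SplitMonoMap f := fun h => hg.1 (splitEpi_of_splitMono f g hs hex h)
  exact ⟨⟨L, E, M, f, g, hf, hs, hex, hg.1, ker_indec (M := M) f hf hns hl, hM, hg.2, hl⟩, rfl⟩

theorem exists_seq_left (K : Type u) [CommRing K] [IsArtinianRing K] {R : Type u} [Ring R]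
    [Algebra K R] [Module.Finite K R] (L : ModA R) (hL : L.IsIndec)
    (hni : ¬ Module.Injective R L.M) : ∃ s : AlmostSplitSeq R, s.l = L := by
  obtain ⟨E, f, hf, hmin⟩ := exists_las_min (exists_las K L hL)
  have hfi := las_inj K hni f hf
  let M := quotM E (LinearMap.range f)
  let g : E.M →ₗ[R] M.M := (LinearMap.range f).mkQ
  have hs : Surjective g := Submodule.mkQ_surjective _
  have hex : LinearMap.range f = LinearMap.ker g := (Submodule.ker_mkQ _).symm
  have hl := coker_ras f g hfi hs hex hf hmin
  have hns : ¬ SplitEpiMap g := fun h => hf.1 (splitMono_of_splitEpi f g hfi hex h)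
  exact ⟨⟨L, E, M, f, g, hfi, hs, hex, hns, hL, coker_indec g hns hl, hl, hf.2⟩, rfl⟩

section Props
variable {R : Type u} [Ring R]

lemma seq_gf (s : AlmostSplitSeq R) (x : s.l.M) : s.g (s.f x) = 0 := by
  have : s.f x ∈ LinearMap.ker s.g := s.exact ▸ ⟨_, rfl⟩
  exact this

lemma seq_ker (s : AlmostSplitSeq R) {x : s.m.M} (h : s.g x = 0) : ∃ y, s.f y = x := by
  have : x ∈ LinearMap.range s.f := s.exact ▸ h
  exact this

lemma seq_ras (s : AlmostSplitSeq R) : RAS s.g := ⟨s.not_split, s.right_almost⟩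

lemma seq_las (s : AlmostSplitSeq R) : LAS s.f :=
  ⟨fun h => s.not_split (splitEpi_of_splitMono s.f s.g s.surj s.exact h), s.left_almost⟩

lemma seq_five (s : AlmostSplitSeq R) (φ : s.m.M →ₗ[R] s.m.M) (ψ : s.l.M →ₗ[R] s.l.M)
    (θ : s.r.M →ₗ[R] s.r.M) (h1 : ∀ x, φ (s.f x) = s.f (ψ x)) (h2 : ∀ x, s.g (φ x) = θ (s.g x))
    (hψ : Injective ψ) (hθ : Injective θ) : Bijective φ := by
  apply bij_of_inj_endo
  rw [injective_iff_map_eq_zero] at hψ hθ ⊢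
  intro x hx
  have h3 : s.g x = 0 := hθ _ (by rw [← h2, hx, map_zero])
  obtain ⟨y, rfl⟩ := seq_ker s h3
  rw [h1] at hx
  rw [hψ y ((injective_iff_map_eq_zero _).1 s.inj _ hx), map_zero]

lemma seq_rmin (s : AlmostSplitSeq R) : RMin s.g := by
  intro φ hφ
  have hφ' : ∀ x, s.g (φ x) = s.g x := LinearMap.congr_fun hφ
  obtain ⟨ψ, hψ⟩ := factor_inj s.f s.inj (φ.comp s.f) (fun x => seq_ker s (by
    show s.g (φ (s.f x)) = 0
    rw [hφ', seq_gf]))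
  have hψ' : ∀ x, s.f (ψ x) = φ (s.f x) := LinearMap.congr_fun hψ
  rcases indec_endo s.l_indec ψ with hu | ⟨n, hn⟩
  · refine seq_five s φ ψ LinearMap.id (fun x => (hψ' x).symm) hφ' ?_ injective_id
    exact ((Module.End.isUnit_iff ψ).1 hu).1
  · exfalso
    let φn : Module.End R s.m.M := (φ : Module.End R s.m.M) ^ n
    have h1 : ∀ (k : ℕ) x, s.g (((φ : Module.End R s.m.M) ^ k) x) = s.g x := by
      intro k
      induction k with
      | zero => intro x; rfl
      | succ k ih =>
        intro x
        rw [pow_succ', Module.End.mul_apply, hφ', ih]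
    have h2 : ∀ (k : ℕ) x, ((φ : Module.End R s.m.M) ^ k) (s.f x)
        = s.f (((ψ : Module.End R s.l.M) ^ k) x) := by
      intro k
      induction k with
      | zero => intro x; rfl
      | succ k ih =>
        intro x
        rw [pow_succ', Module.End.mul_apply, pow_succ', Module.End.mul_apply, ih, hψ']
    obtain ⟨χ, hχ⟩ := factor_surj s.g s.surj φn (by
      intro x hx
      obtain ⟨y, rfl⟩ := seq_ker s hx
      show ((φ : Module.End R s.m.M) ^ n) (s.f y) = 0
      rw [h2, hn]; simp)
    apply s.not_split
    refine ⟨χ, ?_⟩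
    ext y
    obtain ⟨x, rfl⟩ := s.surj y
    show s.g (χ (s.g x)) = s.g x
    rw [show χ (s.g x) = φn x from LinearMap.congr_fun hχ x]
    exact h1 n x

lemma seq_lmin (s : AlmostSplitSeq R) : LMin s.f := by
  intro φ hφ
  have hφ' : ∀ x, φ (s.f x) = s.f x := LinearMap.congr_fun hφ
  obtain ⟨θ, hθ⟩ := factor_surj s.g s.surj (s.g.comp φ) (by
    intro x hx
    obtain ⟨y, rfl⟩ := seq_ker s hx
    show s.g (φ (s.f y)) = 0
    rw [hφ', seq_gf])
  have hθ' : ∀ x, θ (s.g x) = s.g (φ x) := LinearMap.congr_fun hθ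
  rcases indec_endo s.r_indec θ with hu | ⟨n, hn⟩
  · refine seq_five s φ LinearMap.id θ hφ' (fun x => (hθ' x).symm) injective_id ?_
    exact ((Module.End.isUnit_iff θ).1 hu).1
  · exfalso
    let φn : Module.End R s.m.M := (φ : Module.End R s.m.M) ^ n
    have h1 : ∀ (k : ℕ) x, ((φ : Module.End R s.m.M) ^ k) (s.f x) = s.f x := by
      intro k
      induction k with
      | zero => intro x; rfl
      | succ k ih =>
        intro x
        rw [pow_succ', Module.End.mul_apply, ih, hφ']
    have h2 : ∀ (k : ℕ) x, s.g (((φ : Module.End R s.m.M) ^ k) x)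
        = ((θ : Module.End R s.r.M) ^ k) (s.g x) := by
      intro k
      induction k with
      | zero => intro x; rfl
      | succ k ih =>
        intro x
        rw [pow_succ', Module.End.mul_apply, pow_succ', Module.End.mul_apply, ← ih, hθ']
    obtain ⟨χ, hχ⟩ := factor_inj s.f s.inj φn (by
      intro x
      apply seq_ker s
      show s.g (((φ : Module.End R s.m.M) ^ n) x) = 0
      rw [h2, hn]; simp)
    apply (seq_las s).1
    refine ⟨χ, ?_⟩
    ext y
    apply s.inj
    show s.f (χ (s.f y)) = s.f y
    rw [show s.f (χ (s.f y)) = φn (s.f y) from LinearMap.congr_fun hχ _]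
    exact h1 n y

lemma seq_len (s : AlmostSplitSeq R) : mlen s.m = mlen s.l + mlen s.r :=
  mlen_exact s.f s.g s.inj s.surj s.exact

lemma seq_uniq_aux (s t : AlmostSplitSeq R) (h : s.r.Iso t.r) :
    ∃ ψ : s.l.M →ₗ[R] t.l.M, Injective ψ := by
  obtain ⟨i⟩ := h
  have h1 : ¬ SplitEpiMap (X := s.m) (Y := t.r) (i.toLinearMap.comp s.g) := by
    rintro ⟨σ, hσ⟩
    apply s.not_split
    refine ⟨σ.comp i.toLinearMap, ?_⟩
    ext x
    apply i.injective
    exact LinearMap.congr_fun hσ (i x)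
  have h2 : ¬ SplitEpiMap (X := t.m) (Y := s.r) (i.symm.toLinearMap.comp t.g) := by
    rintro ⟨σ, hσ⟩
    apply t.not_split
    refine ⟨σ.comp i.symm.toLinearMap, ?_⟩
    ext x
    apply i.symm.injective
    exact LinearMap.congr_fun hσ (i.symm x)
  obtain ⟨u, hu⟩ := t.right_almost _ _ h1
  obtain ⟨v, hv⟩ := s.right_almost _ _ h2
  have hu' : ∀ x, t.g (u x) = i (s.g x) := LinearMap.congr_fun hu
  have hv' : ∀ x, s.g (v x) = i.symm (t.g x) := LinearMap.congr_fun hv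
  have hb : Bijective (v.comp u) := seq_rmin s _ (by
    ext x
    show s.g (v (u x)) = s.g x
    rw [hv', hu', i.symm_apply_apply])
  have hui : Injective u := by
    intro x y hxy
    apply hb.1
    exact congrArg v hxy
  obtain ⟨ψ, hψ⟩ := factor_inj t.f t.inj (u.comp s.f) (fun x => seq_ker t (by
    show t.g (u (s.f x)) = 0
    rw [hu', seq_gf, map_zero]))
  refine ⟨ψ, fun x y hxy => ?_⟩
  apply s.inj
  apply hui
  have := LinearMap.congr_fun hψ
  exact (this x).symm.trans ((congrArg t.f hxy).trans (this y))

lemma Iso.symm' {X Y : ModA R} (h : X.Iso Y) : Y.Iso X := h.elim fun e => ⟨e.symm⟩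
lemma Iso.trans' {X Y Z : ModA R} (h : X.Iso Y) (h' : Y.Iso Z) : X.Iso Z :=
  h.elim fun e => h'.elim fun e' => ⟨e.trans e'⟩
lemma Iso.refl' (X : ModA R) : X.Iso X := ⟨LinearEquiv.refl R X.M⟩

lemma seq_uniq_l (s t : AlmostSplitSeq R) (h : s.r.Iso t.r) : s.l.Iso t.l := by
  obtain ⟨ψ, hψ⟩ := seq_uniq_aux s t h
  obtain ⟨ψ', hψ'⟩ := seq_uniq_aux t s (Iso.symm' h)
  exact iso_of_bij (bij_of_inj_len ψ hψ (mlen_le_inj ψ' hψ'))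

lemma seq_uniq_aux' (s t : AlmostSplitSeq R) (h : s.l.Iso t.l) :
    ∃ θ : s.r.M →ₗ[R] t.r.M, Surjective θ := by
  obtain ⟨i⟩ := h
  have h1 : ¬ SplitMonoMap (X := s.l) (Y := t.m) (t.f.comp i.toLinearMap) := by
    rintro ⟨σ, hσ⟩
    apply (seq_las t).1
    refine ⟨i.toLinearMap.comp σ, ?_⟩
    ext x
    have := congrArg i (LinearMap.congr_fun hσ (i.symm x))
    simpa using this
  have h2 : ¬ SplitMonoMap (X := t.l) (Y := s.m) (s.f.comp i.symm.toLinearMap) := by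
    rintro ⟨σ, hσ⟩
    apply (seq_las s).1
    refine ⟨i.symm.toLinearMap.comp σ, ?_⟩
    ext x
    have := congrArg i.symm (LinearMap.congr_fun hσ (i x))
    simpa using this
  obtain ⟨u, hu⟩ := s.left_almost _ _ h1
  obtain ⟨v, hv⟩ := t.left_almost _ _ h2
  have hu' : ∀ x, u (s.f x) = t.f (i x) := LinearMap.congr_fun hu
  have hv' : ∀ x, v (t.f x) = s.f (i.symm x) := LinearMap.congr_fun hv
  have hb : Bijective (u.comp v) := seq_lmin t _ (by
    ext x
    show u (v (t.f x)) = t.f x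
    rw [hv', hu', i.apply_symm_apply])
  obtain ⟨θ, hθ⟩ := factor_surj s.g s.surj (t.g.comp u) (by
    intro x hx
    obtain ⟨y, rfl⟩ := seq_ker s hx
    show t.g (u (s.f y)) = 0
    rw [hu', seq_gf])
  refine ⟨θ, fun y => ?_⟩
  obtain ⟨x, rfl⟩ := t.surj y
  obtain ⟨z, rfl⟩ := hb.2 x
  exact ⟨s.g (v z), LinearMap.congr_fun hθ (v z)⟩

lemma seq_uniq_r (s t : AlmostSplitSeq R) (h : s.l.Iso t.l) : s.r.Iso t.r := by
  obtain ⟨ψ, hψ⟩ := seq_uniq_aux' s t h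
  obtain ⟨ψ', hψ'⟩ := seq_uniq_aux' t s (Iso.symm' h)
  obtain ⟨e⟩ := (⟨LinearEquiv.ofBijective _ (bij_of_surj_endo (ψ'.comp ψ) (hψ'.comp hψ))⟩ : s.r.Iso s.r)
  refine iso_of_bij (f := ψ) ⟨?_, hψ⟩
  intro x y hxy
  exact (bij_of_surj_endo (ψ'.comp ψ) (hψ'.comp hψ)).1 (congrArg ψ' hxy)

/-- irreducible maps into `M` give summands of a right almost split map -/
lemma retr_of_irred_ras {X E M : ModA R} {g : E.M →ₗ[R] M.M} (hg : RAS g) {f : X.M →ₗ[R] M.M}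
    (hf : IsIrred f) : ∃ h : X.M →ₗ[R] E.M, SplitMonoMap h ∧ g.comp h = f := by
  obtain ⟨h, hh⟩ := hg.2 X f hf.2.1
  rcases hf.2.2 E h g hh with h1 | h1
  · exact ⟨h, h1, hh⟩
  · exact absurd h1 hg.1

lemma retr_of_irred_las {X E M : ModA R} {g : M.M →ₗ[R] E.M} (hg : LAS g) {f : M.M →ₗ[R] X.M}
    (hf : IsIrred f) : ∃ h : E.M →ₗ[R] X.M, SplitEpiMap h ∧ h.comp g = f := by
  obtain ⟨h, hh⟩ := hg.2 X f hf.1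
  rcases hf.2.2 E g h hh with h1 | h1
  · exact absurd h1 hg.1
  · exact ⟨h, h1, hh⟩

lemma Retr.of_splitMono {X E : ModA R} {h : X.M →ₗ[R] E.M} (hh : SplitMonoMap h) : Retr X E := by
  obtain ⟨r, hr⟩ := hh
  exact ⟨h, r, by rw [hr]; exact bij_id _⟩

lemma Retr.of_splitEpi {X E : ModA R} {h : E.M →ₗ[R] X.M} (hh : SplitEpiMap h) : Retr X E := by
  obtain ⟨r, hr⟩ := hh
  exact ⟨r, h, by rw [hr]; exact bij_id _⟩

lemma Retr.split {X E : ModA R} (h : Retr X E) :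
    ∃ (t : X.M →ₗ[R] E.M) (p : E.M →ₗ[R] X.M), p.comp t = LinearMap.id := by
  obtain ⟨s, r, hb⟩ := h
  obtain ⟨i, hi, -⟩ := exists_inv hb
  exact ⟨s, i.comp r, hi⟩

lemma irred_of_ras {X E M : ModA R} (hX : X.IsIndec) (hM : M.IsIndec) {g : E.M →ₗ[R] M.M}
    (hg : RAS g) (hmin : RMin g) {t : X.M →ₗ[R] E.M} (ht : SplitMonoMap t) :
    IsIrred (g.comp t) := by
  have hne : ¬ SplitEpiMap (g.comp t) := by
    rintro ⟨s, hs⟩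
    exact hg.1 ⟨t.comp s, hs⟩
  obtain ⟨p, hp⟩ := ht
  have hp' : ∀ x, p (t x) = x := LinearMap.congr_fun hp
  refine ⟨?_, hne, ?_⟩
  · intro h
    obtain ⟨i, hi, hi'⟩ := exists_inv (splitMono_bij hX.1 hM h)
    exact hne ⟨i, hi'⟩
  · intro Z a b hab
    by_cases hb : SplitEpiMap b
    · exact Or.inr hb
    left
    obtain ⟨b', hb'⟩ := hg.2 Z b hb
    have hb'' : ∀ x, g (b' x) = b x := LinearMap.congr_fun hb'
    have hab' : ∀ x, b (a x) = g (t x) := LinearMap.congr_fun hab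
    let φ : E.M →ₗ[R] E.M := LinearMap.id - (t - b'.comp a).comp p
    have hφ : Bijective φ := hmin φ (by
      ext x
      show g (x - (t (p x) - b' (a (p x)))) = g x
      rw [map_sub, map_sub, hb'', hab', sub_self, sub_zero])
    obtain ⟨i, hi, -⟩ := exists_inv hφ
    have hi' : ∀ x, i (φ x) = x := LinearMap.congr_fun hi
    refine ⟨p.comp (i.comp b'), ?_⟩
    ext x
    show p (i (b' (a x))) = x
    have : φ (t x) = b' (a x) := by
      show t x - (t (p (t x)) - b' (a (p (t x)))) = _
      rw [hp']; abel
    rw [← this, hi', hp']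

lemma irred_of_las {X E M : ModA R} (hX : X.IsIndec) (hM : M.IsIndec) {g : M.M →ₗ[R] E.M}
    (hg : LAS g) (hmin : LMin g) {p : E.M →ₗ[R] X.M} (hp : SplitEpiMap p) :
    IsIrred (p.comp g) := by
  have hne : ¬ SplitMonoMap (p.comp g) := by
    rintro ⟨s, hs⟩
    exact hg.1 ⟨s.comp p, hs⟩
  obtain ⟨t, ht⟩ := hp
  have ht' : ∀ x, p (t x) = x := LinearMap.congr_fun ht
  refine ⟨hne, ?_, ?_⟩
  · intro h
    obtain ⟨i, hi, hi'⟩ := exists_inv (splitEpi_bij hM hX.1 h)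
    exact hne ⟨i, hi⟩
  · intro Z a b hab
    by_cases ha : SplitMonoMap a
    · exact Or.inl ha
    right
    obtain ⟨a', ha'⟩ := hg.2 Z a ha
    have ha'' : ∀ x, a' (g x) = a x := LinearMap.congr_fun ha'
    have hab' : ∀ x, b (a x) = p (g x) := LinearMap.congr_fun hab
    let φ : E.M →ₗ[R] E.M := LinearMap.id - t.comp (p - b.comp a')
    have hφ : Bijective φ := hmin φ (by
      ext x
      show g x - t (p (g x) - b (a' (g x))) = g x
      rw [ha'', hab', sub_self, map_zero, sub_zero])
    obtain ⟨i, -, hi⟩ := exists_inv hφ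
    have hi' : ∀ x, φ (i x) = x := LinearMap.congr_fun hi
    refine ⟨a'.comp (i.comp t), ?_⟩
    ext x
    show b (a' (i (t x))) = x
    have : ∀ y, p (φ y) = b (a' y) := by
      intro y
      show p (y - t (p y - b (a' y))) = _
      rw [map_sub, ht']; abel
    rw [← this, hi', ht']

lemma isIrred_not_bij {X Y : ModA R} {f : X.M →ₗ[R] Y.M} (h : IsIrred f) : ¬ Bijective f := by
  intro hb
  obtain ⟨i, hi, -⟩ := exists_inv hb
  exact h.1 ⟨i, hi⟩

lemma isIrred_iso {X Y X' Y' : ModA R} (hX : X.Iso X') (hY : Y.Iso Y') {f : X.M →ₗ[R] Y.M}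
    (h : IsIrred f) : ∃ f' : X'.M →ₗ[R] Y'.M, IsIrred f' := by
  obtain ⟨e⟩ := hX
  obtain ⟨e'⟩ := hY
  refine ⟨e'.toLinearMap.comp (f.comp e.symm.toLinearMap), ?_, ?_, ?_⟩
  · rintro ⟨r, hr⟩
    apply h.1
    refine ⟨e.symm.toLinearMap.comp (r.comp e'.toLinearMap), ?_⟩
    ext x
    have := LinearMap.congr_fun hr (e x)
    simp only [LinearMap.comp_apply, LinearEquiv.coe_coe, LinearMap.id_apply,
      LinearEquiv.symm_apply_apply] at this ⊢
    rw [this, LinearEquiv.symm_apply_apply]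
  · rintro ⟨r, hr⟩
    apply h.2.1
    refine ⟨e.symm.toLinearMap.comp (r.comp e'.toLinearMap), ?_⟩
    ext x
    have := LinearMap.congr_fun hr (e' x)
    simp only [LinearMap.comp_apply, LinearEquiv.coe_coe, LinearMap.id_apply] at this ⊢
    exact e'.injective this
  · intro Z a b hab
    rcases h.2.2 Z (a.comp e.toLinearMap) (e'.symm.toLinearMap.comp b) (by
      ext x
      have := LinearMap.congr_fun hab (e x)
      simp only [LinearMap.comp_apply, LinearEquiv.coe_coe,
        LinearEquiv.symm_apply_apply] at this ⊢
      rw [this, LinearEquiv.symm_apply_apply]) with ⟨r, hr⟩ | ⟨r, hr⟩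
    · left
      refine ⟨e.toLinearMap.comp r, ?_⟩
      ext x
      have := LinearMap.congr_fun hr (e.symm x)
      simp only [LinearMap.comp_apply, LinearEquiv.coe_coe, LinearMap.id_apply,
        LinearEquiv.apply_symm_apply] at this ⊢
      rw [this, LinearEquiv.apply_symm_apply]
    · right
      refine ⟨r.comp e'.symm.toLinearMap, ?_⟩
      ext x
      have := LinearMap.congr_fun hr (e'.symm x)
      simp only [LinearMap.comp_apply, LinearEquiv.coe_coe, LinearMap.id_apply] at this ⊢
      exact e'.symm.injective this

end Props
end CF

namespace CF
open Function
set_option linter.all false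

section HS
variable {R : Type u} [Ring R]

/-- length of the image -/
noncomputable def rk {X Y : ModA R} (f : X.M →ₗ[R] Y.M) : ℕ := mlen (subM Y (LinearMap.range f))

lemma rk_le {X Y : ModA R} (f : X.M →ₗ[R] Y.M) : rk f ≤ mlen Y :=
  mlen_le_inj (X := subM Y (LinearMap.range f)) (Y := Y) (LinearMap.range f).subtype
    (Submodule.injective_subtype _)

lemma rk_zero {X Y : ModA R} (f : X.M →ₗ[R] Y.M) (h : rk f = 0) : f = 0 := by
  by_contra hne
  have : ∃ x, f x ≠ 0 := by
    by_contra hc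
    push Not at hc
    exact hne (LinearMap.ext hc)
  obtain ⟨x, hx⟩ := this
  have h1 := mlen_eq (subM Y (LinearMap.range f))
  rw [show mlen (subM Y (LinearMap.range f)) = 0 from h] at h1
  have h2 : Subsingleton (subM Y (LinearMap.range f)).M := Module.length_eq_zero_iff.1 h1.symm
  have h3 : (⟨f x, x, rfl⟩ : (LinearMap.range f)) = 0 := h2.elim _ _
  exact hx (congrArg Subtype.val h3)

lemma rk_comp_left {X Y Z : ModA R} (a : X.M →ₗ[R] Y.M) (b : Y.M →ₗ[R] Z.M)
    (h : rk a ≤ rk (b.comp a)) : ∀ x, b (a x) = 0 → a x = 0 := by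
  let A := subM Y (LinearMap.range a)
  let B := subM Z (LinearMap.range (b.comp a))
  let t : A.M →ₗ[R] B.M := (b.comp (LinearMap.range a).subtype).codRestrict _ (by
    rintro ⟨_, x, rfl⟩
    exact ⟨x, rfl⟩)
  have ht : Surjective t := by
    rintro ⟨_, x, rfl⟩
    exact ⟨⟨a x, x, rfl⟩, rfl⟩
  have h1 : mlen (subM A (LinearMap.ker t)) + mlen B = mlen A :=
    (mlen_exact (X := subM A (LinearMap.ker t)) (LinearMap.ker t).subtype t
      (Submodule.injective_subtype _) ht (Submodule.range_subtype _)).symm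
  have h2 : mlen A ≤ mlen B := h
  have h3 : mlen (subM A (LinearMap.ker t)) = 0 := by omega
  have h4 := mlen_eq (subM A (LinearMap.ker t))
  rw [h3] at h4
  have h5 : Subsingleton (subM A (LinearMap.ker t)).M := Module.length_eq_zero_iff.1 h4.symm
  intro x hx
  have h6 : t ⟨a x, x, rfl⟩ = 0 := Subtype.ext hx
  have h7 : (⟨⟨a x, x, rfl⟩, h6⟩ : LinearMap.ker t) = 0 := h5.elim _ _
  exact congrArg Subtype.val (congrArg Subtype.val h7)

lemma rk_comp_right {X Y Z : ModA R} (a : X.M →ₗ[R] Y.M) (b : Y.M →ₗ[R] Z.M)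
    (h : rk b ≤ rk (b.comp a)) : ∀ y, ∃ x, b (a x) = b y := by
  let A := subM Z (LinearMap.range (b.comp a))
  let B := subM Z (LinearMap.range b)
  let t : A.M →ₗ[R] B.M := Submodule.inclusion (LinearMap.range_comp_le_range a b)
  have ht : Injective t := Submodule.inclusion_injective _
  have := bij_of_inj_len t ht h
  intro y
  obtain ⟨⟨_, x, rfl⟩, hx⟩ := this.2 ⟨b y, y, rfl⟩
  exact ⟨x, congrArg Subtype.val hx⟩

lemma indec_compl {X : ModA R} (hX : X.IsIndec) (P Q : Submodule R X.M) (h : IsCompl P Q) :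
    P = ⊥ ∨ Q = ⊥ := by
  let e : Module.End R X.M := P.projection Q h
  have he : e * e = e := (Submodule.isIdempotentElem_projection h)
  rcases hX.2 e he with h0 | h1
  · left
    have : LinearMap.range e = P := Submodule.range_projection h
    rw [← this, h0, LinearMap.range_zero]
  · right
    have : LinearMap.ker e = Q := Submodule.ker_projection h
    rw [← this, h1]
    exact LinearMap.ker_id

lemma hs_mid {X Y Z W : ModA R} (hY : Y.IsIndec) (hZ : Z.IsIndec) (f : X.M →ₗ[R] Y.M)
    (g : Y.M →ₗ[R] Z.M) (h : Z.M →ₗ[R] W.M) (hg : ¬ Bijective g)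
    (h1 : rk f ≤ rk (h.comp (g.comp f))) (h2 : rk h ≤ rk (h.comp (g.comp f))) :
    h.comp (g.comp f) = 0 := by
  by_contra hne
  have a1 : ∀ x, h (g (f x)) = 0 → f x = 0 := rk_comp_left f (h.comp g) h1
  have a2 : ∀ z, ∃ x, h (g (f x)) = h z := rk_comp_right (g.comp f) h h2
  have c1 : IsCompl (LinearMap.range f) (LinearMap.ker (h.comp g)) := by
    constructor
    · rw [Submodule.disjoint_def]
      rintro _ ⟨x, rfl⟩ hx
      exact a1 x hx
    · rw [codisjoint_iff, eq_top_iff]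
      intro y _
      obtain ⟨x, hx⟩ := a2 (g y)
      rw [Submodule.mem_sup]
      refine ⟨f x, ⟨x, rfl⟩, y - f x, ?_, by abel⟩
      rw [LinearMap.mem_ker, map_sub, sub_eq_zero]
      exact hx.symm
  have c2 : IsCompl (LinearMap.range (g.comp f)) (LinearMap.ker h) := by
    constructor
    · rw [Submodule.disjoint_def]
      rintro _ ⟨x, rfl⟩ hx
      show g (f x) = 0
      rw [a1 x hx, map_zero]
    · rw [codisjoint_iff, eq_top_iff]
      intro y _
      obtain ⟨x, hx⟩ := a2 y
      rw [Submodule.mem_sup]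
      refine ⟨g (f x), ⟨x, rfl⟩, y - g (f x), ?_, by abel⟩
      rw [LinearMap.mem_ker, map_sub, sub_eq_zero]
      exact hx.symm
  have hgi : LinearMap.ker (h.comp g) = ⊥ := by
    rcases indec_compl hY _ _ c1 with h0 | h0
    · exfalso
      apply hne
      rw [LinearMap.range_eq_bot] at h0
      rw [h0]; simp
    · exact h0
  have hhi : LinearMap.ker h = ⊥ := by
    rcases indec_compl hZ _ _ c2 with h0 | h0
    · exfalso
      apply hne
      rw [LinearMap.range_eq_bot] at h0
      rw [h0]; simp
    · exact h0
  apply hg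
  constructor
  · have : Injective (h.comp g) := LinearMap.ker_eq_bot.1 hgi
    intro x y hxy
    exact this (congrArg h hxy)
  · intro z
    obtain ⟨x, hx⟩ := a2 z
    exact ⟨f x, LinearMap.ker_eq_bot.1 hhi hx⟩

/-- composites of consecutive maps -/
inductive PC (X : ℕ → ModA R) (f : ∀ i, (X i).M →ₗ[R] (X (i + 1)).M) :
    ∀ i j, ((X i).M →ₗ[R] (X j).M) → Prop
  | nil (i) : PC X f i i LinearMap.id
  | snoc (i j φ) : PC X f i j φ → PC X f i (j + 1) ((f j).comp φ)

variable {X : ℕ → ModA R} {f : ∀ i, (X i).M →ₗ[R] (X (i + 1)).M}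

lemma PC.le {i j φ} (h : PC X f i j φ) : i ≤ j := by
  induction h with
  | nil => exact le_rfl
  | snoc j φ h ih => omega

lemma PC.exists (n : ℕ) : ∃ φ, PC X f 0 n φ := by
  induction n with
  | zero => exact ⟨_, PC.nil 0⟩
  | succ n ih => exact ih.elim fun φ h => ⟨_, PC.snoc _ _ _ h⟩

lemma PC.split {i j φ} (h : PC X f i j φ) (k : ℕ) (hik : i ≤ k) (hkj : k < j) :
    ∃ a b, PC X f i k a ∧ PC X f (k + 1) j b ∧ φ = b.comp ((f k).comp a) := by
  induction h with
  | nil => omega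
  | snoc j φ h ih =>
    rcases Nat.lt_succ_iff_lt_or_eq.1 hkj with h1 | h1
    · obtain ⟨a, b, ha, hb, rfl⟩ := ih h1
      exact ⟨a, _, ha, PC.snoc _ _ _ hb, rfl⟩
    · subst h1
      exact ⟨φ, LinearMap.id, h, PC.nil _, rfl⟩

lemma harada_sai {N b : ℕ} (hX : ∀ i ≤ N, (X i).IsIndec) (hb : ∀ i ≤ N, mlen (X i) ≤ b)
    (hf : ∀ i < N, ¬ Bijective (f i)) (m : ℕ) : ∀ i j φ, PC X f i j φ → j + 1 = i + 2 ^ m →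
      j ≤ N → φ = 0 ∨ rk φ + m ≤ b := by
  induction m with
  | zero =>
    intro i j φ h hj hN
    right
    exact (rk_le φ).trans (hb _ hN)
  | succ m ih =>
    intro i j φ h hj hN
    have hp : 0 < 2 ^ m := by positivity
    rw [pow_succ] at hj
    obtain ⟨a, c, ha, hc, rfl⟩ := h.split (i + 2 ^ m - 1) (by omega) (by omega)
    rcases ih _ _ _ ha (by omega) (by omega) with h0 | h1
    · left; rw [h0]; simp
    rcases ih _ _ _ hc (by omega) (by omega) with h0 | h2
    · left; rw [h0]; simp
    by_cases hlt : rk (c.comp ((f (i + 2 ^ m - 1)).comp a)) + (m + 1) ≤ b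
    · exact Or.inr hlt
    left
    exact hs_mid (hX _ (by omega)) (hX _ (by omega)) a _ c (hf _ (by omega)) (by omega) (by omega)

lemma harada_sai_zero {b : ℕ} (hX : ∀ i, i + 1 ≤ 2 ^ b → (X i).IsIndec)
    (hb : ∀ i, i + 1 ≤ 2 ^ b → mlen (X i) ≤ b)
    (hf : ∀ i, i + 1 < 2 ^ b → ¬ Bijective (f i)) (φ) (h : PC X f 0 (2 ^ b - 1) φ) : φ = 0 := by
  have hp : 0 < 2 ^ b := by positivity
  rcases harada_sai (N := 2 ^ b - 1) (b := b) (fun i hi => hX i (by omega))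
    (fun i hi => hb i (by omega)) (fun i hi => hf i (by omega)) b 0 _ φ h (by omega) le_rfl
    with h0 | h1
  · exact h0
  · exact rk_zero φ (by omega)

end HS

section Sect
variable {R : Type u} [Ring R]

lemma sep_split {X Y E : ModA R} (hX : X.IsIndec) (hY : Y.IsIndec) (hne : ¬ Y.Iso X)
    {a : X.M →ₗ[R] E.M} {b : Y.M →ₗ[R] E.M} (ha : SplitMonoMap a) (hb : SplitMonoMap b) :
    ∃ p : E.M →ₗ[R] X.M, p.comp a = LinearMap.id ∧ p.comp b = 0 := by
  obtain ⟨p, hp⟩ := ha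
  obtain ⟨q, hq⟩ := hb
  have hp' : ∀ x, p (a x) = x := LinearMap.congr_fun hp
  have hq' : ∀ x, q (b x) = x := LinearMap.congr_fun hq
  let t : X.M →ₗ[R] X.M := p.comp (b.comp (q.comp a))
  have h1 : Bijective ((t + (LinearMap.id - t) : X.M →ₗ[R] X.M)) := by
    rw [add_sub_cancel]; exact bij_id _
  have h2 : Bijective ((LinearMap.id - t : X.M →ₗ[R] X.M)) := by
    rcases indec_add hX h1 with h | h
    · exfalso
      have := bij_of_comp (s := q.comp a) (r := p.comp b) hX hY hX h
      exact hne (iso_of_bij this.2)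
    · exact h
  obtain ⟨i, hi, -⟩ := exists_inv h2
  have hi' : ∀ x, i (x - p (b (q (a x)))) = x := LinearMap.congr_fun hi
  refine ⟨i.comp (p - p.comp (b.comp q)), ?_, ?_⟩
  · ext x
    show i (p (a x) - p (b (q (a x)))) = x
    rw [hp', hi']
  · ext y
    show i (p (b y) - p (b (q (b y)))) = 0
    rw [hq', sub_self, map_zero]

lemma ras_of_proj {M E : ModA R} (hp : Module.Projective R M.M) (g : E.M →ₗ[R] M.M) (hg : RAS g) :
    ∃ (E' : ModA R) (g' : E'.M →ₗ[R] M.M), RAS g' ∧ Injective g' := by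
  refine ⟨subM M (LinearMap.range g), (LinearMap.range g).subtype, ⟨?_, ?_⟩,
    Submodule.injective_subtype _⟩
  · rintro ⟨s, hs⟩
    apply hg.1
    have hsurj : Surjective g := by
      intro y
      obtain ⟨x, hx⟩ := (s y).2
      exact ⟨x, hx.trans (LinearMap.congr_fun hs y)⟩
    obtain ⟨s', hs'⟩ := Module.projective_lifting_property g LinearMap.id hsurj
    exact ⟨s', hs'⟩
  · intro Z h hh
    obtain ⟨h', hh'⟩ := hg.2 Z h hh
    exact ⟨g.rangeRestrict.comp h', hh'⟩

lemma sect_step (K : Type u) [CommRing K] [IsArtinianRing K] [Algebra K R] [Module.Finite K R]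
    {X0 X M : ModA R} (hX : X.IsIndec) (hM : M.IsIndec) {f : X.M →ₗ[R] M.M} (hf : IsIrred f)
    {φ : X0.M →ₗ[R] X.M} (hφ : φ ≠ 0)
    (hno : ∀ s : AlmostSplitSeq R, s.r.Iso M → ∀ h : s.l.M →ₗ[R] X.M, IsIrred h →
      ∀ v : X0.M →ₗ[R] s.l.M, h.comp v ≠ φ) :
    f.comp φ ≠ 0 ∧ ∀ (Y : ModA R), Y.IsIndec → ¬ Y.Iso X → ∀ h : Y.M →ₗ[R] M.M, IsIrred h →
      ∀ u : X0.M →ₗ[R] Y.M, h.comp u ≠ f.comp φ := by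
  have core : ∃ (E : ModA R) (g : E.M →ₗ[R] M.M), RAS g ∧ ∀ (a : X.M →ₗ[R] E.M)
      (p : E.M →ₗ[R] X.M) (w : X0.M →ₗ[R] E.M), p.comp a = LinearMap.id → p.comp w = 0 →
      (∀ x, g (a (φ x)) = g (w x)) → False := by
    by_cases hp : Module.Projective R M.M
    · obtain ⟨E, g, hg⟩ := exists_ras K M hM
      obtain ⟨E, g, hg, hgi⟩ := ras_of_proj hp g hg
      refine ⟨E, g, hg, fun a p w hpa hpw hx => hφ ?_⟩
      ext x
      have h1 : a (φ x) = w x := hgi (hx x)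
      have h2 := LinearMap.congr_fun hpa (φ x)
      have h3 := LinearMap.congr_fun hpw x
      simp only [LinearMap.comp_apply, LinearMap.id_apply, LinearMap.zero_apply] at h2 h3 ⊢
      rw [← h2, h1, h3]
    · obtain ⟨s, rfl⟩ := exists_seq_right K M hM hp
      refine ⟨s.m, s.g, seq_ras s, fun a p w hpa hpw hx => ?_⟩
      obtain ⟨v, hv⟩ := factor_inj s.f s.inj (a.comp φ - w) (fun x => seq_ker s (by
        show s.g (a (φ x) - w x) = 0
        rw [map_sub, hx, sub_self]))
      refine hno s (Iso.refl' _) (p.comp s.f)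
        (irred_of_las hX s.l_indec (seq_las s) (seq_lmin s) ⟨a, hpa⟩) v ?_
      ext x
      have h1 := LinearMap.congr_fun hv x
      have h2 := LinearMap.congr_fun hpa (φ x)
      have h3 := LinearMap.congr_fun hpw x
      simp only [LinearMap.comp_apply, LinearMap.id_apply, LinearMap.zero_apply,
        LinearMap.sub_apply] at h1 h2 h3 ⊢
      rw [h1, map_sub, h2, h3, sub_zero]
  obtain ⟨E, g, hg, hc⟩ := core
  obtain ⟨a, ha, hga⟩ := retr_of_irred_ras hg hf
  have hga' : ∀ x, g (a x) = f x := LinearMap.congr_fun hga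
  constructor
  · intro h0
    obtain ⟨p, hp⟩ := ha
    refine hc a p 0 hp (by simp) (fun x => ?_)
    rw [hga']
    have := LinearMap.congr_fun h0 x
    simpa using this
  · intro Y hY hne h hh u hu
    obtain ⟨b, hb, hgb⟩ := retr_of_irred_ras hg hh
    have hgb' : ∀ x, g (b x) = h x := LinearMap.congr_fun hgb
    obtain ⟨p, hp, hpb⟩ := sep_split hX hY hne ha hb
    refine hc a p (b.comp u) hp ?_ (fun x => ?_)
    · rw [← LinearMap.comp_assoc, hpb, LinearMap.zero_comp]
    · rw [hga', LinearMap.comp_apply, hgb']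
      exact (LinearMap.congr_fun hu x).symm

lemma sect_ne_zero (K : Type u) [CommRing K] [IsArtinianRing K] [Algebra K R] [Module.Finite K R]
    {X : ℕ → ModA R} {f : ∀ i, (X i).M →ₗ[R] (X (i + 1)).M} {N : ℕ} (hX : ∀ i, (X i).IsIndec)
    (hf : ∀ i < N, IsIrred (f i)) (hs : ∀ i, i + 1 < N → ¬ IsTauOf (X i) (X (i + 2)))
    (n : ℕ) (hn : n ≤ N) (φ) (hφ : PC X f 0 n φ) : φ ≠ 0 := by
  have key : ∀ i j φ, PC X f i j φ → i = 0 → j ≤ N → φ ≠ 0 ∧ ∀ (Y : ModA R), Y.IsIndec →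
      (∀ k, k + 1 = j → ¬ Y.Iso (X k)) → ∀ h : Y.M →ₗ[R] (X j).M, IsIrred h →
      ∀ u : (X i).M →ₗ[R] Y.M, h.comp u ≠ φ := by
    intro i j φ h hi
    induction h with
    | nil =>
      intro _
      constructor
      · intro h0
        obtain ⟨x, hx⟩ := (nontrivial_iff_exists_ne (0 : (X i).M)).1 (hX i).1
        exact hx (LinearMap.congr_fun h0 x)
      · intro Y hY _ h hh u hu
        exact hh.2.1 ⟨u, hu⟩
    | snoc j φ h ih =>
      intro hj
      obtain ⟨h1, h2⟩ := ih (by omega)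
      obtain ⟨h3, h4⟩ := sect_step K (hX j) (hX (j + 1)) (hf j (by omega)) h1 (by
        intro s hs' h hh v
        refine h2 s.l s.l_indec ?_ h hh v
        intro k hk hiso
        subst hk
        exact hs k (by omega) ⟨s, hiso, hs'⟩)
      exact ⟨h3, fun Y hY hk => h4 Y hY (hk j rfl)⟩
  exact (key 0 n φ hφ rfl hn).1

end Sect
end CF

namespace CF
open Function Relation
set_option linter.all false

section Rad
variable {R : Type u} [Ring R]

lemma irred_ne_zero {X Y : ModA R} (hX : X.IsIndec) (hY : Y.IsIndec) {f : X.M →ₗ[R] Y.M}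
    (hf : IsIrred f) : f ≠ 0 := by
  rintro rfl
  have hs : Subsingleton (subM X ⊥).M := inferInstanceAs (Subsingleton (⊥ : Submodule R X.M))
  rcases hf.2.2 (subM X ⊥) 0 0 (by simp) with ⟨r, hr⟩ | ⟨s, hs'⟩
  · obtain ⟨a, b, hab⟩ := hX.1
    apply hab
    have h1 := LinearMap.congr_fun hr a
    have h2 := LinearMap.congr_fun hr b
    simp at h1 h2
    rw [← h1, ← h2]
  · obtain ⟨a, b, hab⟩ := hY.1
    apply hab
    have h1 := LinearMap.congr_fun hs' a
    have h2 := LinearMap.congr_fun hs' b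
    simp at h1 h2
    rw [← h1, ← h2]

lemma rad_pre {X Y Z : ModA R} {f : Y.M →ₗ[R] Z.M} (hf : InRad f) (g : X.M →ₗ[R] Y.M) :
    InRad (f.comp g) := by
  intro W hW a b
  exact hf W hW (g.comp a) b

lemma radPow_left (n : ℕ) {X Y Z : ModA R} {f : X.M →ₗ[R] Y.M} (hf : f ∈ radPow R n X Y)
    (h : Y.M →ₗ[R] Z.M) : h.comp f ∈ radPow R n X Z := by
  induction n generalizing X Y Z with
  | zero => exact AddSubgroup.mem_top _
  | succ n ih =>
    unfold radPow at hf
    induction hf using AddSubgroup.closure_induction with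
    | mem f hf =>
      obtain ⟨W, g, k, hg, hk, rfl⟩ := hf
      unfold radPow
      exact AddSubgroup.subset_closure ⟨W, g, h.comp k, hg, ih hk h, rfl⟩
    | zero => rw [LinearMap.comp_zero]; exact zero_mem _
    | add x y _ _ hx hy => rw [LinearMap.comp_add]; exact add_mem hx hy
    | neg x _ hx => rw [LinearMap.comp_neg]; exact neg_mem hx

lemma radPow_mk (n : ℕ) {X Y Z : ModA R} {f : Y.M →ₗ[R] Z.M} (hf : f ∈ radPow R n Y Z)
    {g : X.M →ₗ[R] Y.M} (hg : InRad g) : f.comp g ∈ radPow R (n + 1) X Z := by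
  show _ ∈ AddSubgroup.closure _
  exact AddSubgroup.subset_closure ⟨Y, g, f, hg, hf, rfl⟩

lemma radPow_step (n : ℕ) {X Y Z : ModA R} {g : X.M →ₗ[R] Y.M} (hg : g ∈ radPow R n X Y)
    {f : Y.M →ₗ[R] Z.M} (hf : InRad f) : f.comp g ∈ radPow R (n + 1) X Z := by
  induction n generalizing X Y Z with
  | zero =>
    have := radPow_mk 0 (f := (LinearMap.id : Z.M →ₗ[R] Z.M)) (AddSubgroup.mem_top _) (rad_pre hf g)
    exact this
  | succ n ih =>
    unfold radPow at hg
    induction hg using AddSubgroup.closure_induction with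
    | mem g hg =>
      obtain ⟨W, a, b, ha, hb, rfl⟩ := hg
      exact radPow_mk (n + 1) (ih hb hf) ha
    | zero => rw [LinearMap.comp_zero]; exact zero_mem _
    | add x y _ _ hx hy => rw [LinearMap.comp_add]; exact add_mem hx hy
    | neg x _ hx => rw [LinearMap.comp_neg]; exact neg_mem hx

lemma radPow_anti_succ (n : ℕ) (X Y : ModA R) : radPow R (n + 1) X Y ≤ radPow R n X Y := by
  induction n generalizing X Y with
  | zero => intro _ _; exact AddSubgroup.mem_top _
  | succ n ih =>
    intro f hf
    unfold radPow at hf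
    induction hf using AddSubgroup.closure_induction with
    | mem g hg =>
      obtain ⟨W, a, b, ha, hb, rfl⟩ := hg
      exact radPow_mk n (ih _ _ hb) ha
    | zero => exact zero_mem _
    | add x y _ _ hx hy => exact add_mem hx hy
    | neg x _ hx => exact neg_mem hx

lemma radPow_anti (X Y : ModA R) {m n : ℕ} (h : m ≤ n) : radPow R n X Y ≤ radPow R m X Y :=
  antitone_nat_of_succ_le (f := fun n => radPow R n X Y) (fun n => radPow_anti_succ n X Y) h

lemma radPow_one_not_bij {X Y : ModA R} (hX : X.IsIndec) {f : X.M →ₗ[R] Y.M}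
    (hf : f ∈ radPow R 1 X Y) : ¬ Bijective f := by
  have key : ∀ k : Y.M →ₗ[R] X.M, ¬ Bijective (k.comp f) := by
    intro k
    unfold radPow at hf
    induction hf using AddSubgroup.closure_induction with
    | mem g hg =>
      obtain ⟨W, a, b, ha, hb, rfl⟩ := hg
      exact ha X hX LinearMap.id (k.comp b)
    | zero => rw [LinearMap.comp_zero]; exact indec_not_bij_zero hX
    | add x y _ _ hx hy =>
      rw [LinearMap.comp_add]
      intro h
      rcases indec_add hX h with h | h
      · exact hx h
      · exact hy h
    | neg x _ hx =>
      rw [LinearMap.comp_neg]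
      intro h
      apply hx
      have : (k.comp x : X.M →ₗ[R] X.M) = (-LinearMap.id : X.M →ₗ[R] X.M).comp (-(k.comp x)) := by
        ext; simp
      rw [this]
      exact (neg_involutive.bijective (α := X.M)).comp h
  intro h
  obtain ⟨i, hi, -⟩ := exists_inv h
  apply key i
  rw [hi]; exact bij_id _

lemma PC.radPow {X : ℕ → ModA R} {f : ∀ i, (X i).M →ₗ[R] (X (i + 1)).M} {N : ℕ}
    (hf : ∀ i < N, InRad (f i)) (n : ℕ) (hn : n ≤ N) (φ) (hφ : PC X f 0 n φ) :
    φ ∈ radPow R n (X 0) (X n) := by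
  have key : ∀ i j φ, PC X f i j φ → i = 0 → j ≤ N → φ ∈ _root_.radPow R j (X i) (X j) := by
    intro i j φ h hi
    induction h with
    | nil => intro _; subst hi; exact AddSubgroup.mem_top _
    | snoc j φ h ih => intro hj; exact radPow_step j (ih (by omega)) (hf j (by omega))
  exact key 0 n φ hφ rfl hn

lemma hom_art (K : Type u) [CommRing K] [IsArtinianRing K] [Algebra K R] [Module.Finite K R]
    (X Y : ModA R) : IsArtinian K (X.M →ₗ[R] Y.M) := by
  obtain ⟨_, _⟩ := isFiniteLength_iff_isNoetherian_isArtinian.1 (kFL K Y)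
  obtain ⟨n, w, hw⟩ := Module.Finite.exists_fin (R := R) (M := X.M)
  let e : (X.M →ₗ[R] Y.M) →ₗ[K] (Fin n → Y.M) :=
    { toFun := fun f i => f (w i)
      map_add' := fun f g => rfl
      map_smul' := fun c f => rfl }
  refine isArtinian_of_injective e ?_
  intro f g h
  apply LinearMap.ext_on hw
  rintro _ ⟨i, rfl⟩
  exact congrFun h i

lemma radPow_stab (K : Type u) [CommRing K] [IsArtinianRing K] [Algebra K R] [Module.Finite K R]
    (X Y : ModA R) : ∃ m, ∀ f ∈ radPow R m X Y, InRadInf f := by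
  haveI := hom_art K X Y
  let S : ℕ → Submodule K (X.M →ₗ[R] Y.M) := fun n =>
    { (radPow R n X Y).toAddSubmonoid with
      smul_mem' := fun c f hf => radPow_left n hf (c • (LinearMap.id : Y.M →ₗ[R] Y.M)) }
  have hS : Antitone S := fun m n h => radPow_anti X Y h
  obtain ⟨m, hm⟩ := IsArtinian.monotone_stabilizes (⟨fun n => OrderDual.toDual (S n), hS⟩ :
    ℕ →o (Submodule K (X.M →ₗ[R] Y.M))ᵒᵈ)
  refine ⟨m, fun f hf n => ?_⟩
  rcases le_total n m with h | h
  · exact radPow_anti X Y h hf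
  · have h1 : S m = S n := hm n h
    have h2 : f ∈ S m := hf
    rw [h1] at h2
    exact h2

end Rad

section Cyc
variable {R : Type u} [Ring R]

/-- representing module of a vertex -/
noncomputable def rep (x : ARVertex R) : ModA R := (Quotient.out x).1

lemma rep_indec (x : ARVertex R) : (rep x).IsIndec := (Quotient.out x).2

lemma mk_eq {X Y : IndecModA R} : ARVertex.mk X = ARVertex.mk Y ↔ X.1.Iso Y.1 :=
  Quotient.eq (r := isoSetoid R)

lemma mk_rep (x : ARVertex R) : ARVertex.mk ⟨rep x, rep_indec x⟩ = x := Quotient.out_eq x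

lemma rep_iso {x : ARVertex R} {X : IndecModA R} (h : ARVertex.mk X = x) : X.1.Iso (rep x) := by
  exact mk_eq.1 (h.trans (mk_rep x).symm)

lemma rep_inj {x y : ARVertex R} (h : (rep x).Iso (rep y)) : x = y := by
  exact (mk_rep x).symm.trans ((mk_eq.2 h).trans (mk_rep y))

lemma arr_iff {x y : ARVertex R} : ARArrow x y ↔ ∃ f : (rep x).M →ₗ[R] (rep y).M, IsIrred f := by
  constructor
  · rintro ⟨X, Y, f, hf, hx, hy⟩
    exact isIrred_iso (rep_iso hx) (rep_iso hy) hf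
  · rintro ⟨f, hf⟩
    exact ⟨⟨_, rep_indec x⟩, ⟨_, rep_indec y⟩, f, hf, mk_rep x, mk_rep y⟩

lemma tau_iff {x y : ARVertex R} : TauRel x y ↔ IsTauOf (rep x) (rep y) := by
  constructor
  · rintro ⟨X, Y, hx, hy, s, h1, h2⟩
    exact ⟨s, Iso.trans' h1 (rep_iso hx), Iso.trans' h2 (rep_iso hy)⟩
  · intro h
    exact ⟨⟨_, rep_indec x⟩, ⟨_, rep_indec y⟩, mk_rep x, mk_rep y, h⟩

lemma path_of_map (K : Type u) [CommRing K] [IsArtinianRing K] [Algebra K R] [Module.Finite K R]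
    (n : ℕ) (M N : IndecModA R) (f : M.1.M →ₗ[R] N.1.M) (hb : ¬ Bijective f)
    (hf : f ∉ radPow R n M.1 N.1) : TransGen ARArrow (ARVertex.mk M) (ARVertex.mk N) := by
  induction n generalizing M N with
  | zero => exact absurd (AddSubgroup.mem_top _) hf
  | succ n ih =>
    obtain ⟨E, g, hg, hmin⟩ := exists_las_min (exists_las K M.1 M.2)
    obtain ⟨h, hh⟩ := hg.2 N.1 f (fun hs => hb (splitMono_bij M.2.1 N.2 hs))
    obtain ⟨d⟩ := exists_dec E
    have hirr : ∀ j, IsIrred ((d.p j).comp g) := fun j =>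
      irred_of_las (d.indec j) M.2 hg hmin ⟨d.i j, d.pi_self j⟩
    have hsum : f = ∑ j, (h.comp (d.i j)).comp ((d.p j).comp g) := by
      rw [← hh]
      ext x
      simp only [LinearMap.sum_apply, LinearMap.comp_apply]
      rw [← map_sum, d.total_apply]
    have : ∃ j, h.comp (d.i j) ∉ radPow R n (d.S j) N.1 := by
      by_contra hc
      push Not at hc
      apply hf
      rw [hsum]
      refine sum_mem fun j _ => radPow_mk n (hc j) ?_
      exact (inRad_iff M.2 (d.indec j) _).2 (isIrred_not_bij (hirr j))
    obtain ⟨j, hj⟩ := this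
    have harr : ARArrow (ARVertex.mk M) (ARVertex.mk ⟨d.S j, d.indec j⟩) :=
      ⟨M, ⟨d.S j, d.indec j⟩, _, hirr j, rfl, rfl⟩
    by_cases hbj : Bijective (h.comp (d.i j))
    · have : ARVertex.mk ⟨d.S j, d.indec j⟩ = ARVertex.mk N := mk_eq.2 (iso_of_bij hbj)
      rw [← this]
      exact TransGen.single harr
    · exact TransGen.head harr (ih ⟨d.S j, d.indec j⟩ N _ hbj hj)

lemma cyc_of_cf (K : Type u) [CommRing K] [IsArtinianRing K] [Algebra K R] [Module.Finite K R]
    {x : ARVertex R} (hx : IsCycleFiniteVertex x) : TransGen ARArrow x x := by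
  obtain ⟨X, rfl, ⟨c, i, hi⟩, h2⟩ := hx
  have hfin := h2 c ⟨i, hi⟩
  let v : Fin (c.len + 1) → ARVertex R := fun j => ARVertex.mk ⟨c.obj j, c.obj_indec j⟩
  have hv : v i = ARVertex.mk X := mk_eq.2 hi
  have hstep : ∀ j : Fin c.len, TransGen ARArrow (v j.castSucc) (v j.succ) := by
    intro j
    have := hfin j
    unfold InRadInf at this
    push Not at this
    obtain ⟨n, hn⟩ := this
    exact path_of_map K n ⟨_, c.obj_indec _⟩ ⟨_, c.obj_indec _⟩ _ (c.hom_not_iso j) hn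
  have hclosed : v (Fin.last c.len) = v 0 := by
    refine mk_eq.2 ?_
    show (c.obj _).Iso (c.obj _)
    rw [c.closed]
    exact Iso.refl' _
  have hpos := c.len_pos
  have hpath : ∀ (b : ℕ) (hb : b ≤ c.len) (a : ℕ) (ha : a < b),
      TransGen ARArrow (v ⟨a, by omega⟩) (v ⟨b, by omega⟩) := by
    intro b
    induction b with
    | zero => intro _ a ha; omega
    | succ b ih =>
      intro hb a ha
      have h1 := hstep ⟨b, by omega⟩
      rcases Nat.lt_succ_iff_lt_or_eq.1 ha with h | h
      · exact (ih (by omega) a h).trans h1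
      · subst h; exact h1
  rw [← hv]
  have h0 : TransGen ARArrow (v 0) (v 0) := by
    have := hpath c.len le_rfl 0 hpos
    rw [show (⟨c.len, by omega⟩ : Fin (c.len + 1)) = Fin.last c.len from rfl, hclosed] at this
    exact this
  rcases Nat.eq_zero_or_pos i.1 with h | h
  · have : i = 0 := Fin.ext h
    rw [this]; exact h0
  · rcases Nat.lt_or_ge i.1 c.len with h' | h'
    · have h1 := hpath i.1 (by omega) 0 h
      have h3 := hpath c.len le_rfl i.1 h'
      rw [show (⟨c.len, by omega⟩ : Fin (c.len + 1)) = Fin.last c.len from rfl, hclosed] at h3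
      exact h3.trans h1
    · have : i = Fin.last c.len := Fin.ext (by have := i.2; simp; omega)
      rw [this, hclosed]; exact h0

lemma rtg_path {α : Type*} {r : α → α → Prop} {a b : α} (h : ReflTransGen r a b) :
    ∃ (n : ℕ) (c : ℕ → α), c 0 = a ∧ c n = b ∧ ∀ i < n, r (c i) (c (i + 1)) := by
  induction h with
  | refl => exact ⟨0, fun _ => a, rfl, rfl, fun i hi => by omega⟩
  | @tail b d _ hr ih =>
    obtain ⟨n, c, h0, hn, hc⟩ := ih
    refine ⟨n + 1, fun i => if i ≤ n then c i else d, by simpa using h0, by simp, ?_⟩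
    intro i hi
    rcases Nat.lt_succ_iff_lt_or_eq.1 hi with h | h
    · simp only [if_pos h.le, if_pos (Nat.succ_le_of_lt h)]; exact hc i h
    · subst h; simp only [le_refl, if_true, if_neg (Nat.not_succ_le_self _)]
      rw [hn]; exact hr

lemma rtg_path2 {α : Type*} {r : α → α → Prop} {a b x : α} (h : ReflTransGen r a x)
    (h' : ReflTransGen r x b) :
    ∃ (n : ℕ) (c : ℕ → α), c 0 = a ∧ c n = b ∧ (∀ i < n, r (c i) (c (i + 1))) ∧
      ∃ k ≤ n, c k = x := by
  obtain ⟨n, c, h0, hn, hc⟩ := rtg_path h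
  obtain ⟨m, d, g0, gm, gc⟩ := rtg_path h'
  refine ⟨n + m, fun i => if i ≤ n then c i else d (i - n), by simpa using h0, ?_, ?_,
    n, by omega, by simpa using hn⟩
  · by_cases hm : m = 0
    · subst hm; simp [hn, ← gm, g0]
    · simp only [if_neg (show ¬ n + m ≤ n by omega)]
      rw [Nat.add_sub_cancel_left]; exact gm
  · intro i hi
    rcases Nat.lt_trichotomy i n with h | h | h
    · simp only [if_pos h.le, if_pos (Nat.succ_le_of_lt h)]; exact hc i h
    · subst h
      simp only [le_refl, if_true, if_neg (Nat.not_succ_le_self _)]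
      rw [hn, ← g0, Nat.add_sub_cancel_left]; exact gc 0 (by omega)
    · simp only [if_neg (show ¬ i ≤ n by omega), if_neg (show ¬ i + 1 ≤ n by omega)]
      have := gc (i - n) (by omega)
      rwa [show i + 1 - n = i - n + 1 by omega]

lemma sect_map (K : Type u) [CommRing K] [IsArtinianRing K] [Algebra K R] [Module.Finite K R]
    (n : ℕ) (c : ℕ → ARVertex R) (h1 : ∀ i < n, ARArrow (c i) (c (i + 1)))
    (h2 : ∀ i, i + 1 < n → ¬ TauRel (c i) (c (i + 2))) :
    ∃ φ : (rep (c 0)).M →ₗ[R] (rep (c n)).M, φ ≠ 0 ∧ φ ∈ radPow R n (rep (c 0)) (rep (c n)) := by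
  have hex : ∀ i, ∃ f : (rep (c i)).M →ₗ[R] (rep (c (i + 1))).M, i < n → IsIrred f := by
    intro i
    by_cases hi : i < n
    · obtain ⟨f, hf⟩ := arr_iff.1 (h1 i hi)
      exact ⟨f, fun _ => hf⟩
    · exact ⟨0, fun h => absurd h hi⟩
  choose f hf using hex
  obtain ⟨φ, hφ⟩ := PC.exists (X := fun i => rep (c i)) (f := f) n
  refine ⟨φ, ?_, ?_⟩
  · exact sect_ne_zero K (fun i => rep_indec _) hf (fun i hi h => h2 i hi (tau_iff.2 h)) n le_rfl φ hφ
  · exact PC.radPow (fun i hi => (inRad_iff (rep_indec _) (rep_indec _) _).2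
      (isIrred_not_bij (hf i hi))) n le_rfl φ hφ

lemma no_inf_cycle {x a b : ARVertex R} (hx : IsCycleFiniteVertex x)
    (hbx : ReflTransGen ARArrow b x) (hxa : ReflTransGen ARArrow x a)
    (φ : (rep a).M →ₗ[R] (rep b).M) (h0 : φ ≠ 0) (hinf : InRadInf φ) : False := by
  obtain ⟨n, c, hc0, hcn, hc, k, hk, hck⟩ := rtg_path2 hbx hxa
  subst hc0
  let o : ℕ → ModA R := fun i => match i with
    | 0 => rep a
    | i + 1 => rep (c i)
  have hex : ∀ i, ∃ f : (o i).M →ₗ[R] (o (i + 1)).M,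
      (i < n + 1 → f ≠ 0 ∧ ¬ Bijective f) ∧ (i = 0 → InRadInf f) := by
    intro i
    cases i with
    | zero => exact ⟨φ, fun _ => ⟨h0, radPow_one_not_bij (rep_indec _) (hinf 1)⟩, fun _ => hinf⟩
    | succ i =>
      by_cases hi : i < n
      · obtain ⟨f, hf⟩ := arr_iff.1 (hc i hi)
        exact ⟨f, fun _ => ⟨irred_ne_zero (rep_indec _) (rep_indec _) hf, isIrred_not_bij hf⟩,
          fun h => by omega⟩
      · exact ⟨0, fun h => by omega, fun h => by omega⟩
  choose F hF1 hF2 using hex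
  let cy : ModCycle R :=
    { len := n + 1
      len_pos := Nat.succ_pos n
      obj := fun i => o i.1
      obj_indec := by
        rintro ⟨i, hi⟩
        cases i with
        | zero => exact rep_indec _
        | succ i => exact rep_indec _
      closed := by
        show rep (c n) = rep a
        rw [hcn]
      hom := fun i => F i.1
      hom_ne_zero := fun i => (hF1 i.1 i.2).1
      hom_not_iso := fun i => (hF1 i.1 i.2).2 }
  obtain ⟨X, hX, -, h2⟩ := hx
  refine h2 cy ⟨⟨k + 1, by show k + 1 < n + 1 + 1; omega⟩, ?_⟩ ⟨0, Nat.succ_pos n⟩ (hF2 0 rfl)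
  show (rep (c k)).Iso X.1
  rw [hck]
  exact Iso.symm' (rep_iso hX)

lemma sect_bound (K : Type u) [CommRing K] [IsArtinianRing K] [Algebra K R] [Module.Finite K R]
    {x a b : ARVertex R} (hx : IsCycleFiniteVertex x)
    (hbx : ReflTransGen ARArrow b x) (hxa : ReflTransGen ARArrow x a) :
    ∃ L, ∀ (n : ℕ) (c : ℕ → ARVertex R), (∀ i < n, ARArrow (c i) (c (i + 1))) →
      (∀ i, i + 1 < n → ¬ TauRel (c i) (c (i + 2))) → c 0 = a → c n = b → n ≤ L := by
  obtain ⟨m, hm⟩ := radPow_stab K (rep a) (rep b)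
  refine ⟨m, fun n c h1 h2 ha hb => ?_⟩
  by_contra hlt
  obtain ⟨φ, h0, hφ⟩ := sect_map K n c h1 h2
  subst ha
  subst hb
  exact no_inf_cycle hx hbx hxa φ h0 (hm φ (radPow_anti _ _ (by omega) hφ))

end Cyc
end CF

namespace CF
open Function Relation
set_option linter.all false

section Glue
variable {R : Type u} [Ring R]

lemma arr_mid_l (s : AlmostSplitSeq R) {x z : ARVertex R} (h : s.l.Iso (rep x)) :
    ARArrow x z ↔ Retr (rep z) s.m := by
  rw [arr_iff]
  constructor
  · rintro ⟨f, hf⟩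
    obtain ⟨f', hf'⟩ := isIrred_iso (Iso.symm' h) (Iso.refl' (rep z)) hf
    obtain ⟨h1, h2, -⟩ := retr_of_irred_las (seq_las s) hf'
    exact Retr.of_splitEpi h2
  · intro hr
    obtain ⟨t, p, hp⟩ := hr.split
    exact isIrred_iso h (Iso.refl' (rep z))
      (irred_of_las (rep_indec z) s.l_indec (seq_las s) (seq_lmin s) ⟨t, hp⟩)

lemma arr_mid_r (s : AlmostSplitSeq R) {y z : ARVertex R} (h : s.r.Iso (rep y)) :
    ARArrow z y ↔ Retr (rep z) s.m := by
  rw [arr_iff]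
  constructor
  · rintro ⟨f, hf⟩
    obtain ⟨f', hf'⟩ := isIrred_iso (Iso.refl' (rep z)) (Iso.symm' h) hf
    obtain ⟨h1, h2, -⟩ := retr_of_irred_ras (seq_ras s) hf'
    exact Retr.of_splitMono h2
  · intro hr
    obtain ⟨t, p, hp⟩ := hr.split
    exact isIrred_iso (Iso.refl' (rep z)) h
      (irred_of_ras (rep_indec z) s.r_indec (seq_ras s) (seq_rmin s) ⟨p, hp⟩)

lemma proj_iff (K : Type u) [CommRing K] [IsArtinianRing K] [Algebra K R] [Module.Finite K R]
    (p : ARVertex R) : IsProjVertex p ↔ ¬ ∃ x, TauRel x p := by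
  constructor
  · rintro ⟨X, hX, hp⟩ ⟨x, hx⟩
    obtain ⟨s, h1, h2⟩ := tau_iff.1 hx
    haveI := proj_iso (Iso.trans' (rep_iso hX) (Iso.symm' h2)) hp
    obtain ⟨t, ht⟩ := Module.projective_lifting_property s.g LinearMap.id s.surj
    exact s.not_split ⟨t, ht⟩
  · intro h
    refine ⟨⟨rep p, rep_indec p⟩, mk_rep p, ?_⟩
    by_contra hn
    obtain ⟨s, hs⟩ := exists_seq_right K (rep p) (rep_indec p) hn
    refine h ⟨ARVertex.mk ⟨s.l, s.l_indec⟩, tau_iff.2 ⟨s, rep_iso (X := ⟨s.l, s.l_indec⟩) rfl, ?_⟩⟩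
    rw [hs]; exact Iso.refl' _

lemma inj_iff (K : Type u) [CommRing K] [IsArtinianRing K] [Algebra K R] [Module.Finite K R]
    (p : ARVertex R) : IsInjVertex p ↔ ¬ ∃ x, TauRel p x := by
  constructor
  · rintro ⟨X, hX, hp⟩ ⟨x, hx⟩
    obtain ⟨s, h1, h2⟩ := tau_iff.1 hx
    have hi := inj_iso (Iso.trans' (rep_iso hX) (Iso.symm' h1)) hp
    obtain ⟨t, ht⟩ := hi.out s.f s.inj LinearMap.id
    exact (seq_las s).1 ⟨t, LinearMap.ext ht⟩
  · intro h
    refine ⟨⟨rep p, rep_indec p⟩, mk_rep p, ?_⟩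
    by_contra hn
    obtain ⟨s, hs⟩ := exists_seq_left K (rep p) (rep_indec p) hn
    refine h ⟨ARVertex.mk ⟨s.r, s.r_indec⟩, tau_iff.2 ⟨s, ?_, rep_iso (X := ⟨s.r, s.r_indec⟩) rfl⟩⟩
    rw [hs]; exact Iso.refl' _

/-- the Auslander-Reiten quiver as an abstract translation quiver -/
noncomputable def arTQ (K : Type u) [CommRing K] [IsArtinianRing K] (R : Type u) [Ring R]
    [Algebra K R] [Module.Finite K R] : TQ (ARVertex R) where
  arr := ARArrow
  tau := TauRel
  len x := mlen (rep x)
  tau_fun := by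
    intro x x' y h h'
    obtain ⟨s, h1, h2⟩ := tau_iff.1 h
    obtain ⟨t, h3, h4⟩ := tau_iff.1 h'
    exact rep_inj (Iso.trans' (Iso.symm' h1)
      (Iso.trans' (seq_uniq_l s t (Iso.trans' h2 (Iso.symm' h4))) h3))
  tau_inj := by
    intro x y y' h h'
    obtain ⟨s, h1, h2⟩ := tau_iff.1 h
    obtain ⟨t, h3, h4⟩ := tau_iff.1 h'
    exact rep_inj (Iso.trans' (Iso.symm' h2)
      (Iso.trans' (seq_uniq_r s t (Iso.trans' h1 (Iso.symm' h3))) h4))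
  arr_tau := by
    intro x y h z
    obtain ⟨s, h1, h2⟩ := tau_iff.1 h
    rw [arr_mid_l s h1, arr_mid_r s h2]
  pred_ne := by
    intro x y h
    obtain ⟨s, h1, h2⟩ := tau_iff.1 h
    obtain ⟨d⟩ := exists_dec s.m
    have hne : Nonempty d.I := by
      by_contra hc
      rw [not_nonempty_iff] at hc
      have h3 := d.mlen_eq
      rw [Finset.univ_eq_empty, Finset.sum_empty, seq_len] at h3
      have := mlen_pos_of_indec s.l_indec
      omega
    obtain ⟨j⟩ := hne
    refine ⟨ARVertex.mk ⟨d.S j, d.indec j⟩, ?_⟩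
    rw [arr_mid_r s h2]
    obtain ⟨e⟩ : (d.S j).Iso (rep (ARVertex.mk ⟨d.S j, d.indec j⟩)) :=
      rep_iso (X := ⟨d.S j, d.indec j⟩) rfl
    refine Retr.of_splitMono (h := (d.i j).comp e.symm.toLinearMap)
      ⟨e.toLinearMap.comp (d.p j), ?_⟩
    ext w
    have := LinearMap.congr_fun (d.pi_self j) (e.symm w)
    simp only [LinearMap.comp_apply, LinearMap.id_apply, LinearEquiv.coe_coe] at this ⊢
    rw [this, e.apply_symm_apply]
  proj_fin := by
    obtain ⟨N, hN⟩ := proj_vertices K (R := R)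
    refine (retr_finite N).subset ?_
    intro p hp
    obtain ⟨X, hX, h⟩ := (proj_iff K p).2 hp
    exact ⟨X, hX, hN X.1 X.2 h⟩
  inj_fin := by
    obtain ⟨N, hN⟩ := inj_vertices K (R := R)
    refine (retr_finite N).subset ?_
    intro p hp
    obtain ⟨X, hX, h⟩ := (inj_iff K p).2 hp
    exact ⟨X, hX, hN X.1 X.2 h⟩
  pred_fin := by
    intro y
    obtain ⟨E, g, hg⟩ := exists_ras K (rep y) (rep_indec y)
    refine (retr_finite E).subset ?_
    intro p hp
    obtain ⟨f, hf⟩ := arr_iff.1 hp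
    obtain ⟨h, hh, -⟩ := retr_of_irred_ras hg hf
    exact ⟨⟨rep p, rep_indec p⟩, mk_rep p, Retr.of_splitMono hh⟩
  succ_fin := by
    intro y
    obtain ⟨E, g, hg⟩ := exists_las K (rep y) (rep_indec y)
    refine (retr_finite E).subset ?_
    intro p hp
    obtain ⟨f, hf⟩ := arr_iff.1 hp
    obtain ⟨h, hh, -⟩ := retr_of_irred_las hg hf
    exact ⟨⟨rep p, rep_indec p⟩, mk_rep p, Retr.of_splitEpi hh⟩
  len_pos x := mlen_pos_of_indec (rep_indec x)
  mesh := by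
    intro x y h S hS
    obtain ⟨s, h1, h2⟩ := tau_iff.1 h
    have h3 := sum_mlen_le S (fun z => rep z) (fun z _ => rep_indec z) s.m
      (fun z hz => (arr_mid_r s h2).1 (hS z hz)) (fun a _ b _ hab => rep_inj hab)
    rw [seq_len, mlen_iso h1, mlen_iso h2] at h3
    exact h3
  hs := by
    intro b
    have hp : 0 < 2 ^ b := by positivity
    refine ⟨2 ^ b - 1, fun c h1 h2 => ?_⟩
    by_contra hc
    push Not at hc
    have hex : ∀ i, ∃ f : (rep (c i)).M →ₗ[R] (rep (c (i + 1))).M, i < 2 ^ b - 1 → IsIrred f := by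
      intro i
      by_cases hi : i < 2 ^ b - 1
      · obtain ⟨f, hf⟩ := arr_iff.1 (h1 i hi)
        exact ⟨f, fun _ => hf⟩
      · exact ⟨0, fun h => absurd h hi⟩
    choose f hf using hex
    obtain ⟨φ, hφ⟩ := PC.exists (X := fun i => rep (c i)) (f := f) (2 ^ b - 1)
    refine sect_ne_zero K (fun i => rep_indec _) hf (fun i hi h => h2 i hi (tau_iff.2 h)) _ le_rfl
      φ hφ ?_
    exact harada_sai_zero (fun i _ => rep_indec _) (fun i hi => hc i (by omega))
      (fun i hi => isIrred_not_bij (hf i (by omega))) φ hφ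

theorem final (K : Type u) [CommRing K] [IsArtinianRing K] [Algebra K R] [Module.Finite K R]
    (C : Set (ARVertex R)) (hC : IsARComponent C)
    (Sig : Set (ARVertex R)) (hsub : Sig ⊆ C) (hinf : Sig.Infinite)
    (hcf : ∀ x ∈ Sig, IsCycleFiniteVertex x) :
    (∃ D : Set (ARVertex R), IsComponentOf (stablePart C) D ∧ IsStableTube D ∧
      (D ∩ Sig).Infinite) ∨
    (∃ D : Set (ARVertex R), IsComponentOf (leftStable C) D ∧
      (∃ x ∈ D, OnCycleIn D x) ∧ (∃ x ∈ D, IsInjVertex x) ∧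
      ({x ∈ D | OnCycleIn D x} ∩ Sig).Infinite) ∨
    (∃ D : Set (ARVertex R), IsComponentOf (rightStable C) D ∧
      (∃ x ∈ D, OnCycleIn D x) ∧ (∃ x ∈ D, IsProjVertex x) ∧
      ({x ∈ D | OnCycleIn D x} ∩ Sig).Infinite) := by
  let T := arTQ K R
  have hL : leftStable C = C ∩ T.LS := by
    ext x
    show (x ∈ C ∧ ¬∃ y, TauConn x y ∧ IsProjVertex y) ↔
      (x ∈ C ∧ ¬∃ y, TauConn x y ∧ ¬∃ z, TauRel z y)
    simp only [proj_iff K]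
  have hR : rightStable C = C ∩ T.op.LS := by
    ext x
    show (x ∈ C ∧ ¬∃ y, TauConn x y ∧ IsInjVertex y) ↔
      (x ∈ C ∧ ¬∃ y, T.op.conn x y ∧ ¬∃ z, TauRel y z)
    simp only [inj_iff K]
    have : ∀ y, T.op.conn x y ↔ TauConn x y := fun y => TQ.conn_op
    simp only [this]
  have hcyc : ∀ x ∈ Sig, TransGen T.arr x x := fun x hx => cyc_of_cf K (hcf x hx)
  have hbd : ∀ x ∈ Sig, ∀ a ∈ T.cls x, ∀ b ∈ T.cls x,
      ∃ L, ∀ n c, T.Sec n c → c 0 = a → c n = b → n ≤ L := by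
    intro x hx a ha b hb
    obtain ⟨L, hL⟩ := sect_bound K (hcf x hx) hb.2 ha.1
    exact ⟨L, fun n c h => hL n c h.1 h.2⟩
  have hC' : T.IsComp Set.univ C := hC
  rcases TQ.main hC' hsub hinf hcyc hbd with ⟨D, h1, h2, h3⟩ | ⟨D, h1, h2, h3, h4⟩ |
    ⟨D, h1, h2, h3, h4⟩
  · left
    refine ⟨D, ?_, ?_, h3⟩
    · unfold stablePart; rw [hL, hR]; exact h1
    · obtain ⟨r, φ, g1, g2, g3, g4, g5⟩ := h2
      exact ⟨r, φ, g1, g2, g3, fun u v => (g4 u v).2, fun u v => (g4 u v).1, g5⟩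
  · right; left
    refine ⟨D, ?_, h2, ?_, h4⟩
    · rw [hL]; exact h1
    · obtain ⟨y, hy, hy'⟩ := h3
      exact ⟨y, hy, (inj_iff K y).2 hy'⟩
  · right; right
    have hop : ∀ x, T.op.OnCyc D x ↔ OnCycleIn D x := fun x => TQ.onCyc_op
    refine ⟨D, ?_, ?_, ?_, ?_⟩
    · rw [hR]; exact TQ.isComp_op.1 h1
    · obtain ⟨x, hx, hx'⟩ := h2
      exact ⟨x, hx, (hop x).1 hx'⟩
    · obtain ⟨y, hy, hy'⟩ := h3
      exact ⟨y, hy, (proj_iff K y).2 hy'⟩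
    · simpa only [hop] using h4

end Glue
end CF

/-- **Proposition (infinite families of cycle-finite modules).** Let `A` be a basic
indecomposable artin algebra, `C` a connected component of `Γ_A`, and `Sig` an infinite
family of cycle-finite modules in `C`. Then one of the following holds:
(i) the stable part of `C` contains a stable tube with infinitely many modules from `Sig`;
(ii) the left stable part of `C` contains a component `D` with an oriented cycle and an
injective module whose cyclic part contains infinitely many modules from `Sig`;
(iii) the right stable part of `C` contains a component `D` with an oriented cycle and a
projective module whose cyclic part contains infinitely many modules from `Sig`. -/
theorem infinite_cycle_finite_family_trichotomy
    (K A : Type u) [CommRing K] [IsArtinianRing K] [Ring A] [Algebra K A]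
    [Module.Finite K A] (hbasic : IsBasicAlgebra A) (hconn : IsConnectedAlgebra A)
    (C : Set (ARVertex Aᵐᵒᵖ)) (hC : IsARComponent C)
    (Sig : Set (ARVertex Aᵐᵒᵖ)) (hsub : Sig ⊆ C) (hinf : Sig.Infinite)
    (hcf : ∀ x ∈ Sig, IsCycleFiniteVertex x) :
    (∃ D : Set (ARVertex Aᵐᵒᵖ), IsComponentOf (stablePart C) D ∧ IsStableTube D ∧
      (D ∩ Sig).Infinite) ∨
    (∃ D : Set (ARVertex Aᵐᵒᵖ), IsComponentOf (leftStable C) D ∧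
      (∃ x ∈ D, OnCycleIn D x) ∧ (∃ x ∈ D, IsInjVertex x) ∧
      ({x ∈ D | OnCycleIn D x} ∩ Sig).Infinite) ∨
    (∃ D : Set (ARVertex Aᵐᵒᵖ), IsComponentOf (rightStable C) D ∧
      (∃ x ∈ D, OnCycleIn D x) ∧ (∃ x ∈ D, IsProjVertex x) ∧
      ({x ∈ D | OnCycleIn D x} ∩ Sig).Infinite) := by
  haveI : Module.Finite K Aᵐᵒᵖ := Module.Finite.equiv (MulOpposite.opLinearEquiv K)
  exact CF.final K C hC Sig hsub hinf hcf
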